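/- Let p be a prime with either 5 < p < 1000 and p ≡ 5 (mod 24), or p ∈ {131, 251, 491, 971}. Then there exist no coprime positive integers x, y and integer m > 0 such that x² + 3^(2m) = 2·y^p. (Equivalently, for p ∈ {29, 53, 101, 131, 149, 173, 197, 251, 269, 293, 317, 389, 461, 491, 509, 557, 653, 677, 701, 773, 797, 821, 941, 971} the equation x² + 3^(2m) = 2·y^p has no coprime solution with m > 0.) -/

import Mathlib

/-- `δ₄ = 1` if `p ≡ 1 (mod 4)` and `δ₄ = -1` if `p ≡ 3 (mod 4)`. -/
def d4 (p : ℕ) : ℤ := if p % 4 = 1 then 1 else -1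

/-- `δ₈ = 1` if `p ≡ 1, 3 (mod 8)` and `δ₈ = -1` if `p ≡ 5, 7 (mod 8)`. -/
def d8 (p : ℕ) : ℤ := if p % 8 = 1 ∨ p % 8 = 3 then 1 else -1

/-- `F_p(u,v) = Re((1+i)(u+iv)^p)`. -/
def Ffun (p : ℕ) (u v : ℤ) : ℤ :=
  ((⟨1, 1⟩ : GaussianInt) * (⟨u, v⟩ : GaussianInt) ^ p).re

/-- `G_p(u,v) = Im((1+i)(u+iv)^p)`. -/
def Gfun (p : ℕ) (u v : ℤ) : ℤ :=
  ((⟨1, 1⟩ : GaussianInt) * (⟨u, v⟩ : GaussianInt) ^ p).im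

/-- `H_p(u,v) = G_p(u,v)/(u + δ₄ v)` (exact division whenever `u + δ₄ v ≠ 0`). -/
def Hfun (p : ℕ) (u v : ℤ) : ℤ := Gfun p u v / (u + d4 p * v)


lemma unit_pow_odd (u : GaussianInt) (hu : IsUnit u) (p : ℕ) (hp : p % 2 = 1) :
    ∃ v : GaussianInt, v ^ p = u := by
  have h4 : u ^ 4 = 1 := by
    have hn : u.norm.natAbs = 1 := Zsqrtd.norm_eq_one_iff.mpr hu
    have hn0 : 0 ≤ u.norm := GaussianInt.norm_nonneg u
    have hn1 : u.norm = 1 := by omega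
    obtain ⟨a, b⟩ := u
    rw [Zsqrtd.norm_def] at hn1
    simp only at hn1
    have hab : a * b = 0 := by
      by_contra h
      have h1 : a ≠ 0 := left_ne_zero_of_mul h
      have h2 : b ≠ 0 := right_ne_zero_of_mul h
      have := Int.one_le_abs h1
      have := Int.one_le_abs h2
      nlinarith [abs_mul_abs_self a, abs_mul_abs_self b]
    have e : (⟨a, b⟩ : GaussianInt) ^ 4 = (⟨a, b⟩ * ⟨a, b⟩) * (⟨a, b⟩ * ⟨a, b⟩) := by ring
    rw [e]
    ext
    · simp [Zsqrtd.re_mul, Zsqrtd.im_mul]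
      linear_combination (a * a + b * b + 1) * hn1 - 8 * (a * b) * hab
    · simp [Zsqrtd.re_mul, Zsqrtd.im_mul]
      linear_combination 4 * (a * a - b * b) * hab
  have key : ∀ r : ℕ, u ^ (4 * r + 1) = u := by
    intro r; rw [pow_add, pow_mul, h4]; simp
  rcases (by omega : p % 4 = 1 ∨ p % 4 = 3) with h | h
  · refine ⟨u, ?_⟩
    have := key (p / 4)
    rwa [show 4 * (p / 4) + 1 = p by omega] at this
  · refine ⟨u ^ 3, ?_⟩
    rw [← pow_mul]
    have := key ((3 * p) / 4)
    rwa [show 4 * ((3 * p) / 4) + 1 = 3 * p by omega] at this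

lemma gauss_root (p x y m : ℕ) (hp : p % 2 = 1) (hm : 0 < m) (hxy : Nat.gcd x y = 1)
    (h : x ^ 2 + 3 ^ (2 * m) = 2 * y ^ p) :
    y % 2 = 1 ∧ y % 3 ≠ 0 ∧ ∃ α : GaussianInt, α.norm = y ∧
      (⟨x, 3 ^ m⟩ : GaussianInt) = ⟨1, 1⟩ * α ^ p := by
  have h3odd : (3 ^ m) % 2 = 1 := by
    rw [Nat.pow_mod]; simp
  have h9 : (3 : ℕ) ^ (2 * m) = (3 ^ m) ^ 2 := by rw [mul_comm, pow_mul]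
  rw [h9] at h
  set t := 3 ^ m with ht
  obtain ⟨t', ht'⟩ : ∃ t', t = 2 * t' + 1 := ⟨t / 2, by omega⟩
  have hxodd : x % 2 = 1 := by
    have : (x ^ 2 + t ^ 2) % 2 = 0 := by rw [h]; simp
    rcases Nat.mod_two_eq_zero_or_one x with h0 | h0
    · simp [Nat.add_mod, Nat.pow_mod, h0, h3odd] at this
    · exact h0
  obtain ⟨x', hx'⟩ : ∃ x', x = 2 * x' + 1 := ⟨x / 2, by omega⟩
  have hyp : (y ^ p) % 2 = 1 := by
    have : 2 * y ^ p = 2 * (2 * (x' * x' + x' + t' * t' + t') + 1) := by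
      rw [← h, hx', ht']; ring
    omega
  have hyodd : y % 2 = 1 := by
    rcases Nat.mod_two_eq_zero_or_one y with h0 | h0
    · rw [Nat.pow_mod, h0, Nat.zero_pow (by omega)] at hyp; simp at hyp
    · exact h0
  have h3t : 3 ∣ t := dvd_pow_self 3 (by omega)
  have hx3 : ¬ 3 ∣ x := by
    intro hx
    have : 3 ∣ 2 * y ^ p := by
      rw [← h]; exact dvd_add (dvd_pow hx (by norm_num)) (dvd_pow h3t (by norm_num))
    have h2 : 3 ∣ y := by
      rcases (Nat.prime_three.dvd_mul).mp this with h | h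
      · omega
      · exact Nat.prime_three.dvd_of_dvd_pow h
    have := Nat.dvd_gcd hx h2
    rw [hxy] at this; omega
  have hy3 : y % 3 ≠ 0 := by
    intro hy
    have hy : 3 ∣ y := Nat.dvd_of_mod_eq_zero hy
    apply hx3
    have : 3 ∣ x ^ 2 + t ^ 2 := by
      rw [h]; exact Dvd.dvd.mul_left (dvd_pow hy (by omega)) _
    exact Nat.prime_three.dvd_of_dvd_pow ((Nat.dvd_add_left (dvd_pow h3t (by norm_num))).mp this)
  refine ⟨hyodd, hy3, ?_⟩
  have hcop : IsCoprime (x : ℤ) (t : ℤ) := by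
    apply Nat.isCoprime_iff_coprime.mpr
    rw [ht]
    apply Nat.Coprime.pow_right
    exact ((Nat.Prime.coprime_iff_not_dvd Nat.prime_three).mpr hx3).symm
  -- w = a + b i
  obtain ⟨a, ha⟩ : ∃ a : ℤ, a = x' + t' + 1 := ⟨_, rfl⟩
  obtain ⟨b, hb⟩ : ∃ b : ℤ, b = t' - x' := ⟨_, rfl⟩
  have hxa : (x : ℤ) = a - b := by rw [hx', ha, hb]; push_cast; ring
  have hta : (t : ℤ) = a + b := by rw [ht', ha, hb]; push_cast; ring
  have hab : a ^ 2 + b ^ 2 = (y : ℤ) ^ p := by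
    have : (x : ℤ) ^ 2 + (t : ℤ) ^ 2 = 2 * (y : ℤ) ^ p := by exact_mod_cast h
    rw [hxa, hta] at this
    linarith
  have habc : IsCoprime a b := by
    obtain ⟨u, v, huv⟩ := hcop
    rw [hxa, hta] at huv
    exact ⟨u + v, v - u, by linarith⟩
  set w : GaussianInt := ⟨a, b⟩ with hw
  set w' : GaussianInt := ⟨a, -b⟩ with hw'
  have hmul : w * w' = (y : GaussianInt) ^ p := by
    have : (y : GaussianInt) ^ p = (((y : ℤ) ^ p : ℤ) : GaussianInt) := by push_cast; rfl
    rw [this, ← hab]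
    ext <;> simp [hw, hw', Zsqrtd.re_mul, Zsqrtd.im_mul, pow_two] <;> ring
  have hcw : IsCoprime w w' := by
    obtain ⟨u, v, huv⟩ := habc
    obtain ⟨c, hc⟩ : ∃ c : ℕ, y ^ p = 2 * c + 1 := ⟨y ^ p / 2, by omega⟩
    have hc' : a ^ 2 + b ^ 2 = 2 * (c : ℤ) + 1 := by rw [hab]; exact_mod_cast hc
    refine ⟨w' - ⟨c, 0⟩ * (⟨u, 0⟩ - ⟨0, v⟩), - ⟨c, 0⟩ * (⟨u, 0⟩ + ⟨0, v⟩), ?_⟩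
    ext
    · simp [hw, hw', Zsqrtd.re_mul, Zsqrtd.im_mul]
      linear_combination hc' - 2 * (c : ℤ) * huv
    · simp [hw, hw', Zsqrtd.re_mul, Zsqrtd.im_mul]
      ring
  obtain ⟨d, u, hd⟩ := exists_associated_pow_of_mul_eq_pow' hcw hmul
  obtain ⟨v, hv⟩ := unit_pow_odd (u : GaussianInt) u.isUnit p hp
  have hwd : w = (d * v) ^ p := by rw [mul_pow, hv, hd]
  refine ⟨d * v, ?_, ?_⟩
  · have hn : ((d * v).norm) ^ p = (y : ℤ) ^ p := by
      rw [← hab]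
      have : ((d * v) ^ p).norm = (d * v).norm ^ p :=
        map_pow (Zsqrtd.normMonoidHom (d := -1)) (d * v) p
      rw [← this, ← hwd, hw, Zsqrtd.norm_def]; ring
    exact (pow_left_inj₀ (GaussianInt.norm_nonneg _) (by positivity) (by omega)).mp hn
  · rw [← hwd]
    have e : (3 : ℤ) ^ m = a + b := by rw [← hta, ht]; push_cast; rfl
    ext
    · simp [hw, Zsqrtd.re_mul, hxa]; ring
    · simp [hw, Zsqrtd.im_mul, e]; ring



/-- The sequence `W n = U_{2n+1}`. -/
def Wseq (s y : ℤ) : ℕ → ℤ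
  | 0 => 1
  | 1 => s + y
  | n + 2 => s * Wseq s y (n + 1) - y ^ 2 * Wseq s y n

lemma gauss_pow_im (A B s y : ℤ) (hs : s = A ^ 2 - B ^ 2) (hy : 2 * y = A ^ 2 + B ^ 2) (n : ℕ) :
    ((⟨A, B⟩ : GaussianInt) ^ (2 * n + 1)).im = B * 2 ^ n * Wseq s y n := by
  have hrec : ∀ z : GaussianInt, (z * (⟨A, B⟩ : GaussianInt) ^ 4).im =
      2 * s * (z * (⟨A, B⟩ : GaussianInt) ^ 2).im - 4 * y ^ 2 * z.im := by
    intro z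
    obtain ⟨a, b⟩ := z
    have e4 : (⟨A, B⟩ : GaussianInt) ^ 4 = (⟨A, B⟩ * ⟨A, B⟩) * (⟨A, B⟩ * ⟨A, B⟩) := by ring
    rw [e4, pow_two]
    have : 4 * y ^ 2 = (A ^ 2 + B ^ 2) ^ 2 := by rw [← hy]; ring
    rw [this, hs]
    simp [Zsqrtd.re_mul, Zsqrtd.im_mul]
    ring
  induction n using Nat.twoStepInduction with
  | zero => simp [Wseq]
  | one =>
    have e3 : (⟨A, B⟩ : GaussianInt) ^ (2 * 1 + 1) = (⟨A, B⟩ * ⟨A, B⟩) * ⟨A, B⟩ := by ring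
    rw [e3]
    simp [Wseq, Zsqrtd.re_mul, Zsqrtd.im_mul]
    rw [hs]
    linear_combination (-B) * hy
  | more n ih1 ih2 =>
    have h := hrec (⟨A, B⟩ ^ (2 * n + 1))
    rw [← pow_add, ← pow_add] at h
    rw [show 2 * (n + 2) + 1 = 2 * n + 1 + 4 by ring, h, ih1,
      show 2 * n + 1 + 2 = 2 * (n + 1) + 1 by ring, ih2]
    simp only [Wseq]
    ring

lemma Wseq_cong (q s y s' y' : ℤ) (hs : s ≡ s' [ZMOD q]) (hy : y ≡ y' [ZMOD q]) (n : ℕ) :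
    Wseq s y n ≡ Wseq s' y' n [ZMOD q] := by
  induction n using Nat.twoStepInduction with
  | zero => rfl
  | one => exact hs.add hy
  | more n ih1 ih2 => exact (hs.mul ih2).sub ((hy.pow 2).mul ih1)

lemma Wseq_case1 (n : ℕ) : Wseq 1 (-1) (n + 3) = - Wseq 1 (-1) n := by
  induction n using Nat.twoStepInduction with
  | zero => simp [Wseq]
  | one => simp [Wseq]
  | more n ih1 ih2 =>
    have e1 : Wseq 1 (-1) (n + 2 + 3) = 1 * Wseq 1 (-1) (n + 1 + 3) - (-1) ^ 2 * Wseq 1 (-1) (n + 3) := rfl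
    have e2 : Wseq 1 (-1) (n + 2) = 1 * Wseq 1 (-1) (n + 1) - (-1) ^ 2 * Wseq 1 (-1) n := rfl
    rw [e1, e2, ih1, ih2]; ring

lemma Wseq_case1' (n j : ℕ) : Wseq 1 (-1) (6 * j + n) = Wseq 1 (-1) n := by
  induction j with
  | zero => simp
  | succ j ih =>
    rw [show 6 * (j + 1) + n = (6 * j + n + 3) + 3 by ring, Wseq_case1, Wseq_case1, ih]; ring

lemma Wseq_case2 (n : ℕ) : Wseq (-1) (-1) n ≡ 1 [ZMOD 3] := by
  induction n using Nat.twoStepInduction with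
  | zero => rfl
  | one => rfl
  | more n ih1 ih2 =>
    have : Wseq (-1) (-1) (n + 2) ≡ (-1) * 1 - (-1) ^ 2 * 1 [ZMOD 3] :=
      (ih2.mul_left _).sub (ih1.mul_left _)
    exact this.trans (by decide)

lemma Wseq_case3 (n : ℕ) : Wseq 0 1 n = 1 ∨ Wseq 0 1 n = -1 := by
  induction n using Nat.twoStepInduction with
  | zero => left; rfl
  | one => left; rfl
  | more n ih1 ih2 =>
    have : Wseq 0 1 (n + 2) = 0 * Wseq 0 1 (n + 1) - 1 ^ 2 * Wseq 0 1 n := rfl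
    rw [this]
    rcases ih1 with h | h <;> rw [h] <;> simp

/-- The basic data extracted from a solution. -/
structure Sol (k m : ℕ) (ε A s y : ℤ) : Prop where
  hy : 2 * y = A ^ 2 + (3 ^ m) ^ 2
  hs : s = A ^ 2 - (3 ^ m) ^ 2
  hm : 0 < m
  hpos : 0 < y
  hW : Wseq s y k = ε
  hs3 : s ≡ 1 [ZMOD 3]
  hy3 : y ≡ 2 [ZMOD 3]

lemma exists_sol (p x y m k : ℕ) (ε : ℤ) (hpk : p = 2 * k + 1)
    (hp : (p % 24 = 5 ∧ ε = -1) ∨ (p % 24 = 11 ∧ ε = 1))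
    (hm : 0 < m) (hxy : Nat.gcd x y = 1)
    (h : x ^ 2 + 3 ^ (2 * m) = 2 * y ^ p) : ∃ A s y : ℤ, Sol k m ε A s y := by
  obtain ⟨hyodd, hy3, α, hα, hz⟩ := gauss_root p x y m (by omega) hm hxy h
  set z : GaussianInt := ⟨x, 3 ^ m⟩ with hzdef
  -- γ
  obtain ⟨γ, hγn, hγ⟩ : ∃ γ : GaussianInt, γ.norm = 2 * y ∧ γ ^ p = ((ε * 2 ^ k : ℤ) : GaussianInt) * z := by
    have h2i : (⟨1, 1⟩ : GaussianInt) ^ 2 = 2 * ⟨0, 1⟩ := by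
      rw [pow_two]; ext <;> simp [Zsqrtd.re_mul, Zsqrtd.im_mul]
    have hi2 : (⟨0, 1⟩ : GaussianInt) ^ 2 = -1 := by
      rw [pow_two]; ext <;> simp [Zsqrtd.re_mul, Zsqrtd.im_mul]
    have hg : (⟨1, 1⟩ * α) ^ p = 2 ^ k * ⟨0, 1⟩ ^ k * z := by
      rw [hz, mul_pow, hpk, pow_succ (⟨1, 1⟩ : GaussianInt), pow_mul (⟨1, 1⟩ : GaussianInt), h2i, mul_pow]
      ring
    have hn1 : (⟨1, 1⟩ * α : GaussianInt).norm = 2 * y := by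
      rw [Zsqrtd.norm_mul, hα]; simp [Zsqrtd.norm_def]
    have hi4 : ∀ r j : ℕ, (⟨0, 1⟩ : GaussianInt) ^ (4 * r + j) = ⟨0, 1⟩ ^ j := by
      intro r j
      rw [pow_add, show 4 * r = 2 * (2 * r) by ring, pow_mul, hi2, pow_mul]; simp
    rcases hp with ⟨hp, he⟩ | ⟨hp, he⟩
    · refine ⟨⟨1, 1⟩ * α, hn1, ?_⟩
      rw [hg, show k = 4 * (k / 4) + 2 by omega, hi4, hi2, he]
      push_cast; ring
    · refine ⟨⟨0, 1⟩ * (⟨1, 1⟩ * α), ?_, ?_⟩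
      · rw [Zsqrtd.norm_mul, hn1]; simp [Zsqrtd.norm_def]
      · rw [mul_pow, hg, show k = 4 * (k / 4) + 1 by omega, hi4,
          show p = 4 * (p / 4) + 3 by omega, hi4, he]
        push_cast
        have : (⟨0, 1⟩ : GaussianInt) ^ 3 * ⟨0, 1⟩ ^ 1 = 1 := by
          rw [← pow_add, show 3 + 1 = 2 * 2 by rfl, pow_mul, hi2]; ring
        linear_combination (2 ^ (4 * (k / 4) + 1) * z) * this
  obtain ⟨A, B⟩ := γ
  have hy2 : 2 * (y : ℤ) = A ^ 2 + B ^ 2 := by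
    rw [← hγn, Zsqrtd.norm_def]; ring
  have him : B * Wseq (A ^ 2 - B ^ 2) y k = ε * 3 ^ m := by
    have h1 := gauss_pow_im A B _ y rfl hy2 k
    rw [← hpk, hγ] at h1
    have h2 : (((ε * 2 ^ k : ℤ) : GaussianInt) * z).im = ε * 2 ^ k * 3 ^ m := by
      rw [Zsqrtd.im_mul, Zsqrtd.re_intCast, Zsqrtd.im_intCast]; simp [hzdef]
    rw [h2] at h1
    have h2k : (2 : ℤ) ^ k ≠ 0 := by positivity
    apply mul_left_cancel₀ h2k
    linear_combination -h1
  have hA3 : A % 3 = 0 ∨ A % 3 = 1 ∨ A % 3 = 2 := by omega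
  have hB3 : B % 3 = 0 ∨ B % 3 = 1 ∨ B % 3 = 2 := by omega
  have sq0 : ∀ t : ℤ, t % 3 = 0 → t ^ 2 ≡ 0 [ZMOD 3] := fun t ht => by
    have : t ≡ 0 [ZMOD 3] := ht
    exact this.pow 2
  have sq1 : ∀ t : ℤ, (t % 3 = 1 ∨ t % 3 = 2) → t ^ 2 ≡ 1 [ZMOD 3] := fun t ht => by
    rcases ht with ht | ht
    · have : t ≡ 1 [ZMOD 3] := ht
      exact this.pow 2
    · have : t ≡ 2 [ZMOD 3] := ht
      exact (this.pow 2).trans (by decide)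
  have hε : ε = 1 ∨ ε = -1 := by tauto
  have hWn : ¬ (3 : ℤ) ∣ Wseq (A ^ 2 - B ^ 2) y k := by
    intro hd
    have hd : Wseq (A ^ 2 - B ^ 2) y k ≡ 0 [ZMOD 3] := Int.modEq_zero_iff_dvd.mpr hd
    rcases hA3 with hA | hA <;> rcases hB3 with hB | hB
    · have e1 := sq0 A hA
      have e2 := sq0 B hB
      unfold Int.ModEq at e1 e2
      omega
    · have e1 := sq0 A hA
      have e2 := sq1 B hB
      have := Wseq_cong 3 (A ^ 2 - B ^ 2) y (-1) (-1) (e1.sub e2) (by unfold Int.ModEq at *; omega) k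
      have := (Wseq_case2 k).symm.trans (this.symm.trans hd)
      exact absurd this (by decide)
    · have e1 := sq1 A hA
      have e2 := sq0 B hB
      have := Wseq_cong 3 (A ^ 2 - B ^ 2) y 1 (-1) (e1.sub e2) (by unfold Int.ModEq at *; omega) k
      have := this.symm.trans hd
      rw [show k = 6 * (k / 6) + k % 6 by omega, Wseq_case1'] at this
      rcases (by omega : k % 6 = 2 ∨ k % 6 = 5) with h | h <;> rw [h] at this <;>
        exact absurd this (by decide)
    · have e1 := sq1 A hA
      have e2 := sq1 B hB
      have := Wseq_cong 3 (A ^ 2 - B ^ 2) y 0 1 (e1.sub e2) (by unfold Int.ModEq at *; omega) k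
      have := this.symm.trans hd
      rcases Wseq_case3 k with h | h <;> rw [h] at this <;> exact absurd this (by decide)
  have hWu : IsUnit (Wseq (A ^ 2 - B ^ 2) y k) := by
    have hc : IsCoprime (Wseq (A ^ 2 - B ^ 2) y k) (3 ^ m) :=
      ((Int.prime_three.coprime_iff_not_dvd).mpr hWn).symm.pow_right
    apply hc.isUnit_of_dvd' dvd_rfl
    have : Wseq (A ^ 2 - B ^ 2) y k ∣ ε * 3 ^ m := ⟨B, by rw [← him]; ring⟩
    rcases hε with h | h <;> rw [h] at this <;> simpa using this
  have hB2 : B ^ 2 = (3 ^ m) ^ 2 := by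
    have h1 : (B * Wseq (A ^ 2 - B ^ 2) y k) ^ 2 = (ε * 3 ^ m) ^ 2 := by rw [him]
    have h2 : Wseq (A ^ 2 - B ^ 2) y k ^ 2 = 1 := by
      rcases Int.isUnit_iff.mp hWu with h | h <;> rw [h] <;> norm_num
    have h3 : ε ^ 2 = 1 := by rcases hε with h | h <;> rw [h] <;> norm_num
    rw [mul_pow, mul_pow, h2, h3] at h1
    linarith
  have e2 : B ^ 2 ≡ 0 [ZMOD 3] := by
    rw [hB2, ← pow_mul]
    exact Int.modEq_zero_iff_dvd.mpr (dvd_pow_self 3 (by omega))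
  have e1 : A ^ 2 ≡ 1 [ZMOD 3] := by
    rcases hA3 with hA | hA
    · exfalso
      have e1 := sq0 A hA
      unfold Int.ModEq at e1 e2
      omega
    · exact sq1 A hA
  have hs3 : A ^ 2 - B ^ 2 ≡ 1 [ZMOD 3] := e1.sub e2
  have hy3' : (y : ℤ) ≡ 2 [ZMOD 3] := by unfold Int.ModEq at *; omega
  refine ⟨A, A ^ 2 - B ^ 2, y, by rw [hy2, hB2], by rw [hB2], hm, by omega, ?_, hs3, hy3'⟩
  have hc := Wseq_cong 3 (A ^ 2 - B ^ 2) y 1 (-1) hs3 (hy3'.trans (by decide)) k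
  rw [show k = 6 * (k / 6) + k % 6 by omega, Wseq_case1', ← show k = 6 * (k / 6) + k % 6 by omega] at hc
  rcases hp with ⟨hp, he⟩ | ⟨hp, he⟩
  · rw [show k % 6 = 2 by omega] at hc
    rcases Int.isUnit_iff.mp hWu with h | h
    · rw [h] at hc; exact absurd hc (by decide)
    · rw [h, he]
  · rw [show k % 6 = 5 by omega] at hc
    rcases Int.isUnit_iff.mp hWu with h | h
    · rw [h, he]
    · rw [h] at hc; exact absurd hc (by decide)



open Polynomial in
/-- `f` is a difference of two polynomials with natural coefficients, of total mass at most `b`. -/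
def Maj (f : ℤ[X]) (b : ℕ) : Prop :=
  ∃ f1 f2 : ℕ[X], f = f1.map (Nat.castRingHom ℤ) - f2.map (Nat.castRingHom ℤ) ∧
    f1.eval 1 + f2.eval 1 ≤ b

section Majorants
open Polynomial

lemma Maj.mono {f : ℤ[X]} {b c : ℕ} (h : Maj f b) (hbc : b ≤ c) : Maj f c := by
  obtain ⟨f1, f2, h1, h2⟩ := h
  exact ⟨f1, f2, h1, h2.trans hbc⟩

lemma Maj.add {f g : ℤ[X]} {b c : ℕ} (hf : Maj f b) (hg : Maj g c) : Maj (f + g) (b + c) := by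
  obtain ⟨f1, f2, h1, h2⟩ := hf
  obtain ⟨g1, g2, h3, h4⟩ := hg
  refine ⟨f1 + g1, f2 + g2, ?_, ?_⟩
  · rw [h1, h3, Polynomial.map_add, Polynomial.map_add]; ring
  · rw [eval_add, eval_add]; omega

lemma Maj.neg {f : ℤ[X]} {b : ℕ} (hf : Maj f b) : Maj (-f) b := by
  obtain ⟨f1, f2, h1, h2⟩ := hf
  exact ⟨f2, f1, by rw [h1]; ring, by omega⟩

lemma Maj.sub {f g : ℤ[X]} {b c : ℕ} (hf : Maj f b) (hg : Maj g c) : Maj (f - g) (b + c) := by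
  rw [sub_eq_add_neg]; exact hf.add hg.neg

lemma Maj.mul {f g : ℤ[X]} {b c : ℕ} (hf : Maj f b) (hg : Maj g c) : Maj (f * g) (b * c) := by
  obtain ⟨f1, f2, h1, h2⟩ := hf
  obtain ⟨g1, g2, h3, h4⟩ := hg
  refine ⟨f1 * g1 + f2 * g2, f1 * g2 + f2 * g1, ?_, ?_⟩
  · rw [h1, h3]; simp only [Polynomial.map_add, Polynomial.map_mul]; ring
  · simp only [eval_add, eval_mul]
    calc _ = (f1.eval 1 + f2.eval 1) * (g1.eval 1 + g2.eval 1) := by ring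
      _ ≤ _ := Nat.mul_le_mul h2 h4

lemma Maj.pow2 {f : ℤ[X]} {b : ℕ} (hf : Maj f b) : Maj (f ^ 2) (b ^ 2) := by
  rw [pow_two, pow_two]; exact hf.mul hf

lemma maj_X : Maj (X : ℤ[X]) 1 := ⟨X, 0, by simp, by simp⟩

lemma maj_int (a : ℤ) : Maj (a : ℤ[X]) a.natAbs := by
  rcases Int.natAbs_eq a with h | h
  · refine ⟨(a.natAbs : ℕ[X]), 0, ?_, by simp⟩
    conv_lhs => rw [h]
    simp
  · refine ⟨0, (a.natAbs : ℕ[X]), ?_, by simp⟩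
    conv_lhs => rw [h]
    simp

lemma coeff_le_eval_one (f : ℕ[X]) (n : ℕ) : f.coeff n ≤ f.eval 1 := by
  rw [eval_eq_sum, Polynomial.sum]
  by_cases h : n ∈ f.support
  · simpa using Finset.single_le_sum (f := fun i => f.coeff i) (fun i _ => Nat.zero_le _) h
  · rw [notMem_support_iff.mp h]; exact Nat.zero_le _

lemma Maj.coeff_le {f : ℤ[X]} {b : ℕ} (hf : Maj f b) (n : ℕ) : |f.coeff n| ≤ b := by
  obtain ⟨f1, f2, h1, h2⟩ := hf
  have e1 := coeff_le_eval_one f1 n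
  have e2 := coeff_le_eval_one f2 n
  rw [h1]
  simp only [coeff_sub, coeff_map, eq_natCast]
  rw [abs_le]
  constructor <;> omega

lemma Maj.eq_zero {f : ℤ[X]} {b : ℕ} (hf : Maj f b) (K : ℤ) (hK : (b : ℤ) < K)
    (h0 : f.eval K = 0) : f = 0 := by
  have key : ∀ n, f.coeff n = 0 := by
    intro n
    induction n using Nat.strong_induction_on with
    | _ n ih =>
    have hd : X ^ n ∣ f := X_pow_dvd_iff.mpr ih
    obtain ⟨g, hg⟩ := hd
    have hc : f.coeff n = g.coeff 0 := by
      rw [hg, coeff_X_pow_mul']; simp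
    have hKpos : 0 < K := by omega
    have hgK : g.eval K = 0 := by
      rw [hg, eval_mul, eval_pow, eval_X] at h0
      exact (mul_eq_zero.mp h0).resolve_left (pow_ne_zero _ hKpos.ne')
    have hdv : K - 0 ∣ g.eval K - g.eval 0 := sub_dvd_eval_sub K 0 g
    rw [hgK, sub_zero, zero_sub, dvd_neg, ← coeff_zero_eq_eval_zero, ← hc] at hdv
    exact Int.eq_zero_of_abs_lt_dvd hdv ((hf.coeff_le n).trans_lt hK)
  ext n
  simp [key n]

end Majorants

/-- Homogeneous Horner scheme, leading coefficients first. -/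
def hor {R : Type*} [CommRing R] (s y : R) : List ℤ → R → R → R
  | [], v, _ => v
  | a :: l, v, w => hor s y l (v * s + (a : R) * w) (w * y)

def l1 : List ℤ → ℕ
  | [] => 0
  | a :: l => a.natAbs + l1 l

lemma hor_map {R S : Type*} [CommRing R] [CommRing S] (φ : R →+* S) (s y : R) (l : List ℤ) (v w : R) :
    φ (hor s y l v w) = hor (φ s) (φ y) l (φ v) (φ w) := by
  induction l generalizing v w with
  | nil => rfl
  | cons a l ih => simp [hor, ih]

lemma hor_scale {R : Type*} [CommRing R] (T y : R) (l : List ℤ) (v w : R) :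
    hor (T * y) y l (w * v) (w * y) = w * y ^ l.length * hor T 1 l v 1 := by
  induction l generalizing v w with
  | nil => simp [hor]
  | cons a l ih =>
    simp only [hor, List.length_cons]
    have : w * v * (T * y) + (a : R) * (w * y) = (w * y) * (v * T + a) := by ring
    rw [this, ih, pow_succ]
    simp only [mul_one]
    ring

open Polynomial in
lemma hor_maj (l : List ℤ) (v : ℤ[X]) (b : ℕ) (hv : Maj v b) :
    Maj (hor X 1 l v 1) (b + l1 l) := by
  induction l generalizing v b with
  | nil => simpa [hor, l1] using hv
  | cons a l ih =>
    simp only [hor, l1, mul_one]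
    have := ih (v * X + (a : ℤ[X])) (b * 1 + a.natAbs) ((hv.mul maj_X).add (maj_int a))
    exact this.mono (by omega)

lemma hor_cong (q s y s' y' : ℤ) (hs : s ≡ s' [ZMOD q]) (hy : y ≡ y' [ZMOD q]) (l : List ℤ)
    (v v' w w' : ℤ) (hv : v ≡ v' [ZMOD q]) (hw : w ≡ w' [ZMOD q]) :
    hor s y l v w ≡ hor s' y' l v' w' [ZMOD q] := by
  induction l generalizing v w v' w' with
  | nil => exact hv
  | cons a l ih =>
    exact ih _ _ _ _ ((hv.mul hs).add (hw.mul_left _)) (hw.mul hy)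

/-- `q_0 = 1`, `q_1 = T + 1`, `q_{n+2} = T q_{n+1} - q_n`. -/
def qseq {R : Type*} [CommRing R] (T : R) : ℕ → R
  | 0 => 1
  | 1 => T + 1
  | n + 2 => T * qseq T (n + 1) - qseq T n

lemma qseq_map {R S : Type*} [CommRing R] [CommRing S] (φ : R →+* S) (T : R) (n : ℕ) :
    φ (qseq T n) = qseq (φ T) n := by
  induction n using Nat.twoStepInduction with
  | zero => simp [qseq]
  | one => simp [qseq]
  | more n ih1 ih2 => simp [qseq, ih1, ih2]

open Polynomial in
lemma qseq_maj (n : ℕ) : Maj (qseq (X : ℤ[X]) n) (2 ^ n) := by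
  have h1 : Maj (1 : ℤ[X]) 1 := by simpa using maj_int 1
  induction n using Nat.twoStepInduction with
  | zero => simpa [qseq] using h1
  | one => exact (maj_X.add h1).mono (by norm_num)
  | more n ih1 ih2 =>
    refine ((maj_X.mul ih2).sub ih1).mono ?_
    rw [pow_succ, pow_succ]; omega

lemma Wseq_eq_qseq (s y : ℤ) (T : ℚ) (hT : (s : ℚ) = T * y) (n : ℕ) :
    ((Wseq s y n : ℤ) : ℚ) = (y : ℚ) ^ n * qseq T n := by
  induction n using Nat.twoStepInduction with
  | zero => simp [Wseq, qseq]
  | one => simp [Wseq, qseq, hT]; ring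
  | more n ih1 ih2 =>
    simp only [Wseq, qseq]
    push_cast
    rw [ih1, ih2, hT]; ring

lemma hor_rat (s y : ℤ) (T : ℚ) (hT : (s : ℚ) = T * y) (a : ℤ) (l : List ℤ) :
    ((hor s y l a y : ℤ) : ℚ) = (y : ℚ) ^ l.length * hor T 1 l (a : ℚ) 1 := by
  have := hor_map (Int.castRingHom ℚ) s y l a y
  simp only [eq_intCast] at this
  rw [this, hT]
  have := hor_scale T (y : ℚ) l (a : ℚ) 1
  simpa using this

open Polynomial in
lemma hor_aeval (T : ℚ) (a : ℤ) (l : List ℤ) :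
    aeval T (hor (X : ℤ[X]) 1 l (a : ℤ[X]) 1) = hor T 1 l (a : ℚ) 1 := by
  have := hor_map (aeval (R := ℤ) T).toRingHom (X : ℤ[X]) 1 l (a : ℤ[X]) 1
  simpa using this

open Polynomial in
lemma hor_eval (K : ℤ) (a : ℤ) (l : List ℤ) :
    eval K (hor (X : ℤ[X]) 1 l (a : ℤ[X]) 1) = hor K 1 l a 1 := by
  have := hor_map (evalRingHom K) (X : ℤ[X]) 1 l (a : ℤ[X]) 1
  simpa using this

open Polynomial in
/-- Identity of type `Y² - p Z² = 4 ψ`. -/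
lemma ident5 (p : ℕ) (k : ℕ) (Ya Za : ℤ) (Yl Zl : List ℤ) (K : ℤ)
    (hK : (((Ya.natAbs + l1 Yl) ^ 2 + p * (Za.natAbs + l1 Zl) ^ 2 + 4 * 2 ^ k : ℕ) : ℤ) < K)
    (hev : hor K 1 Yl Ya 1 ^ 2 - p * hor K 1 Zl Za 1 ^ 2 - 4 * qseq K k = 0)
    (hYl : 2 * Yl.length = k) (hZl : 2 * Zl.length = k) (s y : ℤ) (hy : y ≠ 0) :
    hor s y Yl Ya y ^ 2 - p * hor s y Zl Za y ^ 2 = 4 * Wseq s y k := by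
  set f : ℤ[X] := hor X 1 Yl (Ya : ℤ[X]) 1 ^ 2 - ((p : ℤ) : ℤ[X]) * hor X 1 Zl (Za : ℤ[X]) 1 ^ 2
    - ((4 : ℤ) : ℤ[X]) * qseq X k with hf
  have hM : Maj f ((Ya.natAbs + l1 Yl) ^ 2 + p * (Za.natAbs + l1 Zl) ^ 2 + 4 * 2 ^ k) :=
    (((hor_maj Yl _ _ (maj_int Ya)).pow2).sub ((maj_int p).mul (hor_maj Zl _ _ (maj_int Za)).pow2)).sub
      ((maj_int 4).mul (qseq_maj k))
  have h0 : f = 0 := by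
    apply hM.eq_zero K hK
    rw [← hev, hf]
    have hq := qseq_map (evalRingHom K) X k
    simp only [coe_evalRingHom, eval_X] at hq
    simp only [eval_sub, eval_mul, eval_pow, hor_eval, eval_intCast, hq]
    simp
  set T : ℚ := (s : ℚ) / y with hTdef
  have hy' : (y : ℚ) ≠ 0 := by exact_mod_cast hy
  have hT : (s : ℚ) = T * y := by rw [hTdef]; field_simp
  have h1 : aeval T f = 0 := by rw [h0]; simp
  have hq := qseq_map (aeval (R := ℤ) T).toRingHom X k
  simp at hq
  rw [hf] at h1
  simp only [map_sub, map_mul, map_pow, hor_aeval, map_intCast, hq] at h1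
  have : ((hor s y Yl Ya y ^ 2 - p * hor s y Zl Za y ^ 2 : ℤ) : ℚ) = ((4 * Wseq s y k : ℤ) : ℚ) := by
    push_cast
    rw [hor_rat s y T hT, hor_rat s y T hT, Wseq_eq_qseq s y T hT]
    have e1 : (y : ℚ) ^ k = (y ^ Yl.length) ^ 2 := by rw [← pow_mul, ← hYl, mul_comm]
    have e2 : Zl.length = Yl.length := by omega
    rw [e1, e2]
    push_cast at h1
    linear_combination ((y : ℚ) ^ Yl.length) ^ 2 * h1
  exact_mod_cast this

open Polynomial in
/-- Identity of type `(T-2) g² + p (T+2) f² = 4 ψ`. -/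
lemma ident11 (p : ℕ) (k : ℕ) (Ya Za : ℤ) (Yl Zl : List ℤ) (K : ℤ)
    (hK : ((3 * (Ya.natAbs + l1 Yl) ^ 2 + p * (3 * (Za.natAbs + l1 Zl) ^ 2) + 4 * 2 ^ k : ℕ) : ℤ) < K)
    (hev : (K - 2) * hor K 1 Yl Ya 1 ^ 2 + p * ((K + 2) * hor K 1 Zl Za 1 ^ 2) - 4 * qseq K k = 0)
    (hYl : 2 * Yl.length + 1 = k) (hZl : 2 * Zl.length + 1 = k) (s y : ℤ) (hy : y ≠ 0) :
    (s - 2 * y) * hor s y Yl Ya y ^ 2 + p * ((s + 2 * y) * hor s y Zl Za y ^ 2) = 4 * Wseq s y k := by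
  set f : ℤ[X] := (X - ((2 : ℤ) : ℤ[X])) * hor X 1 Yl (Ya : ℤ[X]) 1 ^ 2
    + ((p : ℤ) : ℤ[X]) * ((X + ((2 : ℤ) : ℤ[X])) * hor X 1 Zl (Za : ℤ[X]) 1 ^ 2)
    - ((4 : ℤ) : ℤ[X]) * qseq X k with hf
  have hM : Maj f (3 * (Ya.natAbs + l1 Yl) ^ 2 + p * (3 * (Za.natAbs + l1 Zl) ^ 2) + 4 * 2 ^ k) :=
    (((maj_X.sub (maj_int 2)).mul (hor_maj Yl _ _ (maj_int Ya)).pow2).add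
      ((maj_int p).mul ((maj_X.add (maj_int 2)).mul (hor_maj Zl _ _ (maj_int Za)).pow2))).sub
      ((maj_int 4).mul (qseq_maj k))
  have h0 : f = 0 := by
    apply hM.eq_zero K hK
    rw [← hev, hf]
    have hq := qseq_map (evalRingHom K) X k
    simp only [coe_evalRingHom, eval_X] at hq
    simp only [eval_sub, eval_add, eval_X, eval_mul, eval_pow, hor_eval, eval_intCast, hq]
    simp
  set T : ℚ := (s : ℚ) / y with hTdef
  have hy' : (y : ℚ) ≠ 0 := by exact_mod_cast hy
  have hT : (s : ℚ) = T * y := by rw [hTdef]; field_simp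
  have h1 : aeval T f = 0 := by rw [h0]; simp
  have hq := qseq_map (aeval (R := ℤ) T).toRingHom X k
  simp at hq
  rw [hf] at h1
  simp only [map_sub, map_add, aeval_X, map_mul, map_pow, hor_aeval, map_intCast, hq] at h1
  have : (((s - 2 * y) * hor s y Yl Ya y ^ 2 + p * ((s + 2 * y) * hor s y Zl Za y ^ 2) : ℤ) : ℚ)
      = ((4 * Wseq s y k : ℤ) : ℚ) := by
    push_cast
    rw [hor_rat s y T hT, hor_rat s y T hT, Wseq_eq_qseq s y T hT, hT]
    have e1 : (y : ℚ) ^ k = (y ^ Yl.length) ^ 2 * y := by rw [← pow_mul, ← hYl, pow_succ, mul_comm 2]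
    have e2 : Zl.length = Yl.length := by omega
    rw [e1, e2]
    push_cast at h1
    linear_combination ((y : ℚ) ^ Yl.length) ^ 2 * y * h1
  exact_mod_cast this



lemma dichotomy_aux (p u v Q : ℕ) (hp : Nat.Prime p) (hc : Nat.Coprime u v) (h : u * v = p * Q ^ 2) :
    (∃ r, v = r ^ 2) ∨ (∃ r t, u = r ^ 2 ∧ v = p * t ^ 2) := by
  have hpd : p ∣ u * v := ⟨_, h⟩
  rcases hp.dvd_mul.mp hpd with ⟨c, hc1⟩ | ⟨c, hc1⟩
  · left
    have h2 : v * c = Q ^ 2 := by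
      apply Nat.eq_of_mul_eq_mul_left hp.pos
      rw [← h, hc1]; ring
    have hcop : Nat.Coprime v c := by
      apply Nat.Coprime.symm
      exact Nat.Coprime.coprime_dvd_left ⟨p, by rw [hc1]; ring⟩ hc
    obtain ⟨d, hd⟩ := exists_associated_pow_of_mul_eq_pow (Nat.isUnit_iff.mpr hcop) h2
    exact ⟨d, (associated_iff_eq.mp hd).symm⟩
  · right
    have h2 : u * c = Q ^ 2 := by
      apply Nat.eq_of_mul_eq_mul_left hp.pos
      rw [← h, hc1]; ring
    have hcop : Nat.Coprime u c := Nat.Coprime.coprime_dvd_right ⟨p, by rw [hc1]; ring⟩ hc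
    obtain ⟨d, hd⟩ := exists_associated_pow_of_mul_eq_pow (Nat.isUnit_iff.mpr hcop) h2
    obtain ⟨e, he⟩ := exists_associated_pow_of_mul_eq_pow (Nat.isUnit_iff.mpr hcop.symm)
      ((mul_comm c u).trans h2)
    exact ⟨d, e, (associated_iff_eq.mp hd).symm, by rw [hc1, (associated_iff_eq.mp he).symm]⟩

lemma sq_mod3 (r : ℕ) : r ^ 2 % 3 ≠ 2 := by
  have : r % 3 = 0 ∨ r % 3 = 1 ∨ r % 3 = 2 := by omega
  rcases this with h | h | h <;> simp [Nat.pow_mod, h]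

lemma dichotomy_nat (p a Q : ℕ) (hp : Nat.Prime p) (hp4 : p % 4 = 1) (h3 : a % 3 = 0)
    (h : a ^ 2 = p * Q ^ 2 + 4) : ∃ r t, a = r ^ 2 + 2 ∧ a + 2 = p * t ^ 2 := by
  have ha2 : 2 ≤ a := by nlinarith
  obtain ⟨b, rfl⟩ : ∃ b, a = b + 2 := ⟨a - 2, by omega⟩
  have hb : b * (b + 4) = p * Q ^ 2 := by nlinarith
  rcases Nat.mod_two_eq_zero_or_one b with hb2 | hb2
  · obtain ⟨c, rfl⟩ : ∃ c, b = 2 * c := ⟨b / 2, by omega⟩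
    -- Q even
    have hQ : Q % 2 = 0 := by
      by_contra hQ
      obtain ⟨e, rfl⟩ : ∃ e, Q = 2 * e + 1 := ⟨Q / 2, by omega⟩
      obtain ⟨f, rfl⟩ : ∃ f, p = 4 * f + 1 := ⟨p / 4, by omega⟩
      have : (2 * c) * (2 * c + 4) = 4 * (c * (c + 2)) := by ring
      have h2 : (4 * f + 1) * (2 * e + 1) ^ 2 = 4 * (f * (2 * e + 1) ^ 2 + e * e + e) + 1 := by ring
      omega
    obtain ⟨e, rfl⟩ : ∃ e, Q = 2 * e := ⟨Q / 2, by omega⟩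
    have h1 : c * (c + 2) = p * e ^ 2 := by nlinarith
    have hc : c % 2 = 0 := by
      by_contra hc
      obtain ⟨c', rfl⟩ : ∃ c', c = 2 * c' + 1 := ⟨c / 2, by omega⟩
      obtain ⟨f, rfl⟩ : ∃ f, p = 4 * f + 1 := ⟨p / 4, by omega⟩
      have h2 : (2 * c' + 1) * (2 * c' + 1 + 2) = 4 * (c' * c' + 2 * c') + 3 := by ring
      rcases Nat.even_or_odd' e with ⟨e', rfl | rfl⟩
      · have : (4 * f + 1) * (2 * e') ^ 2 = 4 * ((4 * f + 1) * e' ^ 2) := by ring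
        omega
      · have : (4 * f + 1) * (2 * e' + 1) ^ 2 = 4 * (f * (2 * e' + 1) ^ 2 + e' * e' + e') + 1 := by ring
        omega
    obtain ⟨u, rfl⟩ : ∃ u, c = 2 * u := ⟨c / 2, by omega⟩
    have he : e % 2 = 0 := by
      by_contra he
      obtain ⟨e', rfl⟩ : ∃ e', e = 2 * e' + 1 := ⟨e / 2, by omega⟩
      obtain ⟨f, rfl⟩ : ∃ f, p = 4 * f + 1 := ⟨p / 4, by omega⟩
      have : (2 * u) * (2 * u + 2) = 4 * (u * (u + 1)) := by ring
      have h2 : (4 * f + 1) * (2 * e' + 1) ^ 2 = 4 * (f * (2 * e' + 1) ^ 2 + e' * e' + e') + 1 := by ring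
      omega
    obtain ⟨g, rfl⟩ : ∃ g, e = 2 * g := ⟨e / 2, by omega⟩
    have h2 : u * (u + 1) = p * g ^ 2 := by nlinarith
    rcases dichotomy_aux p u (u + 1) g hp (by simp) h2 with ⟨r, hr⟩ | ⟨r, t, hr, ht⟩
    · exfalso
      have := sq_mod3 r
      omega
    · exact ⟨2 * r, 2 * t, by rw [hr]; ring, by
        have : 2 * (2 * u) + 2 + 2 = 4 * (u + 1) := by ring
        rw [this, ht]; ring⟩
  · have hcop : Nat.Coprime b (b + 4) := by
      have : Nat.Coprime b (2 ^ 2) := by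
        apply Nat.Coprime.pow_right
        exact Nat.coprime_two_right.mpr (Nat.odd_iff.mpr hb2)
      simpa using this
    rcases dichotomy_aux p b (b + 4) Q hp hcop hb with ⟨r, hr⟩ | ⟨r, t, hr, ht⟩
    · exfalso
      have := sq_mod3 r
      omega
    · exact ⟨r, t, by rw [hr], by omega⟩

lemma dichotomy (p : ℕ) (P Q : ℤ) (hp : Nat.Prime p) (hp4 : p % 4 = 1) (h3 : P % 3 = 0)
    (h : P ^ 2 - p * Q ^ 2 = 4) :
    ∃ e r t : ℤ, (e = 1 ∨ e = -1) ∧ e * P = r ^ 2 + 2 ∧ e * P + 2 = p * t ^ 2 := by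
  have h' : P.natAbs ^ 2 = p * Q.natAbs ^ 2 + 4 := by
    zify; rw [sq_abs, sq_abs]; linarith
  obtain ⟨r, t, h1, h2⟩ := dichotomy_nat p P.natAbs Q.natAbs hp hp4 (by omega) h'
  zify at h1 h2
  rcases abs_choice P with hP | hP <;> rw [hP] at h1 h2
  · exact ⟨1, r, t, Or.inl rfl, by linarith, by linarith⟩
  · exact ⟨-1, r, t, Or.inr rfl, by linarith, by linarith⟩

/-- Final algebraic consequence in the case `p ≡ 1 (mod 4)`. -/
lemma pell5 (p : ℕ) (hp : Nat.Prime p) (hp4 : p % 4 = 1) (Y Z Y0 Z0 : ℤ)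
    (h : Y ^ 2 - p * Z ^ 2 = -4) (h0 : Y0 ^ 2 - p * Z0 ^ 2 = -4)
    (h3 : (Y0 * Y - p * (Z0 * Z)) % 3 = 0) :
    ∃ e r t : ℤ, (e = 1 ∨ e = -1) ∧ e * (Y0 * Y - p * (Z0 * Z)) = 2 * (r ^ 2 + 2) ∧
      e * (Y0 * Y - p * (Z0 * Z)) + 4 = 2 * (p * t ^ 2) := by
  obtain ⟨f, hf⟩ : ∃ f : ℤ, (p : ℤ) = 2 * f + 1 := ⟨(p / 2 : ℕ), by omega⟩
  have par : ∀ y z : ℤ, y ^ 2 - p * z ^ 2 = -4 → ∃ c, y = z + 2 * c := by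
    intro y z h
    rcases Int.even_or_odd' y with ⟨a, ha | ha⟩ <;> rcases Int.even_or_odd' z with ⟨b, hb | hb⟩
    · exact ⟨a - b, by omega⟩
    · exfalso
      rw [ha, hb, hf] at h
      have : 2 * (2 * a ^ 2 - f * (2 * b + 1) ^ 2 - 2 * b ^ 2 - 2 * b + 2) = 1 := by linarith
      omega
    · exfalso
      rw [ha, hb, hf] at h
      have : 2 * (2 * a ^ 2 + 2 * a - (2 * f + 1) * 2 * b ^ 2 + 2) = -1 := by linarith
      omega
    · exact ⟨a - b, by omega⟩
  obtain ⟨c, hc⟩ := par Y Z h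
  obtain ⟨d, hd⟩ := par Y0 Z0 h0
  obtain ⟨P, hP⟩ : ∃ P, Y0 * Y - p * (Z0 * Z) = 2 * P :=
    ⟨-f * Z0 * Z + Z0 * c + d * Z + 2 * c * d, by rw [hc, hd, hf]; ring⟩
  obtain ⟨Q, hQ⟩ : ∃ Q, Y0 * Z - Z0 * Y = 2 * Q :=
    ⟨d * Z - Z0 * c, by rw [hc, hd]; ring⟩
  have hPQ : P ^ 2 - p * Q ^ 2 = 4 := by
    have : (2 * P) ^ 2 - p * (2 * Q) ^ 2 = 16 := by
      rw [← hP, ← hQ]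
      linear_combination (Y0 ^ 2 - p * Z0 ^ 2) * h - 4 * h0
    linarith
  obtain ⟨e, r, t, he, h1, h2⟩ := dichotomy p P Q hp hp4 (by omega) hPQ
  exact ⟨e, r, t, he, by rw [hP]; linarith, by rw [hP]; linarith⟩

/-- Pell solutions congruent to `1` modulo `q`. -/
def congOne (d q : ℤ) : Subgroup (Pell.Solution₁ d) where
  carrier := {a | q ∣ a.x - 1 ∧ q ∣ a.y}
  one_mem' := by simp
  mul_mem' := by
    rintro a b ⟨h1, h2⟩ ⟨h3, h4⟩
    constructor
    · rw [Pell.Solution₁.x_mul]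
      have : a.x * b.x + d * (a.y * b.y) - 1 = (a.x - 1) * b.x + (b.x - 1) + (d * b.y) * a.y := by ring
      rw [this]
      exact dvd_add (dvd_add (h1.mul_right _) h3) (h2.mul_left _)
    · rw [Pell.Solution₁.y_mul]
      exact dvd_add (h4.mul_left _) (h2.mul_right _)
  inv_mem' := by
    rintro a ⟨h1, h2⟩
    exact ⟨by rw [Pell.Solution₁.x_inv]; exact h1, by rw [Pell.Solution₁.y_inv]; exact (dvd_neg).mpr h2⟩

/-- If `α ≡ 1 (mod q)` and some solution `ξ` has `ξ^(4·3^i) ≡ 1` but `ξ^4 ≢ 1`, then `α` is a cube. -/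
lemma pell_cube (d q : ℤ) (hd0 : 0 < d) (hd : ¬ IsSquare d) (α ξ : Pell.Solution₁ d) (i : ℕ)
    (hα : α ∈ congOne d q) (hξ : ξ ^ (4 * 3 ^ i) ∈ congOne d q) (hξ4 : ξ ^ 4 ∉ congOne d q) :
    ∃ β : Pell.Solution₁ d, α = β ^ 3 := by
  obtain ⟨u, hu⟩ := Pell.IsFundamental.exists_of_not_isSquare hd0 hd
  obtain ⟨n, hn⟩ := hu.eq_zpow_or_neg_zpow α
  obtain ⟨κ, hκ⟩ := hu.eq_zpow_or_neg_zpow ξ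
  by_cases h3 : (3 : ℤ) ∣ n
  · obtain ⟨c, rfl⟩ := h3
    rcases hn with hn | hn
    · exact ⟨u ^ c, by rw [hn, mul_comm, zpow_mul]; norm_cast⟩
    · refine ⟨-(u ^ c), ?_⟩
      rw [hn, Odd.neg_pow (by decide), mul_comm, zpow_mul]; norm_cast
  · exfalso
    apply hξ4
    have hα2 : α ^ 2 = u ^ (2 * n) := by
      rcases hn with hn | hn
      · rw [hn, mul_comm, zpow_mul]; norm_cast
      · rw [hn, Even.neg_pow (by decide), mul_comm, zpow_mul]; norm_cast
    have hξ2 : ξ ^ 2 = u ^ (2 * κ) := by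
      rcases hκ with hκ | hκ
      · rw [hκ, mul_comm, zpow_mul]; norm_cast
      · rw [hκ, Even.neg_pow (by decide), mul_comm, zpow_mul]; norm_cast
    have h1 : (ξ ^ 2) ^ n ∈ congOne d q := by
      have : (ξ ^ 2) ^ n = (α ^ 2) ^ κ := by
        rw [hα2, hξ2, ← zpow_mul, ← zpow_mul]; congr 1; ring
      rw [this]
      exact Subgroup.zpow_mem _ (Subgroup.pow_mem _ hα 2) κ
    have hg : IsCoprime n ((3 : ℤ) ^ i) :=
      ((Int.prime_three.coprime_iff_not_dvd).mpr h3).symm.pow_right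
    obtain ⟨a, b, hab⟩ := hg
    have e : ξ ^ 4 = (((ξ ^ 2) ^ n) ^ 2) ^ a * (ξ ^ (4 * 3 ^ i)) ^ b := by
      have e1 : (((ξ ^ 2) ^ n) ^ 2) ^ a = ξ ^ (4 * (n * a)) := by
        rw [← zpow_natCast, ← zpow_natCast, ← zpow_mul, ← zpow_mul, ← zpow_mul]; congr 1; push_cast; ring
      have e2 : (ξ ^ (4 * 3 ^ i)) ^ b = ξ ^ (4 * (3 ^ i * b) : ℤ) := by
        rw [← zpow_natCast, ← zpow_mul]; congr 1; push_cast; ring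
      rw [e1, e2, ← zpow_add]
      have : 4 * (n * a) + 4 * (3 ^ i * b) = 4 := by linear_combination 4 * hab
      rw [this]; norm_cast
    rw [e]
    exact Subgroup.mul_mem _ (Subgroup.zpow_mem _ (Subgroup.pow_mem _ h1 2) a) (Subgroup.zpow_mem _ hξ b)



/-- Identity in disguise: forces the evaluation of its first argument. -/
def frc {α : Type*} (n : ℕ) (f : ℕ → α) : α :=
  match n with
  | 0 => f 0
  | k + 1 => f (k + 1)

lemma frc_eq {α : Type*} (n : ℕ) (f : ℕ → α) : frc n f = f n := by
  cases n <;> rfl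

def frcI {α : Type*} (v : ℤ) (f : ℤ → α) : α :=
  match v with
  | Int.ofNat n => frc n (fun n => f (Int.ofNat n))
  | Int.negSucc n => frc n (fun n => f (Int.negSucc n))

lemma frcI_eq {α : Type*} (n : ℤ) (f : ℤ → α) : frcI n f = f n := by
  cases n <;> simp [frcI, frc_eq]

/-- Kernel-friendly evaluation of `hor K 1 l v 1`. -/
def horK (K : ℤ) : List ℤ → ℤ → ℤ
  | [], v => v
  | a :: l, v => frcI (v * K + a) (fun v => horK K l v)

lemma horK_eq (K : ℤ) (l : List ℤ) (v : ℤ) : horK K l v = hor K 1 l v 1 := by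
  induction l generalizing v with
  | nil => rfl
  | cons a l ih => simp [horK, hor, frcI_eq, ih]

/-- Kernel-friendly evaluation of `qseq`. -/
def qK (K : ℤ) : ℕ → ℤ → ℤ → ℤ
  | 0, a, _ => a
  | n + 1, a, b => frcI (K * b - a) (fun c => qK K n b c)

lemma qK_aux (K : ℤ) (n i : ℕ) : qK K n (qseq K i) (qseq K (i + 1)) = qseq K (i + n) := by
  induction n generalizing i with
  | zero => rfl
  | succ n ih =>
    simp only [qK, frcI_eq]
    have : K * qseq K (i + 1) - qseq K i = qseq K (i + 2) := rfl
    rw [this, ih (i + 1)]; congr 1; ring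

lemma qK_eq (K : ℤ) (n : ℕ) : qK K n 1 (K + 1) = qseq K n := by
  have := qK_aux K n 0
  simpa [qseq] using this

def anyLt (f : ℕ → Bool) : ℕ → Bool
  | 0 => false
  | n + 1 => f n || anyLt f n

lemma anyLt_of (f : ℕ → Bool) (n r : ℕ) (hr : r < n) (h : f r = true) : anyLt f n = true := by
  induction n with
  | zero => omega
  | succ n ih =>
    simp only [anyLt, Bool.or_eq_true]
    rcases Nat.lt_succ_iff_lt_or_eq.mp hr with h1 | h1
    · right; exact ih h1
    · left; rw [← h1]; exact h

def allLt (f : ℕ → Bool) : ℕ → Bool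
  | 0 => true
  | n + 1 => f n && allLt f n

lemma allLt_get (f : ℕ → Bool) (n r : ℕ) (hr : r < n) (h : allLt f n = true) : f r = true := by
  induction n with
  | zero => omega
  | succ n ih =>
    simp only [allLt, Bool.and_eq_true] at h
    rcases Nat.lt_succ_iff_lt_or_eq.mp hr with h1 | h1
    · exact ih h1 h.2
    · rw [h1]; exact h.1

/-- Modular Horner scheme. -/
def horm (q s y : ℕ) : List ℤ → ℕ → ℕ → ℕ
  | [], v, _ => v
  | a :: l, v, w =>
    frc ((v * s + (a % (q : ℤ)).toNat * w) % q) (fun v => frc (w * y % q) (fun w => horm q s y l v w))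

lemma cast_emod_toNat (q : ℕ) (hq : 0 < q) (a : ℤ) : (((a % (q : ℤ)).toNat : ℕ) : ZMod q) = (a : ZMod q) := by
  have h : ((a % (q : ℤ)).toNat : ℤ) = a % q := Int.toNat_of_nonneg (Int.emod_nonneg _ (by omega))
  have h2 : ((((a % (q : ℤ)).toNat : ℕ) : ℤ) : ZMod q) = ((a % q : ℤ) : ZMod q) := by rw [h]
  rw [ZMod.intCast_mod] at h2
  rw [← h2, Int.cast_natCast]

lemma emod_toNat_lt (q : ℕ) (hq : 0 < q) (a : ℤ) : (a % (q : ℤ)).toNat < q := by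
  have := Int.emod_lt_of_pos a (by omega : (0 : ℤ) < q)
  omega

lemma horm_cast (q : ℕ) (hq : 0 < q) (s y : ℕ) (l : List ℤ) (v w : ℕ) :
    ((horm q s y l v w : ℕ) : ZMod q) = hor (s : ZMod q) (y : ZMod q) l v w := by
  induction l generalizing v w with
  | nil => rfl
  | cons a l ih =>
    simp only [horm, hor, frc_eq, ih, ZMod.natCast_mod, Nat.cast_add, Nat.cast_mul,
      cast_emod_toNat q hq]

lemma beq_of_cast (q a b : ℕ) (h : (a : ZMod q) = b) : Nat.beq (a % q) (b % q) = true := by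
  rw [Nat.beq_eq]
  exact (ZMod.natCast_eq_natCast_iff' a b q).mp h

/-- Imaginary part of `(A + B i)^n` modulo `q`, `n` given by binary digits (leading first);
`m1` stands for `-1`. -/
def gim (q m1 A B : ℕ) : List Bool → ℕ → ℕ → ℕ
  | [], _, d => d
  | b :: l, c, d =>
    frc ((c * c + m1 * (d * d)) % q) fun c2 => frc (2 * (c * d) % q) fun d2 =>
      match b with
      | false => gim q m1 A B l c2 d2
      | true => frc ((c2 * A + m1 * (d2 * B)) % q) fun c3 => frc ((c2 * B + d2 * A) % q) fun d3 =>
          gim q m1 A B l c3 d3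

def ofBits : List Bool → ℕ → ℕ
  | [], n => n
  | b :: l, n => ofBits l (2 * n + b.toNat)

lemma gim_cast (q m1 : ℕ) (hm1 : (m1 : ZMod q) = -1) (A B : ℕ) (A' B' : ℤ)
    (hA : (A : ZMod q) = A') (hB : (B : ZMod q) = B') (l : List Bool) (c d n : ℕ)
    (hc : (c : ZMod q) = ((((⟨A', B'⟩ : GaussianInt) ^ n).re : ℤ) : ZMod q))
    (hd : (d : ZMod q) = ((((⟨A', B'⟩ : GaussianInt) ^ n).im : ℤ) : ZMod q)) :
    ((gim q m1 A B l c d : ℕ) : ZMod q) =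
      ((((⟨A', B'⟩ : GaussianInt) ^ (ofBits l n)).im : ℤ) : ZMod q) := by
  induction l generalizing c d n with
  | nil => exact hd
  | cons b l ih =>
    have hre : (⟨A', B'⟩ : GaussianInt) ^ (2 * n) = ⟨A', B'⟩ ^ n * ⟨A', B'⟩ ^ n := by
      rw [two_mul, pow_add]
    have hc2 : ((((c * c + m1 * (d * d)) % q : ℕ)) : ZMod q) =
        ((((⟨A', B'⟩ : GaussianInt) ^ (2 * n)).re : ℤ) : ZMod q) := by
      rw [hre, Zsqrtd.re_mul]; push_cast [ZMod.natCast_mod]; rw [hc, hd, hm1]; ring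
    have hd2 : (((2 * (c * d) % q : ℕ)) : ZMod q) =
        ((((⟨A', B'⟩ : GaussianInt) ^ (2 * n)).im : ℤ) : ZMod q) := by
      rw [hre, Zsqrtd.im_mul]; push_cast [ZMod.natCast_mod]; rw [hc, hd]; ring
    cases b with
    | false =>
      simp only [gim, frc_eq, ofBits, Bool.toNat_false, add_zero]
      exact ih _ _ _ hc2 hd2
    | true =>
      simp only [gim, frc_eq, ofBits, Bool.toNat_true]
      apply ih
      · rw [pow_succ, Zsqrtd.re_mul]
        push_cast [ZMod.natCast_mod] at hc2 hd2 ⊢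
        rw [hc2, hd2, hA, hB, hm1]; ring
      · rw [pow_succ, Zsqrtd.im_mul]
        push_cast [ZMod.natCast_mod] at hc2 hd2 ⊢
        rw [hc2, hd2, hA, hB]

/-- Exclude all `A` modulo `q` for given `B`: either the power condition fails or `t` holds. -/
def scanA (q m1 e : ℕ) (bits : List Bool) (k : ℕ) (B : ℕ) (t : ℕ → Bool) : Bool :=
  frc (e * (2 ^ k % q * B) % q) fun tgt =>
    allLt (fun A => frc (gim q m1 A B bits 1 0 % q) fun d => !(Nat.beq d tgt) || t A) q

/-- Exclude all `m` modulo `o` outside `allowed`. -/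
def scanM (q m1 e : ℕ) (bits : List Bool) (k o : ℕ) (allowed : List ℕ) (t : ℕ → ℕ → Bool) : Bool :=
  allLt (fun m => allowed.contains m || frc (3 ^ m % q) fun B => scanA q m1 e bits k B (t B)) o

lemma scanA_sound (q m1 e k m : ℕ) (bits : List Bool) (ε A s y : ℤ) (B : ℕ) (t : ℕ → Bool)
    (hq : 0 < q) (hm1 : (m1 : ZMod q) = -1) (he : (e : ZMod q) = ε)
    (hbits : ofBits bits 0 = 2 * k + 1) (hS : Sol k m ε A s y)
    (hB : (B : ZMod q) = ((3 ^ m : ℤ) : ZMod q)) (h : scanA q m1 e bits k B t = true) :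
    ∃ A' : ℕ, (A' : ZMod q) = A ∧ t A' = true := by
  refine ⟨(A % (q : ℤ)).toNat, cast_emod_toNat q hq A, ?_⟩
  simp only [scanA, frc_eq] at h
  have h1 := allLt_get _ _ _ (emod_toNat_lt q hq A) h
  have hA := cast_emod_toNat q hq A
  have hg := gim_cast q m1 hm1 _ B A (3 ^ m) hA hB bits 1 0 0 (by simp) (by simp)
  rw [hbits, gauss_pow_im A (3 ^ m) s y hS.hs hS.hy k, hS.hW] at hg
  have h2 : Nat.beq (gim q m1 (A % (q : ℤ)).toNat B bits 1 0 % q) (e * (2 ^ k % q * B) % q) = true := by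
    apply beq_of_cast
    rw [hg]
    push_cast [ZMod.natCast_mod]
    rw [he, hB]; push_cast; ring
  rw [h2] at h1
  simpa using h1

lemma scanM_sound (q m1 e k m o : ℕ) (bits : List Bool) (ε A s y : ℤ) (allowed : List ℕ)
    (t : ℕ → ℕ → Bool)
    (hq : 0 < q) (hm1 : (m1 : ZMod q) = -1) (he : (e : ZMod q) = ε)
    (hbits : ofBits bits 0 = 2 * k + 1) (hS : Sol k m ε A s y)
    (ho : 0 < o) (h3 : 3 ^ o % q = 1 % q)
    (h : scanM q m1 e bits k o allowed t = true) :
    m % o ∈ allowed ∨ ∃ B' A' : ℕ, (B' : ZMod q) = ((3 ^ m : ℤ) : ZMod q) ∧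
      (A' : ZMod q) = A ∧ t B' A' = true := by
  have h1 := allLt_get _ _ _ (Nat.mod_lt m ho) h
  simp only [frc_eq, Bool.or_eq_true] at h1
  rcases h1 with h1 | h1
  · left; simpa using h1
  · right
    have hB : ((3 ^ (m % o) % q : ℕ) : ZMod q) = ((3 ^ m : ℤ) : ZMod q) := by
      have h3' : (3 : ZMod q) ^ o = 1 := by
        have := (ZMod.natCast_eq_natCast_iff' (3 ^ o) 1 q).mpr h3
        simpa using this
      push_cast [ZMod.natCast_mod]
      conv_rhs => rw [← Nat.div_add_mod m o, pow_add, pow_mul, h3', one_pow, one_mul]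
    obtain ⟨A', hA', ht⟩ := scanA_sound q m1 e k m bits ε A s y _ _ hq hm1 he hbits hS hB h1
    exact ⟨_, A', hB, hA', ht⟩



/-- Local test for `V = e P`, `P - 2 = r²`, `P + 2 = p t²`. -/
def sqt (q p V : ℕ) : Bool :=
  anyLt (fun r => Nat.beq (2 * (r * r + 2) % q) (V % q)) q &&
    anyLt (fun t => Nat.beq (2 * (p * (t * t)) % q) ((V + 4) % q)) q

lemma sqt_of (q p V : ℕ) (hq : 0 < q) (v r t : ℤ) (hV : (V : ZMod q) = v)
    (h1 : v = 2 * (r ^ 2 + 2)) (h2 : v + 4 = 2 * (p * t ^ 2)) : sqt q p V = true := by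
  simp only [sqt, Bool.and_eq_true]
  constructor
  · apply anyLt_of _ _ _ (emod_toNat_lt q hq r)
    apply beq_of_cast
    push_cast
    rw [cast_emod_toNat q hq, hV, h1]; push_cast; ring
  · apply anyLt_of _ _ _ (emod_toNat_lt q hq t)
    apply beq_of_cast
    push_cast
    rw [cast_emod_toNat q hq, hV]
    have : ((v + 4 : ℤ) : ZMod q) = ((2 * (p * t ^ 2) : ℤ) : ZMod q) := by rw [h2]
    push_cast at this
    rw [this]; ring

def test5 (q m1 half p : ℕ) (Y0 Z0 Ya Za : ℤ) (Yl Zl : List ℤ) (B A : ℕ) : Bool :=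
  frc ((A * A + m1 * (B * B)) % q) fun s => frc (half * (A * A + B * B) % q) fun y =>
  frc (horm q s y Yl (Ya % (q : ℤ)).toNat y % q) fun Y =>
  frc (horm q s y Zl (Za % (q : ℤ)).toNat y % q) fun Z =>
  frc (((Y0 % (q : ℤ)).toNat * Y + m1 * (p * ((Z0 % (q : ℤ)).toNat * Z))) % q) fun V =>
  !(sqt q p V) && !(sqt q p (m1 * V % q))

lemma test5_sound (q m1 half p k m : ℕ) (hq : 0 < q) (hm1 : (m1 : ZMod q) = -1)
    (hh : (half : ZMod q) * 2 = 1) (ε A s y Y0 Z0 Ya Za : ℤ) (Yl Zl : List ℤ) (A' B' : ℕ)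
    (hS : Sol k m ε A s y) (hA : (A' : ZMod q) = A) (hB : (B' : ZMod q) = ((3 ^ m : ℤ) : ZMod q))
    (e r t : ℤ) (he : e = 1 ∨ e = -1)
    (h1 : e * (Y0 * hor s y Yl Ya y - p * (Z0 * hor s y Zl Za y)) = 2 * (r ^ 2 + 2))
    (h2 : e * (Y0 * hor s y Yl Ya y - p * (Z0 * hor s y Zl Za y)) + 4 = 2 * (p * t ^ 2)) :
    test5 q m1 half p Y0 Z0 Ya Za Yl Zl B' A' = false := by
  simp only [test5, frc_eq]
  set S := (A' * A' + m1 * (B' * B')) % q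
  set T := half * (A' * A' + B' * B') % q
  have hSs : (S : ZMod q) = s := by
    simp only [S, hS.hs]; push_cast [ZMod.natCast_mod]; rw [hA, hB, hm1]; push_cast; ring
  have hTy : (T : ZMod q) = y := by
    have : ((2 * y : ℤ) : ZMod q) = ((A ^ 2 + (3 ^ m) ^ 2 : ℤ) : ZMod q) := by rw [hS.hy]
    simp only [T]; push_cast [ZMod.natCast_mod] at this ⊢; rw [hA, hB]; push_cast
    linear_combination (-(half : ZMod q)) * this + (y : ZMod q) * hh
  have hor_c : ∀ (a : ℤ) (l : List ℤ), ((horm q S T l (a % (q : ℤ)).toNat T : ℕ) : ZMod q) =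
      ((hor s y l a y : ℤ) : ZMod q) := by
    intro a l
    rw [horm_cast q hq, cast_emod_toNat q hq, hSs, hTy]
    have := hor_map (Int.castRingHom (ZMod q)) s y l a y
    simp only [eq_intCast] at this
    rw [this]
  set V := ((Y0 % (q : ℤ)).toNat * (horm q S T Yl (Ya % (q : ℤ)).toNat T % q) +
    m1 * (p * ((Z0 % (q : ℤ)).toNat * (horm q S T Zl (Za % (q : ℤ)).toNat T % q)))) % q
  have hV : (V : ZMod q) = ((Y0 * hor s y Yl Ya y - p * (Z0 * hor s y Zl Za y) : ℤ) : ZMod q) := by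
    simp only [V]
    push_cast [ZMod.natCast_mod]
    rw [hor_c, hor_c, cast_emod_toNat q hq, cast_emod_toNat q hq, hm1]; ring
  rcases he with rfl | rfl
  · rw [sqt_of q p V hq _ r t hV (by linarith) (by linarith)]; rfl
  · have hV' : ((m1 * V % q : ℕ) : ZMod q) =
        ((-1 * (Y0 * hor s y Yl Ya y - p * (Z0 * hor s y Zl Za y)) : ℤ) : ZMod q) := by
      push_cast [ZMod.natCast_mod]
      rw [hV, hm1]; push_cast; ring
    rw [sqt_of q p _ hq _ r t hV' h1 h2]; simp

/-- Kernel check of the polynomial identity `Y² - pZ² = 4ψ`. -/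
def kron5 (p k kb : ℕ) (Ya Za : ℤ) (Yl Zl : List ℤ) : Bool :=
  frc (2 ^ kb) fun Kn =>
    Nat.blt ((Ya.natAbs + l1 Yl) ^ 2 + p * (Za.natAbs + l1 Zl) ^ 2 + 4 * 2 ^ k) Kn &&
    (Nat.beq (2 * Yl.length) k && (Nat.beq (2 * Zl.length) k &&
    frcI (horK (Int.ofNat Kn) Yl Ya) fun YK => frcI (horK (Int.ofNat Kn) Zl Za) fun ZK =>
    frcI (qK (Int.ofNat Kn) k 1 (Int.ofNat Kn + 1)) fun QK =>
      decide (YK * YK - p * (ZK * ZK) - 4 * QK = 0)))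

lemma kron5_sound (p k kb : ℕ) (Ya Za : ℤ) (Yl Zl : List ℤ) (h : kron5 p k kb Ya Za Yl Zl = true)
    (s y : ℤ) (hy : y ≠ 0) :
    hor s y Yl Ya y ^ 2 - p * hor s y Zl Za y ^ 2 = 4 * Wseq s y k := by
  simp only [kron5, frc_eq, frcI_eq, horK_eq, qK_eq, Bool.and_eq_true, decide_eq_true_eq,
    Nat.beq_eq, Nat.blt_eq] at h
  obtain ⟨h1, h2, h3, h4⟩ := h
  refine ident5 p k Ya Za Yl Zl (Int.ofNat (2 ^ kb)) ?_ ?_ h2 h3 s y hy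
  · exact Int.ofNat_lt.mpr h1
  · rw [pow_two, pow_two]; exact h4

def bitsOK (bits : List Bool) (k : ℕ) : Bool := Nat.beq (ofBits bits 0) (2 * k + 1)

def loc5 (p k : ℕ) (bits : List Bool) (Y0 Z0 Ya Za : ℤ) (Yl Zl : List ℤ) (q o : ℕ)
    (allowed : List ℕ) : Bool :=
  Nat.blt 0 o && (Nat.beq (3 ^ o % q) (1 % q) && (Nat.beq (q % 2) 1 &&
    frc (q - 1) fun m1 => frc ((q + 1) / 2) fun half =>
    scanM q m1 m1 bits k o allowed (test5 q m1 half p Y0 Z0 Ya Za Yl Zl)))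

def base5 (p k kb : ℕ) (bits : List Bool) (Y0 Z0 Ya Za : ℤ) (Yl Zl : List ℤ) : Bool :=
  kron5 p k kb Ya Za Yl Zl && (bitsOK bits k &&
    (decide (Y0 * Y0 - p * (Z0 * Z0) = -4) &&
      frc (horm 3 1 2 Yl (Ya % 3).toNat 2 % 3) fun Y => frc (horm 3 1 2 Zl (Za % 3).toNat 2 % 3) fun Z =>
      decide ((Y0 * Y - p * (Z0 * Z)) % 3 = 0)))

lemma loc5_sound (p k kb m : ℕ) (hp : Nat.Prime p) (hp4 : p % 4 = 1)
    (bits : List Bool) (A s y Y0 Z0 Ya Za : ℤ) (Yl Zl : List ℤ)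
    (hb : base5 p k kb bits Y0 Z0 Ya Za Yl Zl = true) (hS : Sol k m (-1) A s y)
    (q o : ℕ) (allowed : List ℕ)
    (h : loc5 p k bits Y0 Z0 Ya Za Yl Zl q o allowed = true) : m % o ∈ allowed := by
  simp only [base5, bitsOK, frc_eq, Bool.and_eq_true, decide_eq_true_eq, Nat.beq_eq] at hb
  obtain ⟨hk, hbits, h0, h3⟩ := hb
  simp only [loc5, frc_eq, Bool.and_eq_true, Nat.beq_eq, Nat.blt_eq] at h
  obtain ⟨ho, h3o, hq2, hscan⟩ := h
  have hq : 0 < q := by omega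
  have hm1 : ((q - 1 : ℕ) : ZMod q) = -1 := by
    rw [Nat.cast_sub hq]; simp
  have hh : (((q + 1) / 2 : ℕ) : ZMod q) * 2 = 1 := by
    have : (q + 1) / 2 * 2 = q + 1 := by omega
    have : (((q + 1) / 2 * 2 : ℕ) : ZMod q) = ((q + 1 : ℕ) : ZMod q) := by rw [this]
    push_cast at this ⊢
    rw [this]; simp
  have hid := kron5_sound p k kb Ya Za Yl Zl hk s y hS.hpos.ne'
  rw [hS.hW] at hid
  have hor3 : ∀ (a : ℤ) (l : List ℤ), ((horm 3 1 2 l (a % 3).toNat 2 % 3 : ℕ) : ℤ) ≡ hor s y l a y [ZMOD 3] := by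
    intro a l
    refine (ZMod.intCast_eq_intCast_iff _ _ 3).mp ?_
    rw [Int.cast_natCast, ZMod.natCast_mod, horm_cast 3 (by norm_num)]
    have e1 := cast_emod_toNat 3 (by norm_num) a
    have e2 := hor_map (Int.castRingHom (ZMod 3)) s y l a y
    have e3 : (s : ZMod 3) = 1 := by
      have := (ZMod.intCast_eq_intCast_iff _ _ 3).mpr hS.hs3; simpa using this
    have e4 : (y : ZMod 3) = 2 := by
      have := (ZMod.intCast_eq_intCast_iff _ _ 3).mpr hS.hy3; simpa using this
    simp only [eq_intCast, e3, e4] at e2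
    simp only [Nat.cast_ofNat] at e1
    rw [e2, e1]; simp
  obtain ⟨e, r, t, he, h1, h2⟩ := pell5 p hp hp4 (hor s y Yl Ya y) (hor s y Zl Za y) Y0 Z0
    (by rw [hid]; norm_num) (by rw [pow_two, pow_two]; exact h0) (by
      have := (((hor3 Ya Yl).mul_left Y0).sub (((hor3 Za Zl).mul_left Z0).mul_left p))
      have h4 : _ ≡ 0 [ZMOD 3] := this.symm.trans h3
      exact h4)
  rcases scanM_sound q (q - 1) (q - 1) k m o bits (-1) A s y allowed _ hq hm1 (by rw [hm1]; simp)
    hbits hS ho h3o hscan with h | ⟨B', A', hB, hA, ht⟩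
  · exact h
  · rw [test5_sound q (q - 1) ((q + 1) / 2) p k m hq hm1 hh (-1) A s y Y0 Z0 Ya Za Yl Zl A' B' hS hA hB
      e r t he h1 h2] at ht
    exact absurd ht (by simp)

/-- Incompatibility of the local conditions on `m`. -/
def comb (L : ℕ) (cs : List (ℕ × ℕ × List ℕ)) : Bool :=
  Nat.blt 0 L && (cs.all (fun c => Nat.beq (L % c.2.1) 0) &&
    allLt (fun m => cs.any fun c => !(c.2.2.contains (m % c.2.1))) L)

lemma comb_sound (L m : ℕ) (cs : List (ℕ × ℕ × List ℕ)) (h : comb L cs = true)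
    (hm : ∀ c ∈ cs, m % c.2.1 ∈ c.2.2) : False := by
  simp only [comb, Bool.and_eq_true, Nat.blt_eq, List.all_eq_true, Nat.beq_eq] at h
  obtain ⟨hL, hd, h⟩ := h
  have h1 := allLt_get _ _ _ (Nat.mod_lt m hL) h
  simp only [List.any_eq_true] at h1
  obtain ⟨c, hc, h2⟩ := h1
  rw [Nat.mod_mod_of_dvd m (Nat.dvd_of_mod_eq_zero (hd c hc))] at h2
  simp [hm c hc] at h2

theorem main5 (p k kb L : ℕ) (bits : List Bool) (Y0 Z0 Ya Za : ℤ) (Yl Zl : List ℤ)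
    (cs : List (ℕ × ℕ × List ℕ)) (hpk : p = 2 * k + 1) (hp24 : p % 24 = 5)
    (hb : base5 p k kb bits Y0 Z0 Ya Za Yl Zl = true)
    (hl : cs.all (fun c => loc5 p k bits Y0 Z0 Ya Za Yl Zl c.1 c.2.1 c.2.2) = true)
    (hc : comb L cs = true) (hp : Nat.Prime p) :
    ¬ ∃ x y m : ℕ, 0 < x ∧ 0 < y ∧ 0 < m ∧ Nat.gcd x y = 1 ∧
      x ^ 2 + 3 ^ (2 * m) = 2 * y ^ p := by
  rintro ⟨x, y, m, -, -, hm, hxy, h⟩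
  obtain ⟨A, s, y', hS⟩ := exists_sol p x y m k (-1) hpk (Or.inl ⟨hp24, rfl⟩) hm hxy h
  refine comb_sound L m cs hc fun c hcc => ?_
  exact loc5_sound p k kb m hp (by omega) bits A s y' Y0 Z0 Ya Za Yl Zl hb hS _ _ _
    (List.all_eq_true.mp hl c hcc)



lemma congOne_cube (d q : ℤ) (h3 : 3 ∣ q) (a : Pell.Solution₁ d) (ha : a ∈ congOne d q) :
    a ^ 3 ∈ congOne d (3 * q) := by
  obtain ⟨⟨u, hu⟩, ⟨v, hv⟩⟩ := ha
  obtain ⟨c, hc⟩ := h3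
  have hx : a.x = 1 + q * u := by linarith
  have e : a ^ 3 = a * a * a := by rw [pow_succ, pow_two]
  rw [e]
  constructor
  · simp only [Pell.Solution₁.x_mul, Pell.Solution₁.y_mul]
    rw [hx, hv]
    refine ⟨u + q * u ^ 2 + c * q * u ^ 3 + d * ((1 + q * u) * (q * v) * v), ?_⟩
    rw [hc]; ring
  · simp only [Pell.Solution₁.x_mul, Pell.Solution₁.y_mul]
    rw [hx, hv]
    refine ⟨(1 + q * u) ^ 2 * v + d * (c * q * v ^ 3), ?_⟩
    rw [hc]; ring

lemma congOne_pow4 (d : ℤ) (hd : d % 3 = 2) (a : Pell.Solution₁ d) : a ^ 4 ∈ congOne d 3 := by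
  have hp := a.prop
  have e : a ^ 4 = (a * a) * (a * a) := by rw [show 4 = 2 * 2 by rfl, pow_mul, pow_two, pow_two]
  rw [e]
  obtain ⟨D, hD⟩ : ∃ D, d = 3 * D + 2 := ⟨d / 3, by omega⟩
  have hx : a.x ≡ 0 [ZMOD 3] ∨ a.x ≡ 1 [ZMOD 3] ∨ a.x ≡ 2 [ZMOD 3] := by
    unfold Int.ModEq; omega
  have hy : a.y ≡ 0 [ZMOD 3] ∨ a.y ≡ 1 [ZMOD 3] ∨ a.y ≡ 2 [ZMOD 3] := by
    unfold Int.ModEq; omega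
  have key : (a * a * (a * a)).x = (a.x * a.x + d * (a.y * a.y)) ^ 2 + d * (2 * a.x * a.y) ^ 2 ∧
      (a * a * (a * a)).y = 2 * (a.x * a.x + d * (a.y * a.y)) * (2 * a.x * a.y) := by
    simp only [Pell.Solution₁.x_mul, Pell.Solution₁.y_mul]
    constructor <;> ring
  have hxy : (3 : ℤ) ∣ a.x * a.y := by
    have hd2 : d ≡ 2 [ZMOD 3] := hd
    have h1 : a.x ^ 2 - 2 * a.y ^ 2 ≡ 1 [ZMOD 3] := by
      have := (Int.ModEq.refl (a.x ^ 2)).sub (hd2.mul_right (a.y ^ 2))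
      rw [hp] at this; exact this.symm
    rcases hx with hx | hx | hx
    · exact Dvd.dvd.mul_right (Int.modEq_zero_iff_dvd.mp hx) _
    all_goals
      rcases hy with hy | hy | hy
      · exact Dvd.dvd.mul_left (Int.modEq_zero_iff_dvd.mp hy) _
      all_goals
        exfalso
        have h2 := ((hx.pow 2).sub ((hy.pow 2).mul_left 2)).symm.trans h1
        exact absurd h2 (by decide)
  obtain ⟨c, hc⟩ := hxy
  have hsq : a.x * a.x + d * (a.y * a.y) = 1 + 2 * d * (a.y * a.y) := by linarith
  constructor
  · rw [key.1]
    have : (a.x * a.x + d * (a.y * a.y)) ^ 2 + d * (2 * a.x * a.y) ^ 2 - 1 = 8 * d * (a.x * a.y) ^ 2 := by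
      have : (a.x * a.x + d * (a.y * a.y)) ^ 2 = (a.x ^ 2 - d * a.y ^ 2) ^ 2 + 4 * d * (a.x * a.y) ^ 2 := by ring
      rw [this, hp]; ring
    rw [this, hc]
    exact ⟨24 * d * c ^ 2, by ring⟩
  · rw [key.2]
    exact ⟨4 * (a.x * a.x + d * (a.y * a.y)) * c, by linear_combination 4 * (a.x * a.x + d * (a.y * a.y)) * hc⟩

lemma congOne_pow (d : ℤ) (hd : d % 3 = 2) (a : Pell.Solution₁ d) (i : ℕ) :
    a ^ (4 * 3 ^ i) ∈ congOne d (3 ^ (i + 1)) := by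
  induction i with
  | zero => simpa using congOne_pow4 d hd a
  | succ i ih =>
    have := congOne_cube d (3 ^ (i + 1)) (dvd_pow_self 3 (by omega)) _ ih
    rw [← pow_mul] at this
    rw [pow_succ 3 i, ← mul_assoc, pow_succ 3 (i + 1), mul_comm _ (3 : ℤ)]
    exact this

lemma pell11 (p : ℕ) (hp : Nat.Prime p) (hp3 : p % 3 = 2) (i : ℕ) (F G f0 g0 : ℤ)
    (h : p * F ^ 2 - G ^ 2 = 2) (h0 : p * (f0 * f0) - g0 * g0 = 2) (hG : (3 : ℤ) ^ (i + 1) ∣ G)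
    (hn : ¬ (3 : ℤ) ^ (i + 1) ∣ 4 * ((g0 * g0 + 1) * (g0 * f0)) *
      ((g0 * g0 + 1) * (g0 * g0 + 1) + p * ((g0 * f0) * (g0 * f0)))) :
    ∃ w v : ℤ, G ^ 2 + 1 + 3 * w = 4 * w ^ 3 ∧ w ^ 2 = 1 + p * v ^ 2 := by
  set α : Pell.Solution₁ (p : ℤ) := Pell.Solution₁.mk (G ^ 2 + 1) (G * F)
    (by linear_combination (-G ^ 2) * h) with hα
  set ξ : Pell.Solution₁ (p : ℤ) := Pell.Solution₁.mk (g0 * g0 + 1) (g0 * f0)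
    (by linear_combination (-g0 ^ 2) * h0) with hξ
  have hsq : ¬ IsSquare (p : ℤ) := by
    rw [Int.isSquare_natCast_iff]
    exact hp.prime.not_isSquare
  have hmem : α ∈ congOne p (3 ^ (i + 1)) := by
    constructor
    · rw [hα, Pell.Solution₁.x_mk]
      have : G ^ 2 + 1 - 1 = G * G := by ring
      rw [this]; exact hG.mul_right _
    · rw [hα, Pell.Solution₁.y_mk]; exact hG.mul_right _
  obtain ⟨β, hβ⟩ := pell_cube p (3 ^ (i + 1)) (by exact_mod_cast hp.pos) hsq α ξ i hmem
    (congOne_pow p (by omega) ξ i) (by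
      rintro ⟨-, h4⟩
      apply hn
      have e : ξ ^ 4 = (ξ * ξ) * (ξ * ξ) := by rw [show 4 = 2 * 2 by rfl, pow_mul, pow_two, pow_two]
      rw [e] at h4
      simp only [Pell.Solution₁.x_mul, Pell.Solution₁.y_mul] at h4
      rw [hξ, Pell.Solution₁.x_mk, Pell.Solution₁.y_mk] at h4
      convert h4 using 1
      ring)
  refine ⟨β.x, β.y, ?_, ?_⟩
  · have h1 : α.x = (β * β * β).x := by rw [hβ, pow_succ, pow_two]
    simp only [Pell.Solution₁.x_mul, Pell.Solution₁.y_mul] at h1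
    rw [hα, Pell.Solution₁.x_mk] at h1
    rw [h1]
    linear_combination (-3 * β.x) * β.prop
  · linear_combination β.prop

def kron11 (p k kb : ℕ) (Ya Za : ℤ) (Yl Zl : List ℤ) : Bool :=
  frc (2 ^ kb) fun Kn =>
    Nat.blt (3 * (Ya.natAbs + l1 Yl) ^ 2 + p * (3 * (Za.natAbs + l1 Zl) ^ 2) + 4 * 2 ^ k) Kn &&
    (Nat.beq (2 * Yl.length + 1) k && (Nat.beq (2 * Zl.length + 1) k &&
    frcI (horK (Int.ofNat Kn) Yl Ya) fun YK => frcI (horK (Int.ofNat Kn) Zl Za) fun ZK =>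
    frcI (qK (Int.ofNat Kn) k 1 (Int.ofNat Kn + 1)) fun QK =>
      decide ((Int.ofNat Kn - 2) * (YK * YK) + p * ((Int.ofNat Kn + 2) * (ZK * ZK)) - 4 * QK = 0)))

lemma kron11_sound (p k kb : ℕ) (Ya Za : ℤ) (Yl Zl : List ℤ) (h : kron11 p k kb Ya Za Yl Zl = true)
    (s y : ℤ) (hy : y ≠ 0) :
    (s - 2 * y) * hor s y Yl Ya y ^ 2 + p * ((s + 2 * y) * hor s y Zl Za y ^ 2) = 4 * Wseq s y k := by
  simp only [kron11, frc_eq, frcI_eq, horK_eq, qK_eq, Bool.and_eq_true, decide_eq_true_eq,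
    Nat.beq_eq, Nat.blt_eq] at h
  obtain ⟨h1, h2, h3, h4⟩ := h
  refine ident11 p k Ya Za Yl Zl (Int.ofNat (2 ^ kb)) ?_ ?_ h2 h3 s y hy
  · exact Int.ofNat_lt.mpr h1
  · rw [pow_two, pow_two]; exact h4

def test11 (q m1 half p : ℕ) (Ya : ℤ) (Yl : List ℤ) (B A : ℕ) : Bool :=
  frc ((A * A + m1 * (B * B)) % q) fun s => frc (half * (A * A + B * B) % q) fun y =>
  frc (horm q s y Yl (Ya % (q : ℤ)).toNat y % q) fun g =>
  frc ((B * B * (g * g) + 1) % q) fun G =>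
  !(anyLt (fun w => Nat.beq (4 * (w * w * w) % q) ((G + 3 * w) % q) &&
      anyLt (fun v => Nat.beq (w * w % q) ((1 + p * (v * v)) % q)) q) q)

lemma test11_sound (q m1 half p k m : ℕ) (hq : 0 < q) (hm1 : (m1 : ZMod q) = -1)
    (hh : (half : ZMod q) * 2 = 1) (ε A s y Ya : ℤ) (Yl : List ℤ) (A' B' : ℕ)
    (hS : Sol k m ε A s y) (hA : (A' : ZMod q) = A) (hB : (B' : ZMod q) = ((3 ^ m : ℤ) : ZMod q))
    (w v : ℤ) (h1 : (3 ^ m * hor s y Yl Ya y) ^ 2 + 1 + 3 * w = 4 * w ^ 3) (h2 : w ^ 2 = 1 + p * v ^ 2) :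
    test11 q m1 half p Ya Yl B' A' = false := by
  simp only [test11, frc_eq]
  set S := (A' * A' + m1 * (B' * B')) % q
  set T := half * (A' * A' + B' * B') % q
  have hSs : (S : ZMod q) = s := by
    simp only [S, hS.hs]; push_cast [ZMod.natCast_mod]; rw [hA, hB, hm1]; push_cast; ring
  have hTy : (T : ZMod q) = y := by
    have : ((2 * y : ℤ) : ZMod q) = ((A ^ 2 + (3 ^ m) ^ 2 : ℤ) : ZMod q) := by rw [hS.hy]
    simp only [T]; push_cast [ZMod.natCast_mod] at this ⊢; rw [hA, hB]; push_cast
    linear_combination (-(half : ZMod q)) * this + (y : ZMod q) * hh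
  have hor_c : ((horm q S T Yl (Ya % (q : ℤ)).toNat T : ℕ) : ZMod q) =
      ((hor s y Yl Ya y : ℤ) : ZMod q) := by
    rw [horm_cast q hq, cast_emod_toNat q hq, hSs, hTy]
    have := hor_map (Int.castRingHom (ZMod q)) s y Yl Ya y
    simp only [eq_intCast] at this
    rw [this]
  rw [Bool.not_eq_false']
  apply anyLt_of _ _ _ (emod_toNat_lt q hq w)
  rw [Bool.and_eq_true]
  constructor
  · apply beq_of_cast
    have := congrArg (fun z : ℤ => (z : ZMod q)) h1
    push_cast [ZMod.natCast_mod] at this ⊢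
    rw [hor_c, cast_emod_toNat q hq, hB]
    push_cast
    linear_combination -this
  · apply anyLt_of _ _ _ (emod_toNat_lt q hq v)
    apply beq_of_cast
    have := congrArg (fun z : ℤ => (z : ZMod q)) h2
    push_cast at this ⊢
    rw [cast_emod_toNat q hq, cast_emod_toNat q hq]
    linear_combination this

def base11 (p k kb i : ℕ) (bits : List Bool) (f0 g0 Ya Za : ℤ) (Yl Zl : List ℤ) : Bool :=
  kron11 p k kb Ya Za Yl Zl && (bitsOK bits k &&
    (decide (p * (f0 * f0) - g0 * g0 = 2) &&
      decide ((4 * ((g0 * g0 + 1) * (g0 * f0)) *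
      ((g0 * g0 + 1) * (g0 * g0 + 1) + p * ((g0 * f0) * (g0 * f0)))) % ((3 ^ (i + 1) : ℕ) : ℤ) ≠ 0)))

/-- Local check at `q` (no allowed class), at `5` (giving `m` even) and at `q2` (excluding `m = 2`). -/
def loc11 (p k : ℕ) (bits : List Bool) (Ya : ℤ) (Yl : List ℤ) (q o i q2 : ℕ) : Bool :=
  Nat.blt 0 o && (Nat.beq (3 ^ o % q) (1 % q) && (Nat.beq (q % 2) 1 &&
    (frc (q - 1) fun m1 => frc ((q + 1) / 2) fun half =>
    scanM q m1 1 bits k o [] (test11 q m1 half p Ya Yl)) &&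
    (scanM 5 4 1 bits k 4 [0, 2] (fun _ _ => false) &&
    (Nat.beq i 1 || (Nat.ble i 3 && (Nat.blt 0 q2 && scanA q2 (q2 - 1) 1 bits k 9 (fun _ => false)))))))

theorem main11 (p k kb i q o q2 : ℕ) (bits : List Bool) (f0 g0 Ya Za : ℤ) (Yl Zl : List ℤ)
    (hpk : p = 2 * k + 1) (hp24 : p % 24 = 11)
    (hb : base11 p k kb i bits f0 g0 Ya Za Yl Zl = true)
    (hl : loc11 p k bits Ya Yl q o i q2 = true) (hp : Nat.Prime p) :
    ¬ ∃ x y m : ℕ, 0 < x ∧ 0 < y ∧ 0 < m ∧ Nat.gcd x y = 1 ∧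
      x ^ 2 + 3 ^ (2 * m) = 2 * y ^ p := by
  rintro ⟨x, y, m, -, -, hm, hxy, h⟩
  obtain ⟨A, s, y', hS⟩ := exists_sol p x y m k 1 hpk (Or.inr ⟨hp24, rfl⟩) hm hxy h
  simp only [base11, bitsOK, Bool.and_eq_true, decide_eq_true_eq, Nat.beq_eq] at hb
  obtain ⟨hk, hbits, h0, hn⟩ := hb
  simp only [loc11, frc_eq, Bool.and_eq_true, Bool.or_eq_true, Nat.beq_eq, Nat.blt_eq, Nat.ble_eq] at hl
  obtain ⟨ho, h3o, ⟨hq2, hscan⟩, h5, hi⟩ := hl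
  have hq : 0 < q := by omega
  have hm1 : ∀ q : ℕ, 0 < q → ((q - 1 : ℕ) : ZMod q) = -1 := by
    intro q hq
    rw [Nat.cast_sub hq]; simp
  have hh : (((q + 1) / 2 : ℕ) : ZMod q) * 2 = 1 := by
    have : (q + 1) / 2 * 2 = q + 1 := by omega
    have : (((q + 1) / 2 * 2 : ℕ) : ZMod q) = ((q + 1 : ℕ) : ZMod q) := by rw [this]
    push_cast at this ⊢
    rw [this]; simp
  have heven : m % 2 = 0 := by
    rcases scanM_sound 5 4 1 k m 4 bits 1 A s y' [0, 2] _ (by norm_num) (hm1 5 (by norm_num))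
      (by simp) hbits hS (by norm_num) (by norm_num) h5 with h | ⟨_, _, _, _, h⟩
    · simp at h; omega
    · simp at h
  have hmi : i + 1 ≤ m := by
    rcases hi with rfl | ⟨hi3, hq2', hsc⟩
    · omega
    · by_cases h2 : m = 2
      · exfalso
        subst h2
        obtain ⟨A', _, h⟩ := scanA_sound q2 (q2 - 1) 1 k 2 bits 1 A s y' 9 _ hq2' (hm1 q2 hq2')
          (by simp) hbits hS (by norm_num) hsc
        simp at h
      · omega
  have hid := kron11_sound p k kb Ya Za Yl Zl hk s y' hS.hpos.ne'
  rw [hS.hW] at hid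
  have hFG : p * (A * hor s y' Zl Za y') ^ 2 - (3 ^ m * hor s y' Yl Ya y') ^ 2 = 2 := by
    have e1 : s - 2 * y' = -2 * (3 ^ m) ^ 2 := by rw [hS.hy, hS.hs]; ring
    have e2 : s + 2 * y' = 2 * A ^ 2 := by rw [hS.hy, hS.hs]; ring
    rw [e1, e2] at hid
    linarith
  obtain ⟨w, v, h1, h2⟩ := pell11 p hp (by omega) i _ _ f0 g0 hFG h0
    (Dvd.dvd.mul_right (pow_dvd_pow 3 hmi) _) (by
      intro hd
      apply hn
      exact Int.emod_eq_zero_of_dvd (by exact_mod_cast hd))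
  rcases scanM_sound q (q - 1) 1 k m o bits 1 A s y' [] _ hq (hm1 q hq) (by simp)
    hbits hS ho h3o hscan with h | ⟨B', A', hB, hA, ht⟩
  · simp at h
  · rw [test11_sound q (q - 1) ((q + 1) / 2) p k m hq (hm1 q hq) hh 1 A s y' Ya Yl A' B' hS hA hB
      w v h1 h2] at ht
    exact absurd ht (by simp)



def Yc29 : List ℤ :=
  [1, -6, -9, -11, 19, 26, 5]

def Zc29 : List ℤ :=
  [-1, 0, 5, 1, -5, -4, -1]

theorem no29 : Nat.Prime 29 → ¬ ∃ x y m : ℕ, 0 < x ∧ 0 < y ∧ 0 < m ∧ Nat.gcd x y = 1 ∧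
    x ^ 2 + 3 ^ (2 * m) = 2 * y ^ 29 :=
  main5 29 14 18 42
    [true, true, true, false, true]
    (5) (-1) (2) (0) Yc29 Zc29
    [(43, 42, [])] (by norm_num) (by norm_num)
    (by decide +kernel) (by decide +kernel) (by decide +kernel)



def Yc53 : List ℤ :=
  [1, -12, -18, -16, 100, 228, -191, -482, 35, 343, 102, -34, -7]

def Zc53 : List ℤ :=
  [-1, 0, 10, 2, -34, -18, 43, 50, -9, -41, -14, 4, 1]

theorem no53 : Nat.Prime 53 → ¬ ∃ x y m : ℕ, 0 < x ∧ 0 < y ∧ 0 < m ∧ Nat.gcd x y = 1 ∧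
    x ^ 2 + 3 ^ (2 * m) = 2 * y ^ 53 :=
  main5 53 26 30 18
    [true, true, false, true, false, true]
    (-7) (1) (2) (0) Yc53 Zc53
    [(13, 3, [0]), (19, 18, [2, 11])] (by norm_num) (by norm_num)
    (by decide +kernel) (by decide +kernel) (by decide +kernel)



def Yc101 : List ℤ :=
  [1, -24, -36, -8, 451, 1673, -2719, -12863, 8115, 49378, -7141, -111170, -26726, 147018, 93777,
   -97905, -124079, 5129, 72497, 31262, -10409, -11824, -3520, -457, -20]

def Zc101 : List ℤ :=
  [-1, 0, 20, 4, -167, -79, 739, 655, -1743, -2946, 1415, 7716, 3346, -11566, -11165, 8479, 13765,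
   -511, -7653, -2966, 1065, 1150, 356, 45, 2]

theorem no101 : Nat.Prime 101 → ¬ ∃ x y m : ℕ, 0 < x ∧ 0 < y ∧ 0 < m ∧ Nat.gcd x y = 1 ∧
    x ^ 2 + 3 ^ (2 * m) = 2 * y ^ 101 :=
  main5 101 50 54 6
    [true, true, false, false, true, false, true]
    (-20) (2) (2) (0) Yc101 Zc101
    [(7, 6, [])] (by norm_num) (by norm_num)
    (by decide +kernel) (by decide +kernel) (by decide +kernel)



def gc131 : List ℤ :=
  [3, -93, -105, 1850, 1550, -21286, -12531, 159637, 58485, -827746, -135626, 3056046, -69015,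
   -8119945, 1589731, 15453481, -5553823, -20619401, 10728081, 18424551, -12805838, -10017637,
   9383537, 2529310, -3924961, 149418, 786140, -192227, -40149, 21156, -2696, 103]

def fc131 : List ℤ :=
  [-1, 1, 35, -40, -542, 696, 4889, -7011, -28401, 45664, 110522, -202662, -288293, 627365,
   479825, -1359589, -416017, 2033231, -63605, -2021957, 600232, 1238709, -666983, -389990,
   339697, 23184, -76478, 14797, 4459, -1968, 240, -9]

theorem no131 : Nat.Prime 131 → ¬ ∃ x y m : ℕ, 0 < x ∧ 0 < y ∧ 0 < m ∧ Nat.gcd x y = 1 ∧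
    x ^ 2 + 3 ^ (2 * m) = 2 * y ^ 131 :=
  main11 131 65 69 2 13 3 263
    [true, false, false, false, false, false, true, true]
    (-9) (103) (2) (0) gc131 fc131 (by norm_num) (by norm_num)
    (by decide +kernel) (by decide +kernel)



def Yc149 : List ℤ :=
  [1, -36, -54, 24, 1054, 5197, -10675, -70055, 61814, 497122, -187808, -2285415, 33981, 7250224,
   2294320, -16078565, -10830863, 24188844, 27729575, -21782035, -45341798, 4778510, 48188627,
   14870542, -31530049, -20590083, 10433082, 12429273, -68966, -3560247, -949794, 340267, 187651,
   9741, -8145, -1479, -61]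

def Zc149 : List ℤ :=
  [-1, 0, 30, 6, -398, -183, 3033, 2501, -14206, -20172, 38222, 106313, -25719, -382024, -237228,
   942845, 1123699, -1548104, -2724009, 1489383, 4227034, -327690, -4309707, -1147992, 2736643,
   1618007, -888298, -991675, 6964, 286873, 78592, -27569, -15475, -795, 669, 121, 5]

theorem no149 : Nat.Prime 149 → ¬ ∃ x y m : ℕ, 0 < x ∧ 0 < y ∧ 0 < m ∧ Nat.gcd x y = 1 ∧
    x ^ 2 + 3 ^ (2 * m) = 2 * y ^ 149 :=
  main5 149 74 78 30
    [true, false, false, true, false, true, false, true]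
    (-61) (5) (2) (0) Yc149 Zc149
    [(11, 5, [2]), (31, 30, [0, 1, 4, 9, 10, 15, 16, 19, 24, 25])] (by norm_num) (by norm_num)
    (by decide +kernel) (by decide +kernel) (by decide +kernel)



def Yc173 : List ℤ :=
  [1, -42, -63, 49, 1450, 7987, -17656, -130871, 127147, 1140851, -524205, -6588279, 686495,
   27104914, 5612436, -81721981, -42590654, 180972254, 159630290, -286328365, -395319691,
   293594120, 690571372, -116354966, -860934381, -176559174, 751132610, 375448852, -431291084,
   -350834466, 135992131, 191201847, -3445063, -59140563, -13128721, 8244089, 3741117, -18208,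
   -243502, -38284, 37, 326, 13]

def Zc173 : List ℤ :=
  [-1, 0, 35, 7, -550, -251, 5070, 4097, -29725, -40251, 108443, 265017, -180461, -1230860,
   -444804, 4124507, 4134912, -9976006, -15087654, 16922693, 35688123, -18182734, -59752436,
   6949822, 71981311, 13175014, -61211962, -27480912, 34542464, 25872934, -10809867, -14206003,
   324531, 4414717, 1000179, -615319, -286345, 628, 18742, 2918, -11, -24, -1]

theorem no173 : Nat.Prime 173 → ¬ ∃ x y m : ℕ, 0 < x ∧ 0 < y ∧ 0 < m ∧ Nat.gcd x y = 1 ∧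
    x ^ 2 + 3 ^ (2 * m) = 2 * y ^ 173 :=
  main5 173 86 90 6
    [true, false, true, false, true, true, false, true]
    (13) (-1) (2) (0) Yc173 Zc173
    [(7, 6, [1, 4]), (13, 3, [0])] (by norm_num) (by norm_num)
    (by decide +kernel) (by decide +kernel) (by decide +kernel)



def Yc197 : List ℤ :=
  [1, -48, -72, 80, 1909, 11664, -27155, -225989, 233390, 2344937, -1199895, -16346409, 2565735,
   82669438, 12316805, -313704893, -141797040, 903475287, 711604135, -1958914651, -2374710710,
   3074054486, 5761925082, -3054324337, -10465228655, 636816219, 14303552847, 3841592402,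
   -14548563913, -7825732019, 10681158859, 8648415109, -5287425858, -6281621499, 1452729003,
   3070202376, 824453, -980227369, -151106795, 190884191, 49393968, -20486381, -6629064, 1149857,
   391665, -32373, -8316, 299, 28]

def Zc197 : List ℤ :=
  [-1, 0, 40, 8, -727, -330, 7867, 6275, -55288, -72865, 251405, 576741, -609533, -3286692,
   -618391, 13865717, 13036128, -43724927, -65438293, 102144905, 209523744, -169586216,
   -486300614, 173049421, 849433889, -24029477, -1124814069, -267885904, 1116735425, 537378751,
   -805849415, -597453083, 394788430, 437070053, -108530635, -214834466, 824975, 68854931,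
   10690215, -13436823, -3521072, 1442589, 473276, -80891, -27975, 2275, 594, -21, -2]

theorem no197 : Nat.Prime 197 → ¬ ∃ x y m : ℕ, 0 < x ∧ 0 < y ∧ 0 < m ∧ Nat.gcd x y = 1 ∧
    x ^ 2 + 3 ^ (2 * m) = 2 * y ^ 197 :=
  main5 197 98 102 30
    [true, true, false, false, false, true, false, true]
    (28) (-2) (2) (0) Yc197 Zc197
    [(11, 5, [2]), (31, 30, [1, 2, 12, 14, 16, 17, 27, 29]), (271, 30, [1, 7, 10, 14, 16, 22, 25, 29])] (by norm_num) (by norm_num)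
    (by decide +kernel) (by decide +kernel) (by decide +kernel)



def gc251 : List ℤ :=
  [3, -183, -210, 7450, 6625, -184107, -125022, 3140842, 1563033, -39659698, -13303284, 386899336,
   72388482, -2999664426, -147905255, 18844230971, -1512670814, -97213811336, 19783387511,
   415585645823, -133862919378, -1480656870818, 648391296728, 4409118055364, -2438717852576,
   -10976054546040, 7361101367993, 22784714977986, -18110497981781, -39215528490693,
   36573097073790, 55402796416510, -60726410960403, -63176429287964, 82715222635209,
   56440925196114, -91882174857782, -37141983586901, 82436374633702, 14995416118935,
   -58893995177628, 107916694883, 32823362317055, -5286565230240, -13841970815439, 4302255017924,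
   4201783347050, -1998677579415, -830511489984, 602456018480, 76539521368, -117059091822,
   6506699701, 13508180755, -2692958675, -714177703, 282647731, -6268248, -9542404, 1619541,
   -98583, 1917]

def fc251 : List ℤ :=
  [-1, 1, 70, -80, -2299, 2937, 47144, -66420, -677305, 1044224, 7247520, -12185894, -59914206,
   109910192, 391462847, -786906579, -2049065432, 4554410528, 8645252461, -21577915397,
   -29352675564, 84390364262, 79190992960, -273839305864, -163964974816, 738949197448,
   235293420389, -1657709734388, -133779804681, 3082217620837, -392638767310, -4720762731690,
   1498038561959, 5895556492062, -2955776217173, -5906428408878, 4112872779240, 4619864217103,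
   -4312391352512, -2680020522615, 3462743057608, 1013555307187, -2119643962653, -118394165946,
   970011997767, -127252444756, -319546464940, 95668840117, 70367411620, -34684350700,
   -8519900166, 7478250014, 33620689, -930877179, 145197987, 54008411, -17956485, 81326, 654208,
   -105351, 6283, -121]

theorem no251 : Nat.Prime 251 → ¬ ∃ x y m : ℕ, 0 < x ∧ 0 < y ∧ 0 < m ∧ Nat.gcd x y = 1 ∧
    x ^ 2 + 3 ^ (2 * m) = 2 * y ^ 251 :=
  main11 251 125 129 3 13 3 503
    [true, true, true, true, true, false, true, true]
    (-121) (1917) (2) (0) gc251 fc251 (by norm_num) (by norm_num)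
    (by decide +kernel) (by decide +kernel)



def Yc269 : List ℤ :=
  [1, -66, -99, 209, 3664, 29008, -74630, -826227, 952653, 12733183, -7766050, -135050277,
   34028031, 1070649442, 53265969, -6599919682, -2264298507, 32259878305, 21279928647,
   -125745055658, -130522141665, 387044850021, 601086133169, -904779594192, -2181684993743,
   1404485407491, 6371162881729, -432298004839, -15076147783091, -5518763805105, 28816135285086,
   21410865526074, -43801599086036, -49892613746248, 50908079576206, 85617517287895,
   -40489190446043, -113675154941840, 11778512923162, 117741237188953, 22420523584713,
   -93636978304139, -43891287438412, 54495604369875, 43995369991353, -20212029362905,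
   -29504868317269, 1849877442685, 13622261140972, 2906342574666, -4087227746821, -1976669159807,
   630388583136, 635422647665, 24340658569, -107102846757, -28559522318, 6861559756, 4347233828,
   320965524, -215623399, -53650958, -1091327, 1162012, 171889, 9301, 164]

def Zc269 : List ℤ :=
  [-1, 0, 55, 11, -1406, -632, 21988, 17135, -231433, -291215, 1670594, 3474603, -7583075,
   -30870912, 9177507, 211200126, 177492537, -1132828219, -1856755207, 4789228518, 11155075003,
   -15794870693, -49217361493, 38992719452, 170650346425, -62189476221, -477375808511,
   11133502861, 1087120478073, 306444493205, -2010139895470, -1181782012024, 2971238326860,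
   2798167008292, -3374856790334, -4884954343287, 2636367751683, 6584888335034, -761481873126,
   -6906501917037, -1408456545073, 5547794701053, 2740685409054, -3253885993621, -2729939074465,
   1213918654147, 1821778682481, -111532643105, -838034181552, -175918173860, 250790012855,
   119903634167, -38615370544, -38602908451, -1485340863, 6513206071, 1744584908, -417489492,
   -265434518, -19554090, 13160149, 3268748, 66577, -70822, -10483, -567, -10]

theorem no269 : Nat.Prime 269 → ¬ ∃ x y m : ℕ, 0 < x ∧ 0 < y ∧ 0 < m ∧ Nat.gcd x y = 1 ∧
    x ^ 2 + 3 ^ (2 * m) = 2 * y ^ 269 :=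
  main5 269 134 138 6
    [true, false, false, false, false, true, true, false, true]
    (164) (-10) (2) (0) Yc269 Zc269
    [(7, 6, [])] (by norm_num) (by norm_num)
    (by decide +kernel) (by decide +kernel) (by decide +kernel)



def Yc293 : List ℤ :=
  [1, -72, -108, 264, 4375, 37176, -98071, -1170456, 1389209, 19967776, -12767453, -235601039,
   66626562, 2091550297, 29247273, -14558878779, -4336619523, 81244461949, 48501155838,
   -367187105716, -345393072338, 1342856047996, 1849157393632, -3907847418686, -7871170776117,
   8582623918322, 27328311259814, -11688685246149, -78366563945805, -3546594113905,
   186503435788025, 77936424540975, -367831650032303, -275020981354475, 595978710861005,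
   647086618325848, -777143776739892, -1169356931017005, 777794944566389, 1692630824815548,
   -519261965928934, -1988537439108594, 71672725324409, 1894799958835573, 360974970053816,
   -1447660087239731, -582796760734001, 864729391906612, 548179100464914, -383167785156719,
   -365787226531400, 109654459080580, 179752328305576, -8208204228439, -64466487247518,
   -9296232532976, 16157811930455, 5089813676854, -2552662022603, -1352373579806, 179465801842,
   204640793850, 11303062589, -16303591613, -3031915926, 472515723, 177608763, 7126264, -2411514,
   -258010, -844, 698, 17]

def Zc293 : List ℤ :=
  [-1, 0, 60, 12, -1681, -754, 28981, 22456, -339097, -421368, 2761041, 5583677, -14695756,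
   -55487393, 30677811, 428298981, 296193091, -2621333743, -4043039644, 12846139294, 28710532396,
   -50344211648, -148238079306, 154924924910, 604501105357, -352894954948, -2012724758202,
   470383537535, 5555498372813, 340318955011, -12785401235275, -4246681528775, 24503392638841,
   14790510190843, -38765845464057, -35123477631208, 49594145869766, 64266095224189,
   -48951020809523, -94124987126138, 32507774432552, 111700946229686, -4975253249999,
   -107314778118827, -21209501350064, 82521077695607, 34484639491463, -49529878057046,
   -32399999686680, 22016503975207, 21577017414868, -6304876581626, -10584476206872, 461515020757,
   3791005495556, 544052016732, -949426470361, -296835055726, 149995131757, 78825522910,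
   -10576855202, -11924316152, -654717457, 949312275, 177062186, -27418173, -10391183, -421624,
   141778, 15098, 36, -40, -1]

theorem no293 : Nat.Prime 293 → ¬ ∃ x y m : ℕ, 0 < x ∧ 0 < y ∧ 0 < m ∧ Nat.gcd x y = 1 ∧
    x ^ 2 + 3 ^ (2 * m) = 2 * y ^ 293 :=
  main5 293 146 150 6
    [true, false, false, true, false, false, true, false, true]
    (17) (-1) (2) (0) Yc293 Zc293
    [(7, 6, [])] (by norm_num) (by norm_num)
    (by decide +kernel) (by decide +kernel) (by decide +kernel)



def Yc317 : List ℤ :=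
  [1, -78, -117, 325, 5149, 46813, -125965, -1616514, 1959718, 30282991, -19991309, -393915374,
   119382234, 3874115098, -29967081, -30047294180, -8202391905, 188116134576, 106533865999,
   -962071959327, -864790107682, 4028162488546, 5281758984432, -13667316519803, -25788296067698,
   36295763675771, 103513270400813, -67469439080547, -346617414947276, 42209675651744,
   975367133523538, 276783729218378, -2311393206591084, -1445749605319210, 4599860941405212,
   4364577507905897, -7617079505724894, -9917819698635033, 10285611982042897, 18139762310189468,
   -10819685857350158, -27372774936482747, 7757446126465115, 34384175022535468, -1361404407384304,
   -35977999304544608, -5950907555973108, 31191575714278288, 10972890220183707,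
   -22152244074392238, -11919375955029362, 12636361462323266, 9470869089895558, -5590884933024491,
   -5798315797682785, 1783476082252144, 2770878528726602, -325551635523864, -1030624261505765,
   -19528100046609, 294934358727138, 35530536624535, -63841219002056, -12548566938068,
   10249962885993, 2574035273528, -1198397371055, -339156898747, 100660321006, 28704259219,
   -6014063655, -1486519291, 248886350, 41928959, -6458495, -469834, 78298, -447, -89]

def Zc317 : List ℤ :=
  [-1, 0, 65, 13, -1981, -887, 37333, 28804, -480478, -591951, 4344563, 8633302, -26238356,
   -94941862, 71498133, 816059074, 501213671, -5602584012, -8632118869, 31078950615, 70775983616,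
   -139564501352, -418533513900, 501605686877, 1959791514936, -1387538733057, -7541539465811,
   2586963343805, 24279867709728, -998775240042, -65960599835742, -15159449811282,
   151591377702268, 74579855805384, -293910032886082, -225520399101353, 476306728568332,
   518096915417303, -632338027381123, -959156171526596, 657499205812662, 1463575148289865,
   -470740474196213, -1856102009240532, 93066247571808, 1957471464906746, 332433709474650,
   -1707741677875360, -621918631121883, 1218730265962252, 676112224826268, -697673938384412,
   -536574484033784, 309378994445149, 328021667217585, -98743153391770, -156548213226182,
   17941312058748, 58166364783857, 1159189074987, -16632106725488, -2003583209205, 3598055263066,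
   705403982782, -577442390501, -144577749788, 67492905579, 19044876791, -5667687102, -1611788443,
   338519589, 83477879, -14003214, -2355121, 363171, 26404, -4400, 25, 5]

theorem no317 : Nat.Prime 317 → ¬ ∃ x y m : ℕ, 0 < x ∧ 0 < y ∧ 0 < m ∧ Nat.gcd x y = 1 ∧
    x ^ 2 + 3 ^ (2 * m) = 2 * y ^ 317 :=
  main5 317 158 162 18
    [true, false, false, true, true, true, true, false, true]
    (-89) (5) (2) (0) Yc317 Zc317
    [(19, 18, [])] (by norm_num) (by norm_num)
    (by decide +kernel) (by decide +kernel) (by decide +kernel)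



def Yc389 : List ℤ :=
  [1, -96, -144, 544, 7849, 85409, -240235, -3735240, 4739592, 88831525, -62621667, -1479446173,
   511045160, 18822402083, -966650445, -191067991394, -43101071641, 1586523198286, 812440584886,
   -10928853951679, -9094801747351, 62814083515750, 76567174486111, -300154932490678,
   -520340423385899, 1170184722868638, 2947942655047292, -3517803724102907, -14168021913317648,
   6578507219573042, 58338788118392322, 4718272594591205, -206844279247351058,
   -108401807845933834, 632091718461251999, 582190001037644577, -1658927487715688249,
   -2191850591145984002, 3701544108776548544, 6617624058875451197, -6863761068420798276,
   -16751920962289891873, 10011178243584880096, 36228335892712204044, -9559987999660474007,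
   -67456595413818030724, -914109276841518042, 108284419029857936531, 28600325774727145431,
   -149258686396058989108, -76360177669382512855, 174846151234685771739, 137145529257461243785,
   -170451707226684789830, -193121119138733169992, 132155312207250737996, 222988463273288070773,
   -71728190354220200362, -214304820229740856551, 11349433783523633930, 171657723523551440292,
   29218235200409984723, -113620571344411537651, -43177057562107386964, 60875200054832670016,
   37229568073679304501, -25258917149491201728, -23606943087440176340, 7225003732422920616,
   11588294279956104911, -747391040339100192, -4436295658960906682, -536405230281616223,
   1303232150043521087, 377975481575125343, -281102878336675228, -136858537663892192,
   39716938429562574, 33190326039290371, -2099254702023926, -5597682564498380, -484828596249604,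
   639718267353738, 136555003362837, -45095027118944, -16823428933270, 1363275145495,
   1181412402345, 49336416951, -46015957384, -5899270426, 782681967, 191156252, 1915403, -2032224,
   -153781, -2564]

def Zc389 : List ℤ :=
  [-1, 0, 80, 16, -3029, -1351, 71681, 54798, -1173898, -1420661, 13766117, 26419303, -112025860,
   -374791473, 494682379, 4209117038, 1822938187, -38301334908, -61755644736, 286310915125,
   722519278495, -1767965007886, -5949569772461, 8979555417578, 38890941148799, -36715220433722,
   -211134665524280, 113074581252923, 973164382249938, -197998434553632, -3853309375495418,
   -351359355148121, 13183067112444042, 4914505588502298, -39018638512508039, -25847231922923677,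
   99562609813129229, 98180833699959250, -216822446388278572, -300897219297984085,
   394007182492088040, 773742921534633135, -566065610941794776, -1698149544486813124,
   538596629402215041, 3203864471209677254, 26284193732292210, -5202307503499636895,
   -1494971297378421203, 7241321301136515238, 3997368713431676883, -8552477353318704787,
   -7147944355807781891, 8393643741768279450, 10016360994650022098, -6542101220131007546,
   -11514484198986130707, 3562885975359706710, 11024656776163079881, -558706707102377540,
   -8803534897275854546, -1472051789283988525, 5812651891125738427, 2175050241201636130,
   -3108223480443172390, -1877672231943315841, 1287796196131882400, 1191979888052162590,
   -368002961108996386, -585681544575549275, 38103784670278212, 224382592308619188,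
   27225717171886209, -65954145615487839, -19187723070847555, 14232263420838422, 6945866383962814,
   -2011470278384698, -1684073700457593, 106312276644962, 283968343828384, 24575407760930,
   -32447332365912, -6921766993355, 2286968809876, 852828389406, -69129157649, -59894046981,
   -2501755491, 2333010026, 299115296, -39683257, -9692088, -97113, 103038, 7797, 130]

theorem no389 : Nat.Prime 389 → ¬ ∃ x y m : ℕ, 0 < x ∧ 0 < y ∧ 0 < m ∧ Nat.gcd x y = 1 ∧
    x ^ 2 + 3 ^ (2 * m) = 2 * y ^ 389 :=
  main5 389 194 198 30
    [true, true, false, false, false, false, true, false, true]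
    (-2564) (130) (2) (0) Yc389 Zc389
    [(31, 30, [14, 29]), (271, 30, [7, 22])] (by norm_num) (by norm_num)
    (by decide +kernel) (by decide +kernel) (by decide +kernel)



def Yc461 : List ℤ :=
  [1, -114, -171, 817, 11116, 140696, -408514, -7447463, 9765963, 214604447, -158621284,
   -4354694578, 1648246935, 67965652209, -5879063378, -853033166732, -158393830936, 8837075088292,
   4099157766519, -76764359242140, -59058280891815, 563823272148124, 636360570313091,
   -3505693145909168, -5559436019339413, 18293952775910140, 40819103720220534, -77915373404203561,
   -256895051453463183, 249025558154642626, 1402394713446063043, -396540849062095235,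
   -6688911501356782100, -1707839411239414052, 27983389311928950147, 19874414606842419725,
   -102772669186106841147, -116169537462489500886, 330483093354525110885, 516111503712476885016,
   -923357618779281445402, -1906214875995113725642, 2203653400202663268815,
   6057223782355018333595, -4321083691583075966805, -16827922238194534062156,
   6230258278612518275696, 41194583275138115242177, -3384482298949341824090,
   -89127943896248240322015, -15810958552882707978604, 170324499227582122928501,
   72999438905315350735449, -286236946652203337561811, -198143312323053944194538,
   418990394171810391887029, 418234072327810107967784, -524227937457854720490171,
   -736081188096103530487971, 538455798370915820239735, 1108770285375468639569659,
   -406537702302709563933666, -1444084072665629819908052, 119804494727466773797138,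
   1629209527208197056080969, 260478287716624293709512, -1584933565682777268915856,
   -618625229810386230454808, 1313570584470698345197619, 838552557198566779788301,
   -904591731592460565664397, -863849527905529079249566, 489226582638140726640583,
   722352263969027749814357, -174059464888457423392055, -499778037538229311513334,
   -1461268090914205207561, 285910694100686152535815, 61275436642074469578411,
   -133011360731574614526180, -57319717431993612441574, 48254880966852118107776,
   34377242458972108591053, -12172072694955530529489, -15343273223059400237448,
   1130083861331761960997, 5231527956898585224314, 707606404374247488126, -1333879943812816603101,
   -448627762794824912090, 233774245523421732053, 145111297278655621211, -19712095956566160063,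
   -30812236431184881648, -2463007403577105237, 4285873755986690409, 1130177546859815139,
   -329946628337247911, -184561544547534818, 288643885638703, 16060456664327908, 2659910320174295,
   -616179689780175, -244995381028846, -8300099784051, 8289013414868, 1406760572709, -23809219976,
   -30142321193, -3093261972, -19090192, 17759577, 1324795, 37790, 365]

def Zc461 : List ℤ :=
  [-1, 0, 95, 19, -4298, -1912, 122416, 92983, -2434759, -2908931, 35133746, 65734452, -360963425,
   -1141810655, 2223533966, 15834037384, 2858793496, -179624248406, -287464919323, 1692837843420,
   4521422929491, -13363703282396, -48274907825791, 88431819078052, 407761899309423,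
   -485478225522116, -2874347715722742, 2138257577257845, 17350456467650467, -6787479865224642,
   -90983637554827787, 7881154854203035, 417944954664010224, 81835905510578870,
   -1689177450118769407, -802223007633443685, 6012974161462508713, 4624476431132017376,
   -18804309166268499601, -20730399604523678394, 51270992730311079998, 77706398082818850798,
   -119854723671943177939, -250891956051741399049, 231292567139996943911, 707870847677920472760,
   -331240629074044039478, -1757798112156050677407, 192021108782556898538, 3852432667966960725433,
   754738787584883250850, -7446489779641676773725, -3551433767989844771517,
   12639439572379724324935, 9615486584903106463610, -18661155472488263118593,
   -20188993517332095886582, 23519225195828362698605, 35337097463466332439103,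
   -24303264903522185895485, -52959569934749669132907, 18430813565211878611474,
   68668594586877802243152, -5418281755682850230998, -77175634478278344270171,
   -11989793151336001074712, 74836046681917510976374, 28488147748280708785682,
   -61856187893618166437099, -38690148725255157841165, 42502815841273467832267,
   39929761730910129437740, -22945055068113355293299, -33441065893314779992873,
   8151742362121847913113, 23166616471323793063172, 67994442918113459791,
   -13266752947771003856873, -2863203647609488995137, 6177056676459295942730,
   2676447782764089630126, -2242421220539661590292, -1604260819590636697631,
   565926498441288682829, 715690664141436153422, -52559737982165730345, -243940493673896580808,
   -32924692189002979940, 62180828015110038693, 20878924303812537210, -10895619948642854773,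
   -6754578002981300267, 918639810201823979, 1434421716189014462, 114743488946541123,
   -199541661975800105, -52651628889754417, 15362441073194409, 8597767877200070, -13357160361739,
   -748147087908062, -123870780453513, 28703453617457, 11409336519104, 386539635759,
   -386016219456, -65523166141, 1108475258, 1403969763, 144063378, 888570, -827075, -61705, -1760,
   -17]

theorem no461 : Nat.Prime 461 → ¬ ∃ x y m : ℕ, 0 < x ∧ 0 < y ∧ 0 < m ∧ Nat.gcd x y = 1 ∧
    x ^ 2 + 3 ^ (2 * m) = 2 * y ^ 461 :=
  main5 461 230 234 30
    [true, true, true, false, false, true, true, false, true]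
    (365) (-17) (2) (0) Yc461 Zc461
    [(31, 30, [])] (by norm_num) (by norm_num)
    (by decide +kernel) (by decide +kernel) (by decide +kernel)



def gc491 : List ℤ :=
  [3, -363, -420, 29900, 27350, -1530154, -1106184, 55473900, 31109687, -1531336417, -640179747,
   33682977087, 9733157489, -608966148372, -103549214563, 9254633313542, 545906144186,
   -120234001002856, 5508723123972, 1352876399289102, -196962120920195, -13320660956404550,
   3214247579214556, 115724005484693816, -38625533243832138, -893037583077660991,
   378430001569606265, 6155339872769259537, -3151260772154356947, -38065256087638875860,
   22804271802954505285, 211983953143055138945, -145397881962268974609, -1066291627206273125379,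
   824462726168300323230, 4856076809026820790383, -4185830171107983823431,
   -20060057117812342626975, 19124008196442762389352, 75265358787300832804079,
   -78929012090223220249513, -256707539970751366301193, 295152548625880872110887,
   796172478636893083090077, -1002311863253895726539028, -2244956718973919269470627,
   3096410011251659958177295, 5750094254979535710474138, -8712890950812019142267332,
   -13356857933789015673831123, 22350388729790883788515184, 28063513621868084421277232,
   -52292151025474130084906199, -53110882105934899084443746, 111602939577265399511961535,
   89948839273897937247130493, -217228190204913432174654580, -134878375346898577369393520,
   385413427478438607792203883, 175707170597319437690900865, -622768471551577999761572267,
   -191283939462486820403964280, 915323512778416529982923778, 156937709623359695073465738,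
   -1221666875065072190905867521, -56126316846683406805615431, 1477539774242583822170118520,
   -106497690641094864227510229, -1614979859974268295624335417, 299276667351900178762780811,
   1589873951615566387864241983, -471791584557110859916245033, -1403608392725440201099785501,
   575519333926137186049328757, 1105013341140201728553355768, -585800278414972379624602500,
   -769877392161646260546416695, 511700935481630693169043695, 469567697776546999746081646,
   -388177021686927989640479928, -246556629119520398788692749, 256888124728511660240292058,
   108222675264040164988993147, -148346368476743510464271255, -37276263995355021807242087,
   74550854051580947632058873, 8213179821674303136701455, -32431014382298186202194367,
   395633445457421753177062, 12113194048840416683029876, -1499904511908416332170600,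
   -3838717237374867971021577, 892832536099480512534488, 1014024874055881363494886,
   -353850255517033194670530, -216973072883388519051099, 106805820658205497796911,
   35616343667122753830050, -25387251577325366228068, -3891772912339534056835,
   4764301842308094770543, 104375079498685394995, -695335753025924427299, 59361459696395717316,
   76283573449105116281, -14244950452951362188, -5867784056723597685, 1817895477798831189,
   262607862468911559, -147579625940838899, -740174507272541, 7471846393865860, -683154037935868,
   -203058389132373, 38698581930212, 1357451352754, -829666466715, 48473648573, 4632276807,
   -670640091, 26871781, -305987]

def fc491 : List ℤ :=
  [-1, 1, 140, -160, -9458, 12054, 411280, -575146, -12952501, 19656615, 315087565, -514990481,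
   -6165460659, 10797151338, 99764480519, -186581471012, -1361831427740, 2715171431464,
   15917370787058, -33816957782964, -161119877792115, 365048564417120, 1424790967351224,
   -3449754007852240, -11081103511862998, 28770621381275405, 76174134608223333,
   -213152748999344093, -464424503618396749, 1410461893739592982, 2516067508399614699,
   -8373321586345308251, -12113792705094836983, 44760832793663516415, 51717506724657872090,
   -216109632038908984779, -194678041466121171931, 944691797516674213081, 638432103526077209070,
   -3746212360238823376237, -1778213487750294890557, 13496750855274669678801,
   3951370276305689812031, -44224672056666305286691, -5580848212100176207090,
   131881835654932769750311, -3750664124157201890283, -358013484670348626239654,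
   62374445090599726994526, 884569807055417841624555, -277876661257612708321948,
   -1987950475205674594620992, 897080851932758177885437, 4058911206023453875342222,
   -2390843154442149941727215, -7515362116173966179899813, 5498818386509877907289546,
   12585283854481392106848120, -11135441535010341101872013, -18987601586940177658892301,
   20061769060594700525993353, 25663544778243036772050584, -32336007885195751789828020,
   -30808510564765592834423646, 46763487769553966122579249, 32393226190066062181429143,
   -60744758837802973101919548, -29080658824609985116078865, 70860261561044263098980129,
   21080507839745899120495343, -74135107920056745772649671, -10347966458246848869726751,
   69399203371436831131405321, -148458661038855556673251, -57927838436463398861820290,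
   7743678732322385531534676, 42906342220680747549948307, -11191732114441042312303665,
   -28012499884315446342409766, 10933938508657019529861878, 15968331896203211912607897,
   -8487386305976591511151826, -7835456189906318051929093, 5488138855605286053136615,
   3232540140738465018029203, -3007758172644465690135679, -1071033616294699300412725,
   1404238596602078100827545, 252751243306810812340582, -557535087665231878872944,
   -20865157163457446808176, 186942704839555100220259, -16116866306638039709372,
   -52271333427437204381972, 10594847348362644368328, 11935909948668520291969,
   -3888998758638709535951, -2145288647761914616102, 1032060878116775556594,
   280568157023729778715, -208651530645158210841, -20508518530971335627, 32256120812139465595,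
   -895574734055801100, -3726188295209109389, 501100575491803782, 303936804685594789,
   -75292593174124323, -15155557187122803, 6599631515116177, 205244480946833, -351362108373106,
   26034787228588, 10027071673523, -1711000337264, -80241742480, 38508064401, -2079199961,
   -224336959, 30873643, -1219611, 13809]

theorem no491 : Nat.Prime 491 → ¬ ∃ x y m : ℕ, 0 < x ∧ 0 < y ∧ 0 < m ∧ Nat.gcd x y = 1 ∧
    x ^ 2 + 3 ^ (2 * m) = 2 * y ^ 491 :=
  main11 491 245 249 1 13 3 0
    [true, true, true, true, false, true, false, true, true]
    (13809) (-305987) (2) (0) gc491 fc491 (by norm_num) (by norm_num)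
    (by decide +kernel) (by decide +kernel)



def Yc509 : List ℤ :=
  [1, -126, -189, 1029, 13609, 188350, -555865, -11127157, 14836331, 357998862, -270926876,
   -8132842759, 3216482652, 142581657385, -14897701739, -2017798470365, -333666743169,
   23671877918019, 10403034188967, -234033940208514, -172713194880531, 1968394172912496,
   2135115900056093, -14127288701682117, -21432165018210371, 86095264485746456,
   181436563937814414, -437140920427087607, -1322598357008433130, 1751450443759394374,
   8408473078659424219, -4532923436239473574, -47003752210374197731, -3140395679561327260,
   232190262744883222373, 131617127354351405661, -1015992614807241565327, -1028291720677531363726,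
   3936953776021756099181, 5691293676770955275674, -13461062784188874299543,
   -25773208991639197481578, 40250519515627560790630, 100211378704187925995451,
   -103251297508024526979805, -341929183353332283494441, 217326499498932359196953,
   1035393120488174136644101, -327953548649163935878122, -2798678107177071722012123,
   115030449433150033590738, 6768952946596022639350194, 1437769666157996339696281,
   -14644217926011273866456845, -6747051510052484285689086, 28249563505488327518251175,
   20390109730467165271110686, -48254108481995573486590605, -49251385696430365088787180,
   72017577554740492225800485, 101010999832934463710142465, -91443268798673887374956332,
   -180236966244612057265061811, 92774546094200984265511076, 282836353326028190978487847,
   -60413910223230245001643867, -391887077072428623603702951, -15045101339272082265754302,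
   479108065021963458266153405, 128002254890654914554878186, -514257456328840496685727767,
   -254455649793437881051757272, 479451296751210724687274253, 358786828006973218532228935,
   -380242298948445106772688709, -409160791782388746448578235, 245329506309457343406461200,
   392964700100727489685913516, -113614019015579247802130428, -322315703690852382570505527,
   16265680522482091167616450, 226138127749615125458304900, 35057726134740394671594686,
   -134690793621478068322050997, -47801712248167220505386071, 66821270646566844908867052,
   38880074559485821398683115, -26486537137746129265035745, -23942190758503007994205391,
   7505682864509970165245352, 11792404495209607354838111, -829653896148928508112135,
   -4696491378975257069824541, -573782771756517146996480, 1494045107101562237101482,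
   456149914089121074041524, -364765923847103771852799, -192787197206688160734977,
   61121836541009521401345, 57482303264543483979288, -3874500277392663520797,
   -12660801113887112661720, -1375248350817748632343, 2021332130950294261885,
   552681568532179273434, -213218402669006084459, -108600129392360551706, 9614652443013196111,
   13570937030375552924, 1036118065507865707, -1070504185788475878, -233512691110757619,
   43661683902658798, 20325040972130632, 283627717709634, -910201165323539, -122730035232454,
   15787393042592, 5192103029552, 220869700500, -67916278384, -9792607460, -279241304, 35802064,
   3287520, 97780, 925]

def Zc509 : List ℤ :=
  [-1, 0, 105, 21, -5267, -2340, 166931, 126387, -3711075, -4405504, 60238388, 111303999,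
   -704484506, -2169612667, 5142348375, 33901757283, 265731317, -435333843195, -691686980859,
   4668652728244, 12922907179115, -42208336849224, -159638647074227, 322556593932437,
   1554578479249655, -2070483944786408, -12652761540201830, 10906541244448653, 88498155569789126,
   -43977434581503802, -540316902629603529, 100630696010339094, 2906874760332368421,
   283435256717159586, -13857760805021473819, -5166287242274249457, 58695121515717343289,
   38492153537302736590, -220847338448154230379, -213135878180987985446, 735573887565616881447,
   976923858488708209626, -2149824153922765959818, -3857475396783949843309,
   5411286060322653803073, 13373288165241373845489, -11238618911549447452703,
   -41119800250747914305647, 16962143617175662635416, 112735133489797755622119,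
   -7281451967608893540094, -276198389442659422522182, -65586575063784065037991,
   604462205274209596159665, 313657576181635674130594, -1177974415685552207315263,
   -946346769740288330083216, 2030104188614458437059825, 2274498988792247690165694,
   -3053104008478061436599291, -4639147776016386500670069, 3901498639934933685863408,
   8234229687769380577655683, -3977824227529906097544444, -12860035147437032086870795,
   2594647984924178617154105, 17743708339654894359100661, 674274050514803914213820,
   -21614252037327195295210171, -5601420690535099612801176, 23128196507834953193626019,
   11146214671254426400846006, -21506539072928714068684585, -15744871176293530621265905,
   17019259304947324361713975, 17986857627403141426376387, -10961179302471493421525952,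
   -17301319433228060381836198, 5069296492414645671637242, 14209173425976899485392243,
   -725928969109602572355616, -9979915731441938163952064, -1559246031706865224372270,
   5949381732311076056671825, 2124993413411882396001609, -2953629587708045006253864,
   -1727398796151093632442813, 1171413134666904094444767, 1063207410127023163326125,
   -332091930826725281217250, -523461710459125124678245, 36712179586726864909741,
   208410551659400707474313, 25410920938963836122446, -66283173478122989499938,
   -20203612600327436889626, 16179785939243187074347, 8540113605028432514441,
   -2710810183414869205361, -2546671626875112657920, 171845408778035680731, 560972781724072331928,
   60969623584497232597, -89567360948241939301, -24502435953239092962, 9448392705941788419,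
   4814476141399615160, -426051324807520285, -601608871252944842, -45922664513880061,
   47454969768165430, 10349435059490977, -1935477749611178, -900829014865482, -12570166777768,
   40341648838543, 5440114049506, -699728668628, -230143263774, -9789742484, 3010410908,
   434042576, 12377218, -1586876, -145718, -4334, -41]

theorem no509 : Nat.Prime 509 → ¬ ∃ x y m : ℕ, 0 < x ∧ 0 < y ∧ 0 < m ∧ Nat.gcd x y = 1 ∧
    x ^ 2 + 3 ^ (2 * m) = 2 * y ^ 509 :=
  main5 509 254 258 18
    [true, true, true, true, true, true, true, false, true]
    (925) (-41) (2) (0) Yc509 Zc509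
    [(7, 6, [1, 4]), (19, 18, [0, 4, 9, 13]), (37, 18, [0, 1, 9, 10])] (by norm_num) (by norm_num)
    (by decide +kernel) (by decide +kernel) (by decide +kernel)



def Yc557 : List ℤ :=
  [1, -138, -207, 1265, 16354, 245571, -734960, -16012964, 21665399, 568764807, -439606878,
   -14295714367, 5881962109, 278059461017, -33894110662, -4379817954966, -635011138847,
   57403443117239, 23768208970713, -636867631094888, -448410903610883, 6044582192729901,
   6261592579346427, -49319987076952792, -71031487825919966, 345465776368182284,
   681330377449991889, -2054231544320310470, -5648449990141457698, 10042321029872662602,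
   41029494051133264265, -36631941251578243076, -263510844327081746442, 58370267828630376077,
   1505535377835218333673, 478541026066190491862, -7681873923377069646693,
   -5983621603424468875923, 35073406522172169314845, 42149789502381903077964,
   -143281634727933070967656, -232433625120294676064527, 522340470320930825062212,
   1087012622595324782384419, -1688163103584332008842088, -4453654939603865289270413,
   4771138896109230415427959, 16250828153191687073409046, -11448515833173474120547437,
   -53301214400306101572038504, 21617344748927110373569696, 158004356873406608208030954,
   -23435757080719386060954293, -424626008251197761755689318, -35620242340071172085537921,
   1035939405199512799077584743, 314184897358760649254381683, -2293977450368126564081312984,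
   -1194271563833574460271996159, 4602923599830642169211331796, 3440393525305330633160488290,
   -8338496866461156697720184789, -8330302593029069293824788598, 13549477224169163968125958502,
   17606377888264234724862251789, -19523218555275922946585997962, -33058305376738653941045296459,
   24411266989573400489953832870, 55648868387744996799231163546, -25266916129390736652094423769,
   -84386615770576375683637839608, 18820903555708076800273124525, 115523151388799780087413278305,
   -2976413252142687572987487437, -142813785024429555755141958904, -21570501619679948356255118124,
   159227219041140468468444624232, 50592875230794902494036398691, -159641260340374119085819144969,
   -77275100066731842524937789631, 143223648545329211796091458805, 94715424751431445975140926580,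
   -114079674294754440980239014954, -98787682622356545936976005551, 79637944230261562012909296853,
   89766077861035615709740378953, -47613192375297883864112257265, -71820784967874079085300566101,
   23224202794530778631169938843, 50820746299908732136945090413, -8031339232114504420572791202,
   -31831679793306910071784525495, 604469897056881783503520616, 17619598941968565955626364112,
   1829016762170678230164293981, -8586472119250030148054101106, -1871564286607658001049037961,
   3661940693953605167188371826, 1210474365504749746475898861, -1354735273721188428630242749,
   -609541528012763906081278069, 429106177200644751218896761, 252655751362788903874060935,
   -113988011262674525569247476, -87930842360674852651264698, 24465419848955313827020262,
   25855859185917371941179790, -3895465497249748159664270, -6420117638872450569861667,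
   329032028411402149914964, 1339592754066662121245306, 39806990779864861992709,
   -232936358582341471705083, -22926166091659186237037, 33363909415463638142985,
   5318398933481269531621, -3875665064350389322717, -839961805521468933122, 357594264667436139589,
   98393869305972181663, -25446980697562614724, -8710439929002151442, 1333767141051537412,
   579739420474296791, -47140301023863056, -28446133782519867, 862302686566530, 995026888130272,
   6555241830670, -23548569944782, -777113284255, 347140232347, 17504890538, -2779400364,
   -161450832, 9617387, 506913, -8663, -236]

def Zc557 : List ℤ :=
  [-1, 0, 115, 23, -6334, -2811, 221080, 166922, -5433173, -6413283, 98033816, 179090097,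
   -1287953715, -3870267833, 10928687192, 67275628692, -13635605949, -964781073351,
   -1477383659811, 11608512612748, 32602207651989, -118430160718245, -459573242287433,
   1029198273050778, 5078981898193642, -7599845463862508, -46931670057244955, 47005460237099130,
   373665867725525382, -233542912967692450, -2607369181749027159, 810428247825021508,
   16114433796382053158, -483327191256357865, -88814231848335019099, -20918919676972637120,
   438371824613574734833, 218979029201733837513, -1941834896355958997055, -1505426026810422193952,
   7719598252331278441186, 8328640816749585344411, -27471381327972646945068,
   -39403796300348226675413, 86958364338683684884666, 163755880330668965205587,
   -241648067886138474151817, -606360578263949424658120, 573287478308129731372011,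
   2017204126063101182723572, -1082508535090930882749642, -6059416789287556291665124,
   1237897887037573873343977, 16482602244730980556592316, 1314077782475509025164877,
   -40652807877655938431658087, -13623772929439388752620411, 90899491261660502357738508,
   52517756341284719398823837, -183956214700878789363803636, -151374425770381415787598438,
   335726761602570981479801765, 365495555050256493307021278, -548982015939526180131605364,
   -769592139636828657266327495, 795121491727208469744648704, 1439436651051751435962902751,
   -998059959899771225407008370, -2414250597789351068075843678, 1035059258251792305985536901,
   3648895940170544244311175326, -768574864583384515074032255, -4980629137242359606149552629,
   108864994201409843233457755, 6141547515942167630303603362, 917274318127806991082395704,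
   -6832417910548532847877119062, -2134248953594155624665114327, 6837495559982850704209227225,
   3256171231177440657652546113, -6124844827293610689310449631, -3991819571417823104429893924,
   4872382677228413939114695996, 4165711809464634436246142479, -3398027967388284597817701743,
   -3787623711332530316278963487, 2030208789233828135170111499, 3032227482628446587778769619,
   -990039435322440242788033319, -2146758143513000329572173645, 342686410355330209557366540,
   1345243827139634499657466721, -26373441854211211126493186, -744913683861594142831034050,
   -77335325217826915601336369, 363131850676210569128224914, 79302275003717432730903041,
   -154908129392519607960895396, -51312474231501315236918657, 57320039565808296628914131,
   25841212584391196821874623, -18158613959840709775926829, -10711169016200759747221359,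
   4824117988462205002373156, 3727626334431325140338328, -1035423164296627750143752,
   -1096048499217435584499168, 164838194161205627733460, 272141034754629479190459,
   -13908797312554470642718, -56781449094187228774266, -1690643131837427190483,
   9873172013380784971137, 971775279711929029399, -1414117496626468317013, -225368006896324806285,
   164265965341761411317, 35590070129696668168, -15156148172153545157, -4168875305442793683,
   1078541694280694554, 369047006668658340, -56531693299734912, -24562307139938751,
   1998188139583252, 1205191531966835, -36561918694840, -42156528241190, -277217904466,
   997681473698, 32920408151, -14707182493, -741664152, 117753028, 6840856, -407447, -21479, 367,
   10]

theorem no557 : Nat.Prime 557 → ¬ ∃ x y m : ℕ, 0 < x ∧ 0 < y ∧ 0 < m ∧ Nat.gcd x y = 1 ∧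
    x ^ 2 + 3 ^ (2 * m) = 2 * y ^ 557 :=
  main5 557 278 282 30
    [true, false, false, false, true, false, true, true, false, true]
    (-236) (10) (2) (0) Yc557 Zc557
    [(31, 30, [0, 1, 6, 8, 14, 15, 16, 21, 23, 29]), (271, 30, [1, 2, 13, 16, 17, 28]), (11, 5, [0, 2, 3])] (by norm_num) (by norm_num)
    (by decide +kernel) (by decide +kernel) (by decide +kernel)



def Yc653 : List ℤ :=
  [1, -162, -243, 1809, 22600, 392823, -1200766, -30453982, 42082220, 1286425813, -1023600953,
   -38581211059, 16708959683, 899052618955, -129862962245, -17043085850435, -2044951701420,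
   270182155816256, 103969529969700, -3646271076415171, -2435144095140902, 42373226674912717,
   41853787171877415, -426710759619815614, -584780936433953949, 3727733798641041291,
   6932318468643035089, -28077371366343814823, -71362726838898333095, 178798718845205782952,
   647240916173514907930, -912110340179196859262, -5222890804129395664034, 3065919281008009352229,
   37755335215662971790225, 2364092513382481512125, -245659405543674781725343,
   -148445856882252530232871, 1443134551127011161217750, 1563599092507897928190778,
   -7665483932310714813366331, -11781027681753308097133762, 36805271468540366535305013,
   73613317419879621101993780, -159330175593209252431982934, -400893013864847325180443619,
   618077074625633004705872439, 1947347418577510252350497758, -2121706970549656630947424781,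
   -8545180730618785362031551576, 6275774244136608661074250883, 34134307940097633790506547548,
   -14970288702917402760604654231, -124723352669043009691391295775, 22438067870497950327958989131,
   418113533527402035828466691332, 23431683866003029451109261278,
   -1288116009192150533377257532373, -360718091069092170445356225648,
   3648943531258302343980759285188, 1829717872664413462119613713564,
   -9499202031219139401875333672885, -6933737190617043304672823932692,
   22683729461294379851155701850320, 22171766605915727421384839172566,
   -49510622455355132995652627103408, -62438191680795765291778557936286,
   98158644144290528143098613635521, 157966393849864814735221947100820,
   -174842731792572978776228708980224, -362898309965282908951373760516919,
   274095254437644862937260793278022, 761696474389139341236268339529186,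
   -361570633342819729703938177876407, -1465904858110561901230695085947557,
   351969320932482662142158051232257, 2591684006352186622143530186083597,
   -92137611228783702836096920822698, -4212136436011687364760919047319560,
   -633056610110140762506017392862780, 6290770345571614332678163903360932,
   2053823455173372686055774585224079, -8621241641703716548458576412942481,
   -4322859030433815475945490456870267, 10813225047205456664132278932520934,
   7400591693863527452212128197805742, -12359543910121129375067967582830586,
   -10971798285458694360834276201111659, 12786736857955928226120290545399249,
   14455759537227851303809801272885104, -11840444488706884954786037836699322,
   -17141256127348055918723069509322448, 9619008521937875453554736639151375,
   18413519464337749252096718322135361, -6576293497407145348466108810829974,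
   -17978423632709408894393810022937107, 3375136197099425245353461952063733,
   15974454386380201663669152097976990, -654000577219856063396611283681978,
   -12913987534350258724983908461167968, -1181644420295590269345140635268233,
   9484633790238196991769804556244755, 2049202683892948338745057608573736,
   -6311706582743654541716309501873946, -2137307192167964512343726560484539,
   3790284559994025704377358825550882, 1765112410134750393749658983236869,
   -2041809640588137894106692365647731, -1237018267275783941806875727676442,
   978027563794248487314412037364213, 755631833228442404744184931621014,
   -410838725877027611295558064113080, -407177607311365051925973224575400,
   147743446853578344269837935425259, 194579923149599392432662150862887,
   -43263853345567620392822335522069, -82599457824878639388024471282610,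
   8927493782336462179529107597946, 31128227521612430509193365965204,
   -358471998442301810237038989903, -10390767557601100308965404292543,
   -758631519753656989000187505816, 3061174860138843240054722473888,
   458026666597400619486809322348, -792072061517976072883824185735,
   -175611459876666531231086779756, 178899487602623550657976286204, 52323132295417467730594336682,
   -35004708201289353757956993979, -12792821225121187538513514350, 5878354238586414002108610850,
   2617565647127008919158912813, -837372968168103232648196911, -451212475307117060192900520,
   99669184526690560969521663, 65556377499625768921571062, -9710439026350803517078412,
   -8002926987884770605565949, 750899451018697527033988, 816368161007332623717514,
   -43676409225191687222253, -69069916857075832204301, 1686208783289387851713,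
   4801712679897505740292, -23285460801874256869, -271118600962239679836, -1719820840872257385,
   12250209111770337332, 123412230644987437, -434281256264585782, -3152188068033396,
   11748226377645175, -11777445083463, -232654289973485, 3108581286784, 3154054239284,
   -89417529344, -25874352601, 1158424031, 94822257, -6004867, 13186, 1661]

def Zc653 : List ℤ :=
  [-1, 0, 135, 27, -8764, -3883, 362198, 272370, -10597894, -12411351, 229396141, 412816029,
   -3662989279, -10674445755, 39210391255, 223102082435, -122579418174, -3867526500452,
   -5847110766012, 56588302362793, 170637849874836, -706880666136237, -3005244319067223,
   7585030357904024, 41147673039316985, -69930792452733113, -471137962890651395,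
   549260625034973571, 4662573535563080839, -3579959876295104334, -40625078355943843916,
   17921507107575452428, 315272205516054399942, -48367210426846066753, -2196090842095432079889,
   -251720943753959574527, 13801940859458746809261, 5197333198221933007419,
   -78519757088464526325480, -50581552757452406539064, 405002689756105216899521,
   376708144364699630084698, -1893634496073486200725805, -2368741958855626446869216,
   8006382935452480236412760, 13063264657056541021517217, -30433452218750349538682221,
   -64398508930372414354118154, 102777402799885271094460733, 286915052597668629480119854,
   -300849866089074382710223239, -1163203606683426155138283470, 719025665577125560558312597,
   4310237723236129438278555271, -1136704975132756037641389083, -14638845864819111072589596826,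
   -602594828341744199607234380, 45641463150749507283137774271, 14391520508375319689950758500,
   -130702939569979106614997931130, -74986078163678039801064892656,
   343592240626048679993365955603, 285241393945280244969438346716,
   -827639612753022138312063653976, -910316502955882157777318269004,
   1820265591263204905757057793900, 2553746587299225920475248651478,
   -3632524669699197538337485929979, -6432633499357250947555547897602,
   6505348469839073729921419343500, 14712991304237032939731897841301,
   -10238870118773517019309580671812, -30753092483026533341044775251620,
   13529322959655996573951070493979, 58958686216416032783556680105229,
   -13108505675500537987325099891263, -103877306283957871399733022509549,
   3071650567598902939107271357470, 168306814244995479321700157686862,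
   24921083277972450085806547208078, -250681827175482566110146135633168,
   -79849031711501906623641596380059, 342735619873690591643055043658217,
   167741382763402307351175195904357, -428998888629718047690967021900464,
   -287192930088030216441359023827364, 489493817116629109394694501363320,
   426067991431695249378973101758977, -505678911125820435433836543142631,
   -561833495850685628914619792006072, 467714519925243592447838058132442,
   666773792078134636142496621931084, -379651851121089890385363979402541,
   -716832863159527917371963552568295, 259472368508249241886360274796184,
   700395629491681371093740976702079, -133283657605048929658437164280931,
   -622717628151441728916929372816558, 26150092432243122080523431944392,
   503688562130385682248195942045632, 46068196735345759298439947533161,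
   -370104613243631565100327610879823, -80200614375430707940879157618362,
   246389067688888658143618498470442, 83706211654944395962469501927073,
   -148009127767927287984897495977692, -69139221685000093270261871222557,
   79753121030911856719068189306001, 48452818507345222148119447674574,
   -38209760380762701663341301011437, -29595133958671995415060955710852,
   16053127465697679855514977539226, 15946100071884096080341422247414,
   -5773380335071377095276618426101, -7619553147583166260671030701203,
   1690549759295202442909988554709, 3234243688634762444797941373396,
   -348702176545986174777412573074, -1218760120187167428114488493636,
   13880212977722673530233742007, 406803063076227535965610001737, 29714656145208843362566731786,
   -119839983897601625630007240684, -17927550385290942490502033284, 31006967171865491704089731463,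
   6872362314755243708211196910, -7003067787221789945518111510, -2047477766078571962180068018,
   1370230787340392213986882911, 500588751306859398382603190, -230098769256316823669874290,
   -102425660684297167982865815, 32777219446800405778209493, 17655986784581513354072260,
   -3901328709025104638074773, -2565234661310621369363680, 380096711609713517340222,
   313157637262586525068771, -29393349254153306809806, -31944977330500683985142,
   1709795543848252117919, 2702763537677506436111, -66022998086081231719, -187896228899557880378,
   913055143687081515, 10609237898372299536, 67227324553176907, -479370809421706316,
   -4827050652905363, 16994273273341106, 123292040361372, -459734790784163, 462075650893,
   9104363067363, -121663379270, -123427116102, 3499289106, 1012541437, -45332993, -3710687,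
   234989, -516, -65]

theorem no653 : Nat.Prime 653 → ¬ ∃ x y m : ℕ, 0 < x ∧ 0 < y ∧ 0 < m ∧ Nat.gcd x y = 1 ∧
    x ^ 2 + 3 ^ (2 * m) = 2 * y ^ 653 :=
  main5 653 326 330 30
    [true, false, true, false, false, false, true, true, false, true]
    (1661) (-65) (2) (0) Yc653 Zc653
    [(31, 30, [0, 1, 2, 8, 12, 14, 15, 16, 17, 23, 27, 29]), (271, 30, [2, 3, 5, 6, 7, 8, 9, 17, 18, 20, 21, 22, 23, 24]), (7, 6, [0, 1, 3, 4])] (by norm_num) (by norm_num)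
    (by decide +kernel) (by decide +kernel) (by decide +kernel)



def Yc677 : List ℤ :=
  [1, -168, -252, 1960, 24319, 437080, -1341895, -35232200, 48896077, 1547499952, -1238632965,
   -48290659039, 21129403878, 1171843150698, -174689542427, -23153959171570, -2660051606385,
   382967033886077, 145103223072216, -5398399948062842, -3566147653739162, 65610041433973626,
   64184533337964384, -692038070420859585, -939139362740612796, 6344393197459004812,
   11666294961948223180, -50283095657195985166, -125960036543249933368, 338457386577454568716,
   1199476404690425143180, -1843202581026677573826, -10174466992441215514690,
   6871915340242922328255, 77413126860473337048109, 258809827392371806185,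
   -530908875068630917777170, -301108558972671714132393, 3292483308590804536490231,
   3500809432714819201532607, -18494888932943502515373588, -28283005263598001082518008,
   94103208822859426515606861, 188264254807053775275833601, -432763914728703873933940309,
   -1090274432377837350265948359, 1789196076898164389816432013, 5631080206737501562405366860,
   -6576743412045377772307104185, -26289711054849099211179523461, 21002376377015408855317567518,
   111849070441853826939573894008, -55135831241390494942322381674,
   -435861534440985010715496533465, 98737559077390598154921776039,
   1560741233008839176858346176743, 24389950270045689330406643924,
   -5145003917359287021383685409199, -1259165004980033169665696421267,
   15625366130032315815251053497111, 7349221839045725436498660635056,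
   -43702694311592054106819287896575, -30684190902117357166850170551650,
   112389327610587244294702487694080, 106964741596886509626465812865178,
   -264894372804341967574900004861016, -327335502670484329684896546926327,
   568928991084251761301938745121072, 899415093174400905958933755339406,
   -1102312339778663634045263386191157, -2245441113405197847744353480233792,
   1890846029690673746060567486499101, 5128191631888933327167019259843051,
   -2759029983630761879665431347957543, -10756240353068000356009137567699173,
   3065180255545604458142818444230975, 20764245482853958749613338741082450,
   -1348252996680680650188416797386631, -36921633583371017257914473674937823,
   -4976143431039097385438294165698048, 60452254165172068912053021610308657,
   19602962234076570361746512533636227, -91006375692566828781095659371835761,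
   -46687505328196289354101504915036974, 125610866933044020601710377744689899,
   89388635957558891291054626763264498, -158206817797506375330044582539054522,
   -147850300626201428787242590348524035, 180429165615484317494733001793943205,
   217410560881887533748362023799104940, -183882737834977974804411451762108944,
   -288156103329385643571815485954833744, 163363235469701678137577170169649359,
   346670097639100352564967157148666303, -119663994021661591688807021081734738,
   -379857355254909346055974862341257993, 60399419453491959101166726007407321,
   379494380162244982670047323476785284, 1976725358961181038705213600297141,
   -345432518704371135871305282259505453, -54347014637195460477460438282065590,
   285800381318656209070776328116746436, 87424337161439759593420211114695492,
   -214012511460889394454248050772832044, -98459615077198803485673097656392396,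
   144034985505505155669258719322079695, 91065575261142236085887412755598738,
   -86142984883116855572924868751461964, -72637702002683206945737042021046093,
   44882359023673423802090148811489577, 50974518154106801886922421123182017,
   -19574356479730273909483091674393547, -31743382516571502059799703329485245,
   6433878421447804900432616365067670, 17589724306069203143538563028275305,
   -916131505288662855570928408696759, -8663945596482563422439016423691918,
   -705182899713422892969396951327431, 3777041992496191123191590194658503,
   786302422690277582722090075397188, -1445691945516117139996676587935986,
   -489981910570979233986444284008156, 479276587847308332861395071796914,
   234242707423882863064781171811452, -134356594963281926488522492262323,
   -92308923975293915799154042957362, 30324073817201240087072664465305,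
   30708251111414692901602687495465, -4807020107595773450455229255648,
   -8678343713735927154820655813383, 192193359641206898096296433154,
   2076506952986332220206708262132, 194564467765533392766629696189,
   -415808864665108192427661870153, -85323399567450883973515781609, 68107701652344593397845833962,
   22442890384289084623302548814, -8719038039067323398078237609, -4380211650929454904381817621,
   777615936732487101189202408, 664349912035005371106774649, -26441843392889254475346009,
   -78551918701284658897155752, -5237509923588058956678836, 7081424896796815449759404,
   1170310781722993839941268, -459610402843230662129583, -130937520426398861829011,
   18250276026775093309663, 9617747622250864598152, -98405096159811639610, -473787874449769268356,
   -38145943106595694592, 14539614119424050278, 2509964494532149075, -204015579629055523,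
   -78291891037158836, -2051814063139733, 1195969630099687, 119252934233065, -5012716055467,
   -1403879858966, -56110348710, 3504345585, 365206647, 9025274, -78936, -5761, -52]

def Zc677 : List ℤ :=
  [-1, 0, 140, 28, -9433, -4178, 404997, 304304, -12324525, -14410264, 277868009, 498528669,
   -4633432434, -13420182246, 52153185221, 292295848044, -185992637857, -5285915124013,
   -7967305450412, 80777691000608, 247846552529104, -1055282325103274, -4586913617511620,
   11861188629584731, 65859273761417942, -114781821207128984, -790691211175976786,
   949068047825050944, 8209315022828109902, -6545890225543259468, -75104221192963084550,
   35128338262161990404, 612623057700536272546, -109134774698886607597, -4490652711218637481947,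
   -408468541343698582803, 29739113086239124992176, 10505931790282792478443,
   -178543200128705799310521, -110777028289066632472059, 973498364567945964159928,
   880807984270699169091924, -4821091771205308279976281, -5891339736605459339173345,
   21642287592054082752282683, 34531969934107550545936367, -87618861568360127192275717,
   -180991413101664243237014210, 316589244880644032725308513, 858079338704464297833150915,
   -999255675074469043576442980, -3706329983156423323964595954, 2620662973238507039796096368,
   14652971516878414246840896309, -4868305511094999050456893891, -53182583411339562690873523301,
   608835916861562021211110266, 177515034088578926360031159881, 48880611294319477714589168777,
   -545284195113951146899846795359, -296592180770483909925864898222,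
   1540902236117008898153952658589, 1245756941432206773213272195746,
   -3999470064040569354696850923978, -4336367671499565985667530846280,
   9503905638348685810636281097336, 13219245656583148682633004425591,
   -20557818665808038710237623869266, -36155334923852066422622772060640,
   40070199697539209631440364487751, 89839553982474060740319568116730,
   -69052984566054971858298435849865, -204251444718029509805796185202659,
   101016302570435360142049470613251, 426613605603064725574712823527235,
   -111929862499256509062193833105005, -820399945827671858579603898846876,
   46711462561927290448836322300247, 1453764435889533622508707103342143,
   192589072458492573333720961904594, -2372985962561934183651263967962753,
   -746700936183559696247498169712291, 3562730033878178137313828312159863,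
   1774759044552712295497802941228616, -4905880627292968209662420540980529,
   -3398914101620288817139509670293468, 6166456922120445075677231954489002,
   5626996947069475617398764704412773, -7020609727077957020611382173866483,
   -8283302801968047193319901514487084, 7145056973628321826303414097533140,
   10990476832693390146988588365657162, -6341278984541884353860372182633883,
   -13235453416551143186528216762704769, 4642972972761756299791335097780024,
   14515550981752482393933827582267219, -2346609341132800631322559270186199,
   -14513188339824245712597429063279384, -65993771136888288045691296606209,
   13219654511443716913022009214961351, 2089019998927151223490776200956894,
   -10944013324850280010713818897238810, -3365525698731797240731117974486798,
   8199181372197441210499422765227186, 3791028364261867445837539626802654,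
   -5520521987719259896711681649286963, -3505984328700933050968917150519916,
   3302764072468772259014803039310246, 2796032768452506480031175896305247,
   -1721240208168746533793331508111921, -1961790309531459938105569400830715,
   750779253654900331235420808738707, 1221452720110270234717291618817981,
   -246746350657564188330247630993552, -676729004579398859365912200968115,
   35066791433678921943903409909593, 333282994837300404882988748261258,
   27124551037236266521335646481597, -145278186635787502606210662332501,
   -30215493177398467129930822042098, 55601290190968876128129590323936,
   18825896263482131074387135125378, -18431701645901688067669449348196,
   -8999774996892856047453789184336, 5166774721587473376897540302777,
   3546615510563015330808386405106, -1166129640998823369091974802345,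
   -1179870880151263676636238315783, 184876425021265120465655799736,
   333445957858429398691686924451, -7405286656908111730975874456, -79786553501458690949350039440,
   -7476008059856986407924516557, 15976996428770440666021414831, 3279303285015579034570262307,
   -2616969356743578154553588870, -862615788540590835628566050, 335015206185654962907869997,
   168361678404031845443268667, -29876774791277495097617144, -25535846432201382878031875,
   1015420251525776753280825, 3019361013593010422946606, 201343709608553743838316,
   -272198783190380122684308, -44979808543603389264934, 17667288519675612653373,
   5032172018155579219889, -701602248116773035865, -369615083678824908522, 3790393504198373920,
   18207235383815025130, 1465836110683102522, -558706959227018406, -96464665171882799,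
   7837778809695067, 3009209263573070, 78920748986541, -45973931306065, -4583742540621,
   192826664083, 53949186642, 2155229744, -134549415, -14037681, -347256, 3056, 221, 2]

theorem no677 : Nat.Prime 677 → ¬ ∃ x y m : ℕ, 0 < x ∧ 0 < y ∧ 0 < m ∧ Nat.gcd x y = 1 ∧
    x ^ 2 + 3 ^ (2 * m) = 2 * y ^ 677 :=
  main5 677 338 342 6
    [true, false, true, false, true, false, false, true, false, true]
    (-52) (2) (2) (0) Yc677 Zc677
    [(7, 6, [])] (by norm_num) (by norm_num)
    (by decide +kernel) (by decide +kernel) (by decide +kernel)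



def Yc701 : List ℤ :=
  [1, -174, -261, 2117, 26101, 484678, -1493669, -40570870, 56501445, 1850610544, -1487755013,
   -60009970999, 26439414237, 1514308768244, -229987662891, -31137127446231, -3495187454114,
   536356650789264, 201918528819112, -7880075592038974, -5188936753798568, 99894873968249789,
   97568421915003614, -1099870379017065498, -1491883077649057812, 10533209068708923347,
   19378594125689172658, -87266161245014002101, -218933938955243529505, 614337845883854822590,
   2183167776269649962128, -3499192690493532093047, -19406567990277126704420,
   13610666371063015468401, 154849991792909475562362, 1530774080020287062695,
   -1114482794894651499580588, -670624972654176408219867, 7257629240782480208870694,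
   8157404743327509150131230, -42829327051775183564436847, -69235731872426026047416009,
   228987329663629159926006576, 484988458097893061988471617, -1106364721808218330688761743,
   -2959220347329860847763333568, 4801089731323012782009586725, 16119399756776874532251194906,
   -18477526713053550726661263228, -79441862755685323577928899236, 61393964393083192225979955159,
   357069616001939574331617632079, -164644232042802239716153911984,
   -1471060549719435370970766454575, 275619428548104970670554499832,
   5572093390468315166333096264580, 356807184126257307880783684684,
   -19437331055810856168471724526988, -5926794114947929105449478999482,
   62470500984850155160968896979516, 34100959050573585806950708159553,
   -184833661980032889301179792053710, -147556252016525624645760907950757,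
   502279379914232721732099843847058, 540971534793973253722480269103319,
   -1248034556559684371781792080999648, -1752778517003677513015363254678626,
   2812940818683471902422010017908740, 5118766577561658074134956442880356,
   -5667745007873572934247879284896018, -13616668955015478443027698869332854,
   9912881789911801429402836058872570, 33193494127921996745049876181837038,
   -13998462444255275455079352744269277, -74400498334333736113443367882907381,
   12022369554614500208761130751930788, 153579301230174284889143211287525166,
   10775853087961148678321535501510050, -292014900164108721153839525729867404,
   -83784755796547241944875707932612750, 510846959406910961499164503545755186,
   255705505466048448551276257557605793, -820002316485293333315440651489615915,
   -593620763101341890435183733052873165, 1201928904448518165221985501978608445,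
   1170913721092038751297790802363786824, -1595524533761489788864521192041923271,
   -2040870636067687263517214964056097028, 1890448049653458853887866973228963286,
   3199812106513535527000799712212565845, -1943059078744121264687382101642015067,
   -4553447984288417175421231413214590177, 1618706972794595907426935539574507718,
   5907064569841936320499543028880747634, -850942143555697696235155463935390343,
   -6996830066066309467708302819618144994, -307090360800352722976394122927990690,
   7562777595239914093214148776248368916, 1669298956917236235226910631374835760,
   -7439975254619825741896337700068662850, -2959058600165650300063277442884352182,
   6627448996520084669524963222863327236, 3897528515494714354098628921194085983,
   -5298466491805252794975382300981544857, -4300694829707880946706279196676719152,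
   3742624868243782040011366063374940205, 4139516779639477759875075440428569618,
   -2265332967727207594600112910322029112, -3535701821701599547985641910763895213,
   1091683716023832744322353264228923694, 2699827670958408625269217120880093852,
   -315828626113895345712790729356413240, -1846890157385579347667315337553461916,
   -90998968752832700047049190888752902, 1129909807876062255767988641813667596,
   231278874098215406351847116779186187, -614845832288685942222867287253685635,
   -223078492199102054079591047183273521, 294462526227153057109384432837445509,
   159394897402582284516265847160357107, -121719805852336662720900503212359111,
   -93997611966025055170978404615225328, 41723805892700105619954781996600316,
   47395841646334144793877956420400208, -10671732304516183523502329811198642,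
   -20696629919793255328612554888280310, 1164502301062366733108084345866499,
   7844042052325309900779641376816692, 693886799634878393131885457960545,
   -2566549787713748847092467506937604, -581650871647539647930481403061340,
   715089529549478079523348262891074, 269603064022619394913880007050854,
   -164922679319131930276034775203092, -94460674566484255657340571117678,
   29501188164982341500391540313640, 26790839644879246443089818819648,
   -3284322843522275903280102947692, -6268617599231131883674466240924,
   -126320050806830508123830764820, 1207909987430312015866494316358,
   175329190744325388084949662274, -188125520769515835590826302431,
   -51894185654786130594374531980, 22601885677393600302521252782, 10217192934062732985026465961,
   -1834824323688428190662419919, -1507160613821852303064562575, 40406462116520414290275676,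
   169918371018694678620116860, 15217185501073239421511588, -14310926673854351135354259,
   -2910293603231304762871821, 829372256677870689770552, 303425892054387141858131,
   -23632014246194312173628, -21069116648648034273144, -849777322315029384238,
   972253217342982046344, 134809039000832595680, -26030708490903043438, -7305452560336606553,
   134482193355003455, 212922892873915909, 15916661930317106, -2914993658360899, -519893284793623,
   -2173807057088, 5725300827024, 461683934952, -4370699269, -2499092550, -142589337, -3241215,
   -23564]

def Zc701 : List ℤ :=
  [-1, 0, 145, 29, -10127, -4484, 451073, 338692, -14254173, -16646274, 334106253, 598184789,
   -5801621099, -16740187714, 68264751219, 379351280845, -264468068510, -7143637157334,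
   -10962180559252, 113772145112714, 359585020424348, -1550326111629281, -6964637611291738,
   18190835575782214, 104564633211305394, -183914171308381717, -1312938427978049618,
   1589912341710150601, 14263531286979049807, -11471194688218795488, -136625095566100018202,
   64385646157465569643, 1167580061574202143498, -208129007159348643179, -8972455032385174487252,
   -850085880752187190161, 62331150717061853981456, 22552726785505243495007,
   -392763684370084943189624, -249457702597317522129006, 2248610508096370299686241,
   2086090455020883453904449, -11695002764444928141591494, -14695762738771298659392301,
   55125397888871232418221455, 90826769505999150972136672, -234124228410243679557339355,
   -502451562139056455282924246, 885348895743571131248748212, 2516498182480275874251734346,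
   -2907478329608782990930831515, -11492032639052871288823517547, 7802852527166768261583052808,
   48069153908262776537537804645, -13779679143605793356724413624, -184688873311406251273335184534,
   -9503048569196293676217198564, 652817344680384908330258194152, 232879692844218025592725767232,
   -2123683393697089144382320441218, -1372887210087632309944622006719,
   6352997051623225768697797395112, 5953512219701359304892010782593,
   -17436170846152050063179500941724, -21753556583783076419656957072429,
   43708542108774816052482471946848, 70122409580669949388843601677828,
   -99276628414092450209222277538800, -203639831830635628261635977372476,
   201328394159555991442756355788470, 538715873067623961031373682948962,
   -353833747673686831517182123699182, -1306350662892559407573516574277176,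
   500562400001302465092389027951257, 2913884418908877944457607452973003,
   -424982217392606903941979317284350, -5988359328962699470827985387529474,
   -418061573517805997192558023964198, 11340979014113565238147125938209134,
   3119867914302162767170094769697836, -19769399169660964251729045884876654,
   -9497662185212366078037639446098383, 31633922585772092987398882073661485,
   22066614614568156482992518106630055, -46240305287602239190621173315885909,
   -43594037637588225241208498555715124, 61236436190355278961172665058586823,
   76112215887879008284299186993917952, -72409171272875257590187550102228624,
   -119529262419831570618373516687641799, 74303354682386862967513957911563875,
   170350580913936138876780827524395515, -61834280207893798295710669506345302,
   -221289469435997125108702059791422926, 32529265085392178211872528583741405,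
   262426297931854931919509247463892262, 11540635557980745564361449106187314,
   -283947855609189869802572289029197946, -63277508146032633928139668331856412,
   279588323796621687166459512946579494, 112182019897108059585723681692235392,
   -249246214974185667060016336051048266, -147704121239462875347494030454772505,
   199395988736623381440221890058013597, 162908728997239507535594443874562304,
   -140922355939413095090132981621275507, -156735203635355453923227318921656648,
   85335007105767059097594744068716844, 133820698381423016161742529425855357,
   -41136541121880087508923217379493672, -102149512821994222008785988230437654,
   11900510366568103097948712727677296, 69857819934630954008753913670191108,
   3437171700777372059939646259919818, -42727821800986332033318654623481486,
   -8728050029069050059031351525089013, 23245743306825376743962973051611723,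
   8419035470480460425303184468319501, -11130961462563229927142501843057427,
   -6016265286221709033901514094413497, 4600477641119334371458986393762483,
   3548270412466756743237475212408336, -1576803303972876788735623375496872,
   -1789295562578655082852165172374776, 403270410140721803104761677485340,
   781406995799478143642887195594218, -44008665708012994715484420275053,
   -296174441479654800664531799464478, -26211819908820193008202343050837,
   96913032742116148200190092056100, 21972714347733011886782792385018,
   -27003074993690712849096751464930, -10184392658211518226449564471940,
   6228013350093019191189021802010, 3568199565778057033941641385542,
   -1114092486534527164301563258860, -1011983664194151666733445131302,
   124032235962804354123858592744, 236782559379928680471234048030, 4771137961328788742461511706,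
   -45625206711143579445952586816, -6621758387623778211298570320, 7105779281345505696764215639,
   1959932485593067667775604894, -853696639309826928432889720, -385884978646646204569254325,
   69302559843996763318945207, 56923189103049255676957755, -1526168799755697559906516,
   -6417603414626903665653950, -574755250042108051197532, 540508658736311845399857,
   109921674210777747270875, -31324662390181397849406, -11460339690529459687829,
   892564862418118991538, 795774214491083770622, 32095362189862926162, -36721625618785313910,
   -5091647476503638232, 983167841041480402, 275922577591595673, -5079306265785115,
   -8041979195182557, -601164785503398, 110097765133321, 19636106548057, 82103217600,
   -216241648592, -17437559240, 165078973, 94389422, 5385525, 122419, 890]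

theorem no701 : Nat.Prime 701 → ¬ ∃ x y m : ℕ, 0 < x ∧ 0 < y ∧ 0 < m ∧ Nat.gcd x y = 1 ∧
    x ^ 2 + 3 ^ (2 * m) = 2 * y ^ 701 :=
  main5 701 350 354 30
    [true, false, true, false, true, true, true, true, false, true]
    (-23564) (890) (2) (0) Yc701 Zc701
    [(31, 30, [0, 1, 3, 4, 6, 7, 9, 10, 12, 13, 15, 16, 18, 19, 21, 22, 24, 25, 27, 28]), (271, 30, [2, 5, 8, 11, 14, 17, 20, 23, 26, 29])] (by norm_num) (by norm_num)
    (by decide +kernel) (by decide +kernel) (by decide +kernel)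



def Yc773 : List ℤ :=
  [1, -192, -288, 2624, 31825, 647232, -2016731, -60155296, 84714332, 3046741716, -2487581675,
   -109875996376, 49745834495, 3089751100036, -509365983070, -70958567444398, -6915035490415,
   1368700460342059, 490818406885005, -22583080666390503, -14355119649763644, 322618118939164176,
   305078150729378023, -4019967936842522445, -5270042103138457407, 43813701430811538713,
   77440452918608225484, -416500349001254798669, -991891278050399480031, 3411381588294284038843,
   11243558190861983380550, -23294902115645834370387, -113966150878916169193696,
   120209214656361995945598, 1040594398368582191812507, -271465148752083053927848,
   -8604745860541792614780038, -3350277182703490208551079, 64682041096478718211893201,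
   61445277849682478873582913, -443063691266057199379083856, -647642689370050056239060010,
   2768494633890471187654991070, 5426625705763550644249531872, -15772140281884584446716841301,
   -39149482837528597124763543425, 81706462475409218089472091542, 251292878356934995050124209050,
   -382595014910196186913221029233, -1459706553168354240561615721990,
   1599899880150578927728322239274, 7750456607748787742948884317818,
   -5825576371543673978895436560466, -37855846005734129922662717708452,
   17363231590523546123889844284099, 170811075892773729571744147379436,
   -33894190708662977488313530762083, -713987971395259615579430627994253,
   -29786532899285410054356843813226, 2769570525023330720832519961752179,
   751702258354968592677395917408225, -9978135391878307342978248021072594,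
   -4979872336835795669800793581456042, 33388629905482021943210699307363493,
   24483904451397275605909097116427852, -103667774292741228469244509824855601,
   -102041055722920541086892027450129171, 298018222034564452615444763827327822,
   377315641938167883440061162046348771, -790124271926728241191257956355684935,
   -1264342109852231392794159615014651962, 1918988216740944668439847731795272876,
   3883724541721505329375276039844705632, -4218854115510806327836869189218946595,
   -11010879168149795941049083629839961974, 8205520996576376960101664928695105280,
   28935086722529979652113316795927450962, -13405574017058118340247755305857720704,
   -70663388731586849141942135116617856873, 15608408840255809344285385595545460974,
   160612844642477100451499391157756817811, -729505238390152875631023520887311035,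
   -339976368300904062547733254671839750984, -66573964796209733712369901044356834629,
   670075743565719370933353525662981704829, 260457156580427532278712265736408558912,
   -1228504808261028206340226156862832646895, -715382023566137103563029414295225655763,
   2091031231167662950915330325302531427680, 1643526482582737393477763882101945193581,
   -3293557212562970422993744451605725160722, -3333081821594265346100475963168666733857,
   4775651586759522636208043821419129420467, 6108492365052928360890756180537669933348,
   -6320828215563759242576620753161238324344, -10239198444854737427151025091409636935381,
   7524431027135964093516850851576467745381, 15803093872633703456114436531032477401838,
   -7827451349582177381439860270391669514332, -22542061826387212235063919301610169748368,
   6641823081702727611133925027237553211205, 29775770800444875713855718355119626403828,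
   -3554945882623664666471491253170945059214, -36444767017920520249045587324575484088522,
   -1450097629358560502271723460593542016455, 41318084884558307005442981798072476744545,
   7858742593739673186200838046349943687270, -43328460309717466116798019799492680373152,
   -14664583082884923573760123022361824326429, 41921904369555549746340680676494421453538,
   20609990838459974794737749411796757879656, -37274536812394417282207041517286257405005,
   -24556555079329260962511346200033589681233, 30269491247509326383855836684273122238411,
   25839349738601440031780766873387414363261, -22229639644082783194563077154059010080179,
   -24454792246483081384366610668345004979241, 14514636385985481134638476900521480157750,
   21007237174308359071273398109934560499856, -8149214045007389967122351276044882807706,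
   -16453398220984928568151234136189202898656, 3621521347845144495059963093922734748091,
   11770832070899506034426221948123233978637, -896831343574807318070739440078963463607,
   -7691152337166775584014625085862133001373, -408590457861993620907830731358235509613,
   4582466282986602675062551947650117502572, 802020788000067605923398743963258165352,
   -2481637350987392458043158325022177239140, -734938707394775126602532626943938457281,
   1215291947411045428837205015014410288639, 515503136691988468803608113962872419791,
   -533931991179829797732060900093471501130, -304382734693248842780362062789552716706,
   207806466032691716592601318516271948532, 156484025508676007728626069000708793092,
   -70082550904530321608533871606885640924, -71059905855523559134490900981460691936,
   19575352347825195394112490943720686167, 28673372713043624410256041194573704595,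
   -3996943438137624070671982714491190856, -10295343835271546648053001422833573460,
   259619107773835521576674586455677033, 3283778194666875007180602650060431848,
   250479150994972635133941366061008472, -926364747439550797600247979434117318,
   -159537639774077321708043420490813454, 229449100930959365790481080503908453,
   61882377681915268706212176489588326, -49330026809389085891922547219281901,
   -18655379786031353542157008355655282, 9036168758526508247900014381880039,
   4647891199531344792161331011107725, -1363433900920488993240846662547659,
   -977677139624954266351966538672671, 156968523224452586886967963928389,
   174753228452556749270722510215247, -10406756208633267818071068035950,
   -26509703081949889706010925076175, -614768886874969445635739155518,
   3390179293349056195333454613872, 325977755651145159326800940704,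
   -361082345133703211682324597351, -60065644715679497577643024025, 31407937261443390437602288155,
   7609374325561847390427430003, -2158115590564633299932716395, -732956834568522669536281401,
   109555871798731674502256187, 55039872012459096948484101, -3368679328151015281172505,
   -3220902637938741279463040, -10856524999966724404062, 144695324199505800007296,
   7990284704259880659644, -4846164749220307979375, -494081955775383126186, 114926714602064799676,
   17566735736658901421, -1736244201892240035, -402465765976828491, 11660611819427175,
   5880676445134602, 84919968148481, -50758524259639, -2296261382214, 213700137514, 15708953864,
   -205376015, -32723142, -320083, 11709, 139]

def Zc773 : List ℤ :=
  [-1, 0, 160, 32, -12355, -5466, 609825, 456942, -21414660, -24904136, 559954981, 994464226,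
   -10920798757, -30994292686, 146972002698, 784122634198, -775582748209, -16529087879417,
   -24505761893903, 295580118633971, 967136440133424, -4538649557303722, -21416468406959611,
   60276100721716157, 364884123233211883, -693858372338668265, -5194116809114744694,
   6890629261344947599, 64041952382075746447, -58031844704256387661, -697648497558238737670,
   395133441222362892787, 6798882683313851057932, -1843154832521986969482,
   -59774920711393811912395, -27630749789555781120, 476900349269249375008176,
   125049745068601498119043, -3466735736210105940997919, -1820989836665670573753293,
   23020337138236180806922416, 18426421240171981097547794, -139799153717961209989070050,
   -153829625909992539706287298, 776114295205657432850940641, 1119466449448016816083867679,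
   -3929287299006699877186073288, -7283422549731426298856504534, 18040505577506711251373403825,
   42961310210482008630090181436, -74282756646364961616493671424, -231726236621651262831609402084,
   268085805827745080938306001950, 1149449080889171927186935129802,
   -803219672075557180063002337577, -5263727314336817523057028996750,
   1667302272131296033279839786833, 22310821713683362058404032838787,
   322696876550404035436061731834, -87673514105588989869221897544833,
   -27455283614185983257278899276245, 319670009640589136727834317430010,
   189865626263387967249286933649756, -1081451866362142306593434330979923,
   -940964435594787915958249097161136, 3391316870646260516876528034944309,
   3918987509701781708535602404669961, -9836566330748943571905756384005848,
   -14437930786768800309776885519695447, 26286044282537852371717907105833357,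
   48148900122012267659872655042200652, -64277309196580897050206848742249338,
   -147148618065957455986506542617497464, 142098024438678498635840866092388811,
   415088295754444448402077005066570314, -277433378692698506970231515998628878,
   -1085568409132672274269506841437247068, 453522046915869764830768257094164782,
   2639258649006731610616200837170297451, -522651939445529942731859048394487292,
   -5974210678917409705373785869564429003, -10614722048833000530786794479883591,
   12598653381617583063949408811566460886, 2393713052959251264866133798614678591,
   -24747705228669986201161283555975382555, -9252744019032402830068339488928233706,
   45235431676551335868395434242195348749, 25364761152011576296209734896852329505,
   -76789487160999793610004736453345450542, -58291306774059046344699704986437448947,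
   120666850496653331505198134150138687318, 118335716705019771076027874718675743153,
   -174612307916403967669044090309329253787, -217141296181096191930254421771844684696,
   230714391284172823210210004111166008102, 364438869573288297087660334778523808221,
   -274274604097888067113634634059562210725, -563153339465258738247352150691703830286,
   285065909232868206713684734136183582506, 804199265044979101532838436159713170312,
   -241886100981800422571881322676337307141, -1063340127411991754383265987745789879872,
   129945367220685617813116041633037672102, 1302675000821208370822269230757738728122,
   51214608388782786198303825984905181693, -1478041814449084088130232580432779053939,
   -282875195833538019041779068392568327450, 1551036071984161156035532895625046369274,
   528629637029881759044523129772136741307, -1501589255571204450237363871355799680104,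
   -743099092257738264736292386203537012742, 1335814320220922823495399288141154638275,
   885291646744868096894366855834218025881, -1085242812378801390080872031269325041401,
   -931341648566433134067061567975306711425, 797272855908624198918200289091334538475,
   881232284834975969445503626002619736229, -520709209193097579270052668028097362096,
   -756828088349422039478264441449627563056, 292393762727596781169453775577111000676,
   592643762853826097726262552928191027664, -129927613582396799821315300524842509435,
   -423901371572255855037287037169802506199, 32131248140756938336605893471468649919,
   276935553419046509417821096200440407557, 14728963779044619303011842464199745153,
   -164977989980974256134415190463929902766, -28846170814721722428930838547694840032,
   89333367889276459117915677222687485172, 26425940921367763541197679730406857197,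
   -43743483319342484264370055657321115011, -18534695660021724612174604088619676423,
   19216948923853751787500575554783918970, 10943989069260799167749403654923549754,
   -7478801477359971886278818365866762180, -5626468319971789478857988890990089976,
   2522132027068159828601599306717523728, 2555072540081546717742645042609117016,
   -704481339681507518049933809149458491, -1031027190731297594034222745406829687,
   143858917439785105341042848994963674, 370206333444536625702728069397516106,
   -9357914749405756614562163996316135, -118082870785099638111152040483231264,
   -9006087311603078461735054320245846, 33312209184736686446882913840334750,
   5737995849136028606901913812216160, -8251143845300453166592687772181999,
   -2225837716683423431833599899295896, 1773957857094111753944868605065665,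
   671027861852564242851013009226720, -324950721894329954164473792958739,
   -167184510292648857186395772071543, 49030201764078549548365914946413,
   35167116243551598662442642127771, -5644522034464425339934774324063,
   -6285891056270437138911387868667, 374161209238995819889078910180,
   953557162806623969595643018825, 22125266939518070239524324800, -121945312284541482015501253618,
   -11725560505493068271465967130, 12988232220857296237693064037, 2160445896348152509666776571,
   -1129759349449061319840065025, -273687826011317934413310653, 77629477353887863247861341,
   26362043606260645914469155, -3940937841761263890866749, -1979583709027438124710405,
   121188678365186025890281, 115843087109781837433092, 389427350861225707206,
   -5204061978353563896200, -287359362549465127330, 174292953403509444735, 17770358685154862692,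
   -4133256733767715338, -631833291557411361, 62439734548210665, 14476078376693571,
   -419266414963375, -211524420776024, -3055653224377, 1825819667245, 82595834718, -7687469872,
   -564999244, 7390617, 1176860, 11509, -421, -5]

theorem no773 : Nat.Prime 773 → ¬ ∃ x y m : ℕ, 0 < x ∧ 0 < y ∧ 0 < m ∧ Nat.gcd x y = 1 ∧
    x ^ 2 + 3 ^ (2 * m) = 2 * y ^ 773 :=
  main5 773 386 390 18
    [true, true, false, false, false, false, false, true, false, true]
    (139) (-5) (2) (0) Yc773 Zc773
    [(7, 6, [1, 4]), (19, 18, [6, 15])] (by norm_num) (by norm_num)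
    (by decide +kernel) (by decide +kernel) (by decide +kernel)



def Yc797 : List ℤ :=
  [1, -198, -297, 2805, 33859, 708609, -2214955, -68045835, 96123905, 3560799135, -2919513317,
   -132739617424, 60527458281, 3860593819186, -649418949544, -91757638569984, -8601922095031,
   1832958805920028, 649415131990966, -31344880453111897, -19759483710637697, 464502277630641346,
   436064484478594434, -6010085314667200743, -7821421432537912454, 68105224953108298392,
   119381231978095144331, -674301731521347650706, -1589202438156473504814, 5767965896821332832297,
   18735537120101026456196, -41353680661878828962894, -197662066712494185748652,
   227463236839385385876773, 1880124919350080257934820, -615995924309096897922272,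
   -16211051257770249712887640, -5587951555145213691111581, 127197793233983194977317572,
   117288785793168748707266714, -910536448572300431005166905, -1316929494611914961296980958,
   5953917547425002494995524430, 11628572484174788827430992813, -35554067643064614660585974238,
   -88134257016721334638754015958, 193462564840852965240613385034, 593791718832200057351276859557,
   -954244049392615212361889359311, -3620423607549461693878985962263,
   4221769192546107890424675395596, 20186742029722868750286436134240,
   -16393793631331281228951678794219, -103620606605859875291636735773358,
   53105439422051803324445696010113, 491839510364711208971479627658297,
   -121799063146142294560095611920677, -2165163562945624025237373271817984,
   9567639903025303059415142154086, 8856874511451167676973543258503559,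
   2010097129286928497366950555781260, -33701413161443447764730785711771247,
   -15327689834246084053456734576826427, 119315477500469291244550759150507558,
   82014396042144329256089942942416357, -392782563173617112709051131710783841,
   -366901410958920693411223653924647072, 1200263940813915555692223456314753831,
   1449315762384256106458458318101420073, -3393820830337659321001177990467130414,
   -5179437242018404860334741192118364517, 8830858754740462942408940481441150516,
   16963516392792221719571912094747165400, -20944762572876527449543427421271082267,
   -51305419635458934628234647547930344286, 44488410138303715375969177344776259848,
   143972042829436445361152021190115636766, -81549942925309066822661650100468766457,
   -375973964884904021195628671802828973491, 116739091124299304827026030885873851481,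
   915353520249353993321979121696073137462, -77397751903035877035089501325509107500,
   -2079570491370598886056547667981640791836, -254073983983955481183518676905661755114,
   4409473291687514971770467119216052543328, 1403972603003256357825070508242698517164,
   -8721341982988333203340349761131008364762, -4466048020143655694076045707673793532905,
   16068000200558422853215451251891828014906, 11435106148008949894681805397876257018939,
   -27508517282516184293369328994288922491830, -25516169426541995195278969531163883481762,
   43591084991615727911868140850705948057610, 51202716181462604902263496894940176685738,
   -63536782036213036216849472783098410594077, -93833904896939149702289595589484939301794,
   84294976417362756016726612389699704670202, 158370785259579829507384823583425653025856,
   -99883918335431513126526069343088562298135, -247363885924854337314877613118783482981550,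
   101603971758286982608350123506234217390010, 358527232884459476884723429990722862136271,
   -79630837592961948210343832741080720450585, -482837640837086839210740959166042943695317,
   26032556427313969280517616328893716286267, 604339168826741322634628771505204345206876,
   61518428453600651970960137793449083917278, -702532182834776329503723441085685074343231,
   -176798807629987475923029849431239556139559, 757272867578642536108916151629237297783683,
   304502839740459042841634965724200497111796, -754825330719575207464212757721167465402032,
   -423077984442716048361359935779089734112965, 692772360417038541562764633905761322152443,
   510438996967658418354782380085082380752049, -581568258970994369497122304065427666414517,
   -550572035408486123562699405848789716181570, 441781915279338936379123300945139702493076,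
   538366116065358143502276935183114275678626, -297978343274242909619532493833408882966165,
   -480664004428410587613363884607016534188462, 171702920107880062735361566566757267819568,
   393231565543686720748555179629835597497053, -76312812525538511284328986949184006911512,
   -295167823413311579636723166099187806845114, 15326924146722148925144260949164954657225,
   203219894364728510652405742692642070454117, 15777691120270504624931819178812798218734,
   -128110502631710378088218344195349301261975, -25807955932146469350448376721211681574301,
   73708277431849163879148455234827268262556, 24040452795587759807910164955991628699318,
   -38505611571519299476951949258474332028940, -17703357089251326883330117824918193141926,
   18119052187270682404771442237939316089390, 11127331329335389306484262993962178111383,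
   -7581213820582371855701075316454501741163, -6144630991023856588311866772168719017718,
   2756620469410478974290101202064779338604, 3019091899641509096439243244362166957628,
   -830220603962501149540107194509944356950, -1326930098981503990391369850286057408903,
   180388488389433503680416525923134253070, 522303706897958174951451287657014526496,
   -9206502399903264043239781111291720258, -183797731129910464268687470437544967438,
   -16386168806036391643021353243824412541, 57568345714338758999409771961372143160,
   11045356938766138612998005735358129785, -15928922538002443681185212228355997024,
   -4753722069921433904173267547243906150, 3846637725115549363831760658940713242,
   1616209746897130956220038897748569477, -794259452514753865651932515465679562,
   -459371926547204693508330730387093777, 134792736320635831443417883610651373,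
   111367366527408494297728896847065494, -17037957669264100766629263808194071,
   -23167696548346424822406185209428508, 1008017748404728550193471121866958,
   4128715264214865242921719766989509, 203228167892970043560123756642876,
   -625512380149073313684830189437249, -84444013222164814783580057889383,
   79405438150821001484402715225635, 17749765440501354447285461331150,
   -8231810737735669515403302208584, -2716222858044335051531973965464,
   662296749862214983924142596580, 325311181271773621469765876354, -36107066853966889285072152911,
   -31036286862863810869897668476, 526472794428793393134178483, 2348836128569283712515363291,
   138037951861287095073212032, -138142311391912031784030832, -17872683038780582689052624,
   6042427295057322503935437, 1275859186398268111283595, -177210408510462923893994,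
   -61916949322609709466052, 2259096252143387794120, 2098754422649863162319, 65972646201233291691,
   -48072707479807623529, -4245894416033761661, 668043867159708312, 106141918239446715,
   -3611508265692380, -1432484224297320, -36980036441276, 9554930291094, 685802071579,
   -14740019743, -3087294734, -98489012, 90231, 41191, 367]

def Zc797 : List ℤ :=
  [-1, 0, 165, 33, -13147, -5815, 670033, 501763, -24313725, -28243465, 657657245, 1165488330,
   -13291143695, -37562139170, 186171260672, 983326287078, -1059833955431, -21464748742856,
   -31681774118588, 397800099617723, 1321763263390455, -6336127972159888, -30488325115943122,
   87380760942868443, 539987867843095008, -1045928552537671184, -7988669331465007427,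
   10821105296656983460, 102396476058394232408, -95238563235892568533, -1160227811633440671468,
   682234337946553748250, 11768499184754032312846, -3429622858485717437433,
   -107774980477259216278270, 2075634478779665576056, 896448507198050099151306,
   217362973658254322141999, -6800640292101060228220378, -3433019255253452359928502,
   47180789725803591226240435, 36720698611462415463155686, -299748381740925737930489722,
   -322252534335516442257203723, 1743689131275201832269632978, 2461228579803778521403732300,
   -9268859740977868673923661928, -16801069441810228208526526567, 44805294815228071505453943521,
   104010088400885500600106135179, -195055491492952589430700397334,
   -589182153993554275511877336958, 749846550131320396814901457243,
   3071962551911814630508012539988, -2434163904966513026123203635395,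
   -14802043544360443300977726338131, 5829831785794682194170871861105,
   66094416430192893785996596008664, -3326916309467660469693230426962,
   -273986117060939514403944298134737, -70496192030306694095280691422106,
   1055468439193797234059426276618597, 574223579636136571991367478280705,
   -3779283748260153057778970976557254, -3110806049036062623495559472607383,
   12570297136667371887244976828541421, 13927162973431118835590454034875204,
   -38771759913518058972510603413425427, -54840786392258881379986301900958823,
   110543280433240553056768617360441246, 195077307645588583467968846939614541,
   -289727386139912146431001303745339706, -635635889769615271665472143309162984,
   691332030418691844338835648232066379, 1912523351625744581273149238534679954,
   -1475077817879918660924465223937137804, -5340140336949662392413421069396035108,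
   2709220446526649592076037452066402411, 13880074931242266946637556704143222965,
   -3860330256806897553933001598840237141, -33646024918078455529848439846876738744,
   2414880273214709551530340910869803594, 76135879013501690869901590946201983254,
   9173373549107682931645927916507032880, -160854726461557509438925538339218085228,
   -49211748691507464887758433619836392154, 317116351955172229206785736709790290148,
   155862899573447430027287839469268138675, -582554171365728362245390793868469959008,
   -398933988000195276026588764072906797605, 994776469560144894777617964871928010694,
   890903785905551423271698311841935722104, -1572821343299940880423346529461930110432,
   -1789925582560120597072051210312986871776, 2288064267428484273245043143586649286617,
   3284531997284489035050603434133042857356, -3030750275952467536748375102049047458390,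
   -5550745058361482975496002843012597136924, 3586903855213854719710236079237593452309,
   8680433953122126819715810037310483349982, -3646433960330996594472582677175788529544,
   -12595406904389502661919893983997442272641, 2860266060169248389803469616921961898247,
   16979642438267464709887011025240167134841, -947783995081678927500099833791113933367,
   -21271496178033588307454697237894788935694, -2171518856693711205259722660065767854800,
   24747296506416698119232799419718414270795, 6274070648672063071745551327567600744033,
   -26694096833503878739421098118229600788065, -10814261434674232074436473223330058116960,
   26623830175079277997202812864016526124096, 15025899900041397725331896412624869823231,
   -24447721217995717200172951302397946336685, -18125368514542694482335815711770934022771,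
   20532251512821511420074281466341950367723, 19545759688453455056298310233591345016224,
   -15602567834168200032582737849197459805366, -19107652041221130310478002692988346707968,
   10526523428941765054887506574538438287267, 17055625532356907432519236304123650666858,
   -6066423062070100843638142120179324066140, -13950184176023083400903848734631287571373,
   2695718795101597195511745183978227701014, 10469271602684361130179309721186028658766,
   -540070112749511565666035158648641100917, -7206759704894428633435759425387766321761,
   -559532351869668340623019007405434881872, 4542500477876568340313384545938956594641,
   914009478857057415656738172543922856931, -2613198418806286936493214406731295536120,
   -851233430616523450712638512634877565074, 1365007109723331819800568244403699484104,
   626825237700063441751015820153534230026, -642258263846983989134364996385071008328,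
   -393992976875552281746825234748249177237, 268710840645021433379478605123173618863,
   217573955016669462317460249740431008938, -97702654471714550011276717969207400940,
   -106906170174784560939064539303466806412, 29425468093441865705793240047611586352,
   46988259077547155401274149309346114877, -6394249454907231116583030017943922134,
   -18496003561020485466910213440000041992, 327074876521634791337765071932648296,
   6508885769628693982342769651430164112, 580290759262710692162690766798975513,
   -2038731466491492782199428457572944134, -391249001412535887483992410407737087,
   564118545739031093832190776609970966, 168395677419534076591817940275419536,
   -136229333115450386191291857041697534, -57253504093553852336098451472457247,
   28128985853221453053007851157480382, 16273113055829833395760533480248381,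
   -4773703330789356012316924786138267, -3945154429009847098001756588858750,
   603379465172161993329057799793269, 820707027242550535315785261175214,
   -35688739176123087150711752611506, -146257952130070278067060898099989,
   -7200366224184187359012199668324, 22158489702878864034779028790801,
   2991253863236615203451927671595, -2812904736503593514561439777027,
   -628724202000026807639581949410, 291609869279966784431984024020, 96211350832298462403771987986,
   -23461990696845064053503858028, -11522754995808398705158036990, 1279147952106111817331389531,
   1099321054385343099765984930, -18658800989570839365812779, -83196500279195284002500153,
   -4889121411156699763955624, 4893008587963908403840496, 633074384732275115206766,
   -214020717337228750435449, -45193678851404560487887, 6276582917544146298190,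
   2193260738997089918060, -80005746937290761836, -74344217221875099787, -2337152285442607945,
   1702901819509062763, 150398658210572373, -23664885924150006, -3759671396969285,
   127943233735992, 50739497152252, 1309838138656, -338437908878, -24292750791, 522078323,
   109360028, 3488660, -3199, -1459, -13]

theorem no797 : Nat.Prime 797 → ¬ ∃ x y m : ℕ, 0 < x ∧ 0 < y ∧ 0 < m ∧ Nat.gcd x y = 1 ∧
    x ^ 2 + 3 ^ (2 * m) = 2 * y ^ 797 :=
  main5 797 398 402 6
    [true, true, false, false, false, true, true, true, false, true]
    (367) (-13) (2) (0) Yc797 Zc797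
    [(7, 6, [])] (by norm_num) (by norm_num)
    (by decide +kernel) (by decide +kernel) (by decide +kernel)



def Yc821 : List ℤ :=
  [1, -204, -306, 2992, 35956, 773909, -2425759, -76714935, 108643161, 4144129000, -3408461100,
   -159544492235, 73103508533, 4794564697641, -816300904247, -117809178945015, -10819064869027,
   2434238538675563, 858159802295239, -43080733813204742, -27091683567904125, 661060632332810067,
   619830617201397829, -8861294863958406176, -11527491551792121699, 104082052663006693961,
   182507731977341226371, -1068618010866082615824, -2521308769658487393904,
   9482178010126820157502, 30862638293322417967198, -70522566535443786368890,
   -338244387129458665151691, 401941583401551669089489, 3343865031906844515947344,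
   -1114029172970719311162565, -29979827492206439713274896, -10978009164314518160927641,
   244699025591375934449817895, 236836276527199595097966381, -1822754296033668854583278243,
   -2762653951311363802656703051, 12405072915976344526444205191, 25397178790801292162434953444,
   -77098972869323133645195372001, -200619683694753104389115759356,
   436477888435648208971154822342, 1409862041902929482927977382733,
   -2237654320281639732795290509667, -8972243056822271572825131008348,
   10265715339427428368975779599543, 52246244367853382371904493357095,
   -41113043882148725489719865372067, -280218889118775879744668538799739,
   135313273634532398437058069994877, 1390325065354989125892372496904934,
   -295234565236359815669612261767566, -6399699240483186363644154476743661,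
   -243572506336884656822837356037260, 27377840090460226691178716785378586,
   7626470361940222850192509148064900, -108944660000314781223678227730673900,
   -56453440428001606352401086305830396, 403236697184240388061966560336813133,
   308987692496257128356472105842660642, -1386760778933667605201237832027702000,
   -1434114333349518497325974189070647248, 4420793376910136898197600158293990499,
   5913312492636569830066844674946166246, -13007291609326952667369473171941440577,
   -22132320358290862732619112978901240220, 35059152894681491101155749635641850921,
   76073945846617467343694826390774585681, -85401407492561763808401939662992375808,
   -241801366782028375451051922932926848281, 183028580947610900162593468959244722533,
   713756023168691430395462962407849385965, -323670365156592582897136095749202448632,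
   -1961755877041080075117583817828249043430, 374726795246679458558305628245381518442,
   5027745235840428978174974137724442359901, 226832182920329480802207533467571434145,
   -12021430273658703643521033376665460423895, -3200164759986817292246514791344467153560,
   26806235146807938703230283217159611810142, 12924029088929282398980677280101245038041,
   -55672802942085236408472082069843787000854, -39137315080375702329428583779968671958863,
   107421723038470656115769495850253683797742, 101084662172327195013667396617757713605126,
   -191760049059910221071383215579080465965175, -232708180516156602639063423784473615256980,
   314503877276359765265310160988612355549118, 487198908660581242116557220890897229079220,
   -468291146327308692256553670963644166599337, -937478057857505961016680504993088523735932,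
   619006498908991840460350366267147379014220, 1667805835951224804600672565066752069186811,
   -691250674896128990895038845668761982872412, -2752207029244931969339711495176117381717600,
   560279831647402498005942404626220237708218, 4219307164595859730622139339611847320295991,
   -60712337149351371643395843148700058427455, -6010787317224241398667939900516385967783886,
   -979295566958048497394745923442299245882281, 7949622712278600220088193776934275167630849,
   2678221090697546090311685847244725079482714, -9739320081734171305600844872026334137729117,
   -5029910193373460741813891963445594044866729, 11010539940840520500747490750603532723722204,
   7849226741763106069413888126389579305946862, -11414380622428183218704244500659358385083615,
   -10767274208184781443027524609390087424223150, 10737290435359264998856775984490401312674317,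
   13295951479568854135581673189291401215991634, -8993460327565450106871956652855095521548428,
   -14952913276495249845697980034301386369787124, 6450209132328321301860967878839873003519097,
   15406155378598362066762506789997007564909893, -3565604329196835826189716546724783458568434,
   -14580801378253968349980648649351653693048223, 856273380347861301672099789513187241448079,
   12681823989404380166244472057830292986487944, 1253226181060380769230483468574826946259181,
   -10122386258472470024437427338662591132524189, -2539379750561109513824176546685281042336171,
   7389600703784001084091980851676080087174494, 3008339157478466805527653191683498235086187,
   -4904689488091598815579522694280065015484049, -2844448644105484082962704504951413915140934,
   2930122324236751233134952170800887256581829, 2313125056377151761780979471874905483803698,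
   -1547711546506190710705616657989664925882128, -1664710610090754831625203177033363497238847,
   697344596618663819609809422166941249931765, 1073840490513311218284500810087015342783686,
   -244520141936658255435723625803752397648739, -624243157545237347828269211035071332181460,
   43571107653800464232282039459427167263668, 327397824590385556659246043436347977242389,
   22963824376586208034976335188154167960916, -154591830147583588577667842906373571714329,
   -31445497105822055619070481755730200068466, 65360120698834506333190444405064392637254,
   22292415489821930379883633528728620864259, -24495129674428543600877854269302457289372,
   -12200647969751277883632246253767506888946, 7990446726074430512264286843807361077002,
   5608386469271840267643952665659675791061, -2187364640948624876601132040673701853118,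
   -2230645966967339753668790829480807342652, 458008818358715324665009236116325035693,
   776459305323524665392790310995807296833, -47820719210896650041904464002745163832,
   -237162632518865547383735698510394920386, -14523614493179195430208786046757245790,
   63354522427075180794335157686819881871, 11185522453846473624985155911606433619,
   -14664918923927053061827308304946895388, -4359760293764232104759889685700872332,
   2888357825334274448561903328508907433, 1278788148683637299535281952794730121,
   -466591253714270901680097709955606695, -306180929136848893538678677003929398,
   56400677954471963219185406414622387, 61417117081994238540489550582805063,
   -3387554993287242044839773623242365, -10387679544498674157040064794025615,
   -511191319085733625188301864549894, 1474555833674130672631838028008499,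
   212973407982930179201927036728898, -173050987783091444622258221416223,
   -42348143203261042691370578175426, 16264766372369630556954906413945,
   6071315595187342403314651365893, -1136984036856393801841092971205,
   -678606268047666999811777194986, 45392672688205828495663977200, 60287129631621943143930032876,
   1242063230056398732443107099, -4239782893397343471830081587, -399701341227557328988365490,
   230848407323050510310335986, 38788256326662777892880564, -9251260594779692931616806,
   -2435482259082125490005241, 238930138375386060946776, 108615751415536005122612,
   -1797869884817012451941, -3457358710253979403369, -141454587652403460998, 75581766239273557381,
   6779106658294338014, -1030060375912081015, -150245424521373215, 6581598990290371,
   1816682532680266, 12541325790983, -11099886429642, -366744871908, 30167113290, 1501459680,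
   -22763595, -1819615, -16189]

def Zc821 : List ℤ :=
  [-1, 0, 170, 34, -13964, -6175, 734117, 549483, -27497965, -31914674, 768384366, 1359714291,
   -16060845663, -45269902483, 233245655785, 1224982397187, -1400950092649, -27655716920461,
   -41412334363237, 530400881180246, 1807665188164781, -8747709145433159, -43294092361655869,
   124986240918734432, 795499770703347251, -1550804181943152501, -12209939474341402071,
   16639529130551556720, 162419979248194466394, -151928317812542157178, -1910669748517819923166,
   1128931495612746562308, 20129740617447997352183, -5873983809757296775213,
   -191556822021108749512802, 3238996437700674627857, 1656329341474273971098228,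
   410920366476176133587773, -13066917993582084993376103, -6723488210652409646035451,
   94301586959295760477850923, 74821251771740974021524605, -623329526457477341839011271,
   -684140710597768063548835230, 3772495980881592205082221577, 5449308127450883303854594348,
   -20856066314579664563165487488, -38822980778974090415969027669, 104753204925109073238764723247,
   250997063886458390104554158500, -472813638437313557385749735667,
   -1485698228277981809051067605875, 1875205796460067652506810252333,
   8098421074144434459344796290727, -6198115694503318843778077326005,
   -40812131193832912307183861475370, 14345193519195761384594187000682,
   190655647316737664457843862010773, 1365394108620199005495796973618,
   -826996137789662044156314319604726, -273501427696149932014252586396670,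
   3333472239205984471545901098701644, 2117761688385737923595568211391370,
   -12485315096261737798119508801667581, -11682048392366662111215597508854556,
   43405778966118689070858614163145516, 54151106863903054582529036907678596,
   -139735472922294211708386038003420741, -222297789295914604514933310392624726,
   414758737907688557290889654649389745, 827391636886153356980404380086404812,
   -1126470546147653916289875053797685705, -2827216291090430763170570417335947715,
   2761284667466713084987125627607318170, 8934047588565322869509446761717884155,
   -5943793224430742027135013154134088865, -26225056002822902625729224493177190881,
   10516472342150106551828659353740234194, 71703512764962505971707971318861657094,
   -11988617421507684925603919069421801288, -182880676952711153834593906658935040639,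
   -8735601761560894913174765353894022945, 435337560111757588829485882241616628149,
   110162016072245851785012366310326991378, -966844704025628921013397354443310465684,
   -441843444581576044815493662744535326239, 2000717340887789107481206048104158126774,
   1337556236247549014949597817268007159889, -3847877278523918231587439571324674120802,
   -3459015018518605445638862045064579226482, 6849085192741233697303578211015664198937,
   7976892632040763135434818085417536502084, -11204733201986497532876830426231404507200,
   -16731226087801609959562086897654118038678, 16647623830404138923447147025328907706863,
   32252275226062575370125053814522652628864, -21967223194182630584578900469187364010712,
   -57474175879998504149867499861253446899665, 24503617297613570515708883337974836025430,
   94989417061647049166591541619662295969780, -19871816542242417225430687703096297391920,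
   -145826918491966324387012950011674488422595, 2275622063497958684751775412481668692583,
   208001640274415467556662625019717546997722, 34287959741244959017289209339992183755081,
   -275397545926753327096650129266355630616103, -93932152612625050596635867436242819613030,
   337725204466988357617333046284514005218259, 176392866358208163130379249665809614875641,
   -382130701646301497683096556609089908387994, -275141948886160552357191020274726895921598,
   396437819488350444306370440922795857388417, 377238725520882753372063033704163551523778,
   -373156063474558682843647015455216545607775, -465602859028568740888679291444393484298102,
   312715648835043779079094407926478631156386, 523388828639270297782453726890544016082856,
   -224372919164966708346781344205338620518177, -539033400799722369138646287103259118915371,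
   124053885922452833027033639252255001941224, 509972034345093209882553653423318436862111,
   -29754622627068482871509762913281013262893, -443414720675317555309106819343044189440968,
   -43712832901751645628179191085815934510467, 353828696113561682564184493543838686069613,
   88530501702880346171173933034241685009805, -258243583167532962946664651677517616393690,
   -104885143471046860024716797759376038139557, 171369503513078398134260852123577033399799,
   99182819753308177178800070198588251564326, -102361083050022794942513702173134756534539,
   -80666136213034395931728740982545549241708, 54060371307872920642538496865302514814660,
   58060497152016342255045819818994450904483, -24355080787331684105466034452417602879263,
   -37456394121884474574169422356146319635606, 8539432040340952453270243350506018845523,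
   21776008889124363649837787675008045706738, -1521839175781031656326377706342955778260,
   -11421760268795499564566856484930009786701, -801502915529550804095723123559419408338,
   5393510387092521825304867881302576531759, 1097692807079405863726554815456522507932,
   -2280452738852175778006556758852937231256, -778169895843112553698996370290917823439,
   854687261827871189877065283863867756420, 425881330670182834755460538335365328808,
   -278813729620819853699381225929515114912, -195763539815622818874454652601739126177,
   76326653219351033554575813622473580078, 77859899857569061082277996825849001034,
   -15982169300881390892164532504675245163, -27101457976356639476962050683295562049,
   1668642365600362997016140690628402544, 8277751913078310418628259933144615440,
   506874718728030558535909134250778006, -2211247005933924230890931026936043689,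
   -390360610105000807562972454035147703, 511839694289978619158307438902819856,
   152150405417794970208715814694582894, -100809396253095667573702959552371829,
   -44628426331744579736247083371124573, 16284835791874451379460327486230669,
   10685470696650749652041455721154072, -1968472248904121228590768598021567,
   -2143419776819351655020384577278957, 118232030277422985081172921852223,
   362525280091019939995353260806451, 17840646266359007936171957409770,
   -51461517224777720297291196379527, -7432886444510831367491935250016,
   6039441034322477291628647988811, 1477972780602443413695772887866,
   -567638037102066844777206477347, -211891885191160190332571972437,
   39680640372256746571541475535, 23683659204476460579193879550, -1584199287038359811895838426,
   -2104045027803382922256089814, -43348591045897862466562287, 147969980327886458883320823,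
   13949653879013326573330398, -8056688004278961114276202, -1353717371551904351557690,
   322871964083605414298346, 84998806305210610182583, -8338736292877363187258,
   -3790712023998735165246, 62746325335691445291, 120662558229058621421, 4936798619348959462,
   -2637820282417023681, -236592503958265256, 35949337952727063, 5243602545478301,
   -229699276120117, -63402668206880, -437695634675, 387388761284, 12799484234, -1052839632,
   -52401302, 794455, 63505, 565]

theorem no821 : Nat.Prime 821 → ¬ ∃ x y m : ℕ, 0 < x ∧ 0 < y ∧ 0 < m ∧ Nat.gcd x y = 1 ∧
    x ^ 2 + 3 ^ (2 * m) = 2 * y ^ 821 :=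
  main5 821 410 414 30
    [true, true, false, false, true, true, false, true, false, true]
    (-16189) (565) (2) (0) Yc821 Zc821
    [(31, 30, [])] (by norm_num) (by norm_num)
    (by decide +kernel) (by decide +kernel) (by decide +kernel)



def Yc941 : List ℤ :=
  [1, -234, -351, 4017, 47386, 1159900, -3682024, -132875413, 190534052, 8295091467, -6938079239,
   -369729763103, 174283780989, 12892548224951, -2371655746592, -368497431839550, -28256937322236,
   8881085903627041, 2974079770833186, -183882748056584204, -111648051135603094,
   3312329774496706236, 3012174364899665814, -52331179015031976008, -66015422069931208838,
   728058061409798004094, 1233332553231168194364, -8913548456501629125959,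
   -20149206563049187899036, 95288170451198227720618, 292446448708966934913351,
   -870355928094918240605423, -3811743818620052269843909, 6403942431805779640522811,
   44963109881452528288294693, -30430999946673705229220452, -482758908827259737594774449,
   -65155027851504730554638722, 4737798104883947721256499267, 3897884565341243951995862276,
   -42626880054290101926457529830, -61190410162050899515564398748, 352235698761685546104435873362,
   709097244809575259154748557415, -2674655727857076701141881734565,
   -6936387040595628807920035685304, 18645110144639468165555644019796,
   60021473772348409579850865048310, -118949541700715413833382721132815,
   -469821562603998316357307796580932, 689880584934100211697718470326961,
   3368923222422182132981549007964370, -3589643068864307703466344898931163,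
   -22305301068342761069051000269799966, 16295547563678798058216294025829567,
   137077738011249424331503450685046620, -60157727873086171979750787507919690,
   -784762175791978894801466406728399463, 137014341656772125500983614414609159,
   4195660421180105012580041656808704461, 307973143682081450322537883680401176,
   -20982439677380650492766604887280444475, -6588496002770709751654346860810407267,
   98238907200324900907015951745131530611, 54546423255348174606629443240443472199,
   -430670998850997345625843454906158415390, -346928361010531271929316485200859074310,
   1766663390766777841399396987308330440089, 1899297689239387003477497061289081789841,
   -6769816513900712915564179964964097560360, -9326285843831277020621577420073702975100,
   24157814506105219053014846352479713002227, 41893276229501718466754397155205446254867,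
   -79845927021996003300376469896166947340461, -174045218269163430579197984342662817023586,
   242150176841633974271383010141366264629547, 673229631873771851228681552249063316550928,
   -662219828701566323943217925489797368976074, -2435051320061893095029129123282281366392382,
   1574454071053924357949782561866263804181023, 8258652042669160873626781771689186874953270,
   -2949668020792004166834675973276400077979464, -26310696284355479535046853685919200210446813,
   2624017527637380373007364625363630619694167, 78813628987700809987055987930264917027838997,
   10824104278063298820302162124658873445524618, -222046528868071663112664057119893987686864057,
   -80736796938725813882972644594740067933031994, 588161709211843109532511285649616034310939025,
   345802468736986031688942609380802243849274322, -1463080009976782081586813876410780688841360964,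
   -1199481354103638953866462004024422647351140197,
   3410741372161170742572286091069783383078211706, 3652993671703270040876419399579863256677566444,
   -7425666090045253245852282434422022889666039824,
   -10085176534689822878186671684834937162976403870,
   15013693953662900925696133045169787403398311006,
   25642276660519845369131723790516405366219072617,
   -27926942410180628138302937847499353033873668920,
   -60573266669883557532460556163224612065276050551,
   46989717183061954094603064489857074339872744834,
   133630707576709818607995671779590201626759752017,
   -69088611242364823244810122632684375697488528086,
   -276165156382313415093684224704026076218104630664,
   81141525077592240507007902309205935313965318616,
   535556293122820187478136747852287942130209990581,
   -50077200500471713250662007964568052929338298074,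
   -975222948306774512806666331566140933824552678015,
   -90941937039382819552578718321332333738567133951,
   1667129958669042502755821689081833646340025681714,
   457245826628308959738415584770768712590607114137,
   -2672507674428146449356396394651645764008011068990,
   -1221789162822437055404584337627766028759793741305,
   4008802058930727204230774821232333007364143772300,
   2608594664291811231207997227067657421529284035589,
   -5606642810370709020359057380109875309940991537786,
   -4859628238112682185839642651385227217462518474101,
   7269214279362454430151201438726894345888594779155,
   8169225209775214268074998086069138509641867190462,
   -8654623865434388563027302612035084405587725696131,
   -12592469999533840606401973170799954525796286288664,
   9304179063051478630011923979238558207583057100231,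
   17951154731548588485120158177182751725000490416313,
   -8730454804042587277396502923166854438638578298435,
   -23775832855635953493940594846516824655001463652961,
   6557242289577709203164215268413087306595964524613,
   29324834108675465589847199977104358992978144344543,
   -2675000668206764850565080460310653669336427778729,
   -33703208301243855065621283814188510433897267818430,
   -2646317111622280816371696518347571821615632240748,
   36067746017199901964457831929340108281422053921521,
   8745155239899021517998823209533651605162811870994,
   -35861951151659455750656851529091938083376864797617,
   -14685843465964545679267941827868675973615735377309,
   32998474353560937609337830118022423268408604570460,
   19483962033513804513913981423577547703576524931244,
   -27914085994134304123925115865297901360879738342842,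
   -22368192274566817665781485841460420067126351892757,
   21466252775179969285716309184715754413229371150029,
   22984719741084326047675348083891634220563124664414,
   -14703067055282619977520893440413871375805004712589,
   -21469450919387031705600785539478676760532421859176,
   8589550740837310794387350970583567764794871911831,
   18367012745918356026962176734821721248777746813821,
   -3787488716293383864379708427604910092348471591094,
   -14437421264864354442438011457329865519661299413378,
   556835100658106153831892911870751779078337535242,
   10430980809565141548478899432164130348433363488368,
   1208719266535891929780805102901561888809300029971,
   -6912365522421428419000326331922446244866259869348,
   -1852103166064635677051893147280387264013286648744,
   4180924001327543391453235910571022943218485684603,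
   1795172385511257383882999150595683022604940210949,
   -2287700403071680700825955794706722676275324815201,
   -1411787604322499465665119213472767304980235462385,
   1114362271874043328840741185177720058224960615220,
   961443676315869129653761802426902162272070223154,
   -468033909639633664561283328322715073740249134893,
   -581410116581717577140046089008473668381873734925,
   156701050549365504599900754393539291897798455792,
   315523139098455165691575858681489411879074444689,
   -30425018842397902402587054142201913368864850782,
   -154166466950395423999723119209974014112891476322,
   -8377701837521345056307325019154359794407604188,
   67702355931997639232442074789574217394009484478,
   13397173039417250506365582909013663041763705597,
   -26542989012432293432438590920821208198385741456,
   -9261524853241862421362762181348915471277824837,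
   9161741882029876176716814937960949090326844140, 4845376051951431212900142712360034690154329844,
   -2706900005157024592004743904538879863702069105,
   -2118736949934786275326451329558393693389184778, 640648059482722800527811468564583163621971505,
   800033739672333825994159347900984222967544543, -95925441121197782590325723492928865283841257,
   -263716919407744824048767547969787899068277140, -7531848711055763503145355193506016825361911,
   75853397888577268287429959463552762845933467, 12537842444524743019454139931343514850332046,
   -18844400481457765325103739567186789427475717, -5840976090415869505796137579667029350191736,
   3944514485162330901396255335631819966233757, 1945397408306173190690621724332255991759555,
   -655605662135912583774913497701397075979678, -522388780760420284062431498420841451480101,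
   71027428148309768490869340158467399881294, 116923241949586546297670066546694398896994,
   1416143886060698994631147058579677418624, -21909391598406838018021169598068998721114,
   -3117953283169155694316166484954561411957, 3383812668272749324170202010342531857909,
   952408261949188189717874963855451028166, -411142354055083999323668762594593987395,
   -195712850216632850546974054275297216028, 34002228625973534091522100569021268076,
   30951591569764719607410333098966866673, -516209484579577549020568023405230989,
   -3866336848145866438089505857160470454, -419031722061110324123216045259109461,
   374485549882872625122850879594227766, 89442169529561940426196827620427235,
   -25946544024662510461040304343017312, -11413228924177875478678408389968191,
   893199114962876607651515717716875, 1039632242124641763323279458028640,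
   54291605292431483979775011681955, -68135127836319114810471756468337,
   -11556641733194142899981455811180, 2905268932283055007898848172586,
   1000632125236293292263156844725, -41523001010965901737234989958,
   -54079065246922072676401909548, -4177037418630878544407651882, 1785680490977588786129628899,
   355932647790435292042955582, -22621781876806996783035970, -13575408097685087900867558,
   -831611547444408748288234, 251420160138159609030432, 45253636396115797967056,
   -147365309646507640048, -786344730908298884303, -79089668241502970477, 1680209034777698545,
   978718553599789680, 81425979419365172, 1461618197760757, -220683918264041, -17592342984814,
   -420286505367, 9897453207, 884158760, 22941220, 267033, 1135]

def Zc941 : List ℤ :=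
  [-1, 0, 195, 39, -18416, -8136, 1116062, 833427, -48341232, -55851301, 1568544465, 2752049885,
   -38331061785, -106236921057, 661826646650, 3342054471438, -5322652180304, -87970359708223,
   -128333216789936, 1973310881665836, 7214598546563326, -38200925362069432, -206672720623539446,
   643356988353031418, 4498870983911813662, -9458922843608026202, -81685968040447621636,
   121137805737850600499, 1286582136927706919594, -1335718388410787189544,
   -17955165880464893120675, 12277524761350117722081, 224982344530887026366029,
   -85336279078156972658909, -2553920742406624675096973, 260746400643566394841202,
   26431709049787993730227519, 4294211210012526519266362, -250541281711280841530728077,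
   -106596509492198214452295970, 2181931502974687585553832002, 1520654494760795266325610244,
   -17492358101662155469122124468, -17277489538511716201789193163, 129180208542795858901990117309,
   169431547265390451378973976170, -878086139630842187371249015360,
   -1482556943505146143756510820550, 5478275794304608705335726769807,
   11778132464766032484149472526670, -31181287533442350716406496428099,
   -85843312892028459628975076525828, 159999351479066716323325133621437,
   577894222505089585980704887218470, -722184959762960808707295713475825,
   -3610173871109613972283278465868052, 2702491164951850252202062832121670,
   20997767447413160348834420142008389, -6812657978011023235285580393958283,
   -113967623585052716782582136271882189, -5420917096102161291629061880568942,
   578109961250095990052976170669870721, 223138239646622609106919248591183973,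
   -2742926690292920418718526132145181059, -1936381787729678794412797651771904079,
   12174262297673888808050004240502098452, 12435495476472083381996892245795056304,
   -50512593589388681983505667894712121255, -68054487387918498819929466125343782803,
   195589633204685116190466176183294441578, 332810518738483442123817093980208795252,
   -704544070875693696048236774924882318451, -1486624980799798789427330652681623595957,
   2348056406014910235102000884699280729351, 6138271376840418469749715742189759633382,
   -7171172877576263311718952227760861526189, -23595717395627852769240042269526774711270,
   19715601494615700565695094166493815794652, 84825687908335224069593760595957988315426,
   -46984259685164122683555064469870881566831, -286020105067766222630715340328947289403670,
   87534052689081643038379773450327728089978, 906224267014446061852315158768087788683865,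
   -72657382307878789654229787697673397407425, -2700737574808798948864073344300699410414253,
   -358286140159857272943508865842681928502718, 7573028982088356637880881632726367105015593,
   2575479034172525498178400922338064432868634, -19972559900532276768550518828336087506040889,
   -10974880855588226482278927545387084770685474, 49485770158050312820827612924805469899643604,
   38065166405334288556234510752020100986737017, -114946644668197753189768576218078158796099500,
   -116090839532104518189119863846551753145036444, 249444980747847448304001554784879904503903134,
   321123265203331855283601636986881052651948820, -502891925099720882559233967091800386479626266,
   -818176535541570667861432935044306447590692979, 933082957562369564900344130658500308573412866,
   1936715647679549715362434018390863610697735817,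
   -1566731999128392016247778219967397389168248944,
   -4280995499935490675144673599246108122284225569,
   2300135639114496501093873803741727328370849170, 8863492200667129946237616885382195845728490004,
   -2700869482862731149212693307066016876670253948,
   -17217737609383572648032951352514118252594066171,
   1679327770127345573802356389864279708129411714,
   31401169865074890462908065502129014525984949745,
   2961473782658697265934424083598078982352665503,
   -53755072954563627795943453058808756364794941948,
   -15005110230443349683199901977783253670377748167,
   86281311516333392658672018379613377035844117732,
   40115559570924569124263901719861075246386936779,
   -129569597877067870428512065713839785670842110960,
   -85616145083716891502384219717503516133135776019,
   181396322662191407719195360874381314854997234520,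
   159400099636105123506085115574440223788493223255,
   -235396327686373750503705015489456230700790413831,
   -267783960699819782229911049838113250685234833558,
   280478040396275363846486082998945916305568744857,
   412516570819759494779568142496550960528056337192,
   -301730478804689849068866642565728631626232440279,
   -587717439052317495512365564015768855657936277287,
   283279055803734469457877971579714024532550090911,
   778001130813947638683083086975126320989467480753,
   -212838245885196090126418883992640777163960514865,
   -959117112147720357864255131117185752660898436071,
   86780056000199127588990349130886278348894458649,
   1101847495999358848397871080231626716289450717078,
   86175407777379265181215381202984667182744353286,
   -1178703681580899332174854066028937385572493508521,
   -284544546570023671197649996317646505801180116568,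
   1171586962904681707137610348233952176371614186871,
   477888721104824797858245714482965839619762643271,
   -1077723447227553929558656687617331490629543533064,
   -634146182151813715381742356279436902137063630420,
   911435543370346622990936076102643344701906520284,
   728164972991903499561322807291983998022305161273,
   -700749187149412854847379108392898494415685188233,
   -748374525020666344968826924238415725955227877586,
   479878952796138411221140713199566646598332559137,
   699154985991928764535277225794671722035902300174,
   -280301175286984258256348797494659068889018312967,
   -598212305519320721568712309958421479407071862537,
   123581488151453791036570495332176796662355044020,
   470286703193024787601432792274295677881935058028,
   -18170938492140111560098607598571182347360942312,
   -339818566495991586190829654258918638271256432370,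
   -39423768056211437961920428526148365987318232695,
   225211681311726952878779726196039403288961765798,
   60406133954777612475526957839498440037588665554,
   -136230033301951728059610927063072401127376074009,
   -58545531631085615429440782501410822501454374971,
   74547127396851795061662128774035088336734403163,
   46039464920085759892134198991265790113986368211,
   -36314892374093429410389204649194039497898428472,
   -31351704259180629559584950265740317915114114106,
   15253103389021980137340350588612232748231012373,
   18958303076447578772539092657906028489143044051,
   -5107066888060812902328298220070879629092220784,
   -10287991112510749796527519083352952097976453517,
   991617228771470000191680891410416453280538254, 5026600480589491540540717842293070730021888704,
   273064347547706065808207238865690224478072498, -2207372266288104297422833650099821176698584786,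
   -436675834746171832616909969187166161177951135, 865388160436130467324296379962273251012632746,
   301882211951642540648051117834168522840174435, -298696549551132561003028210214336505993684642,
   -157939412482834538460535873792760602570662434, 88250444177865178030942642722861676495386355,
   69063232000970877068301539748730138136933040, -20886137628974142587877343262017429602826197,
   -26078578807396592428615635944453520145847439, 3127290630915550084827288851205314388460143,
   8596436081058702347033988195710066966237828, 245539321656661756738871091285005930870549,
   -2472632125205260698059725962739880076566249, -408738435319776951024810022107399896268478,
   614285297315324709276777546242322318071249, 190416957461997798501650259025154776381516,
   -128583150545762230089635034610628200229577, -63419991192635559806470194181220798323411,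
   21371515019624125922291189494180352248006, 17029804705149684380367315610742535513795,
   -2315367111260155409018815107905075167054, -3811667291332096874365811793024012865520,
   -46165753053894978892344102605297106872, 714238181097245356962958342255039440730,
   101641052222676066550163712016812063053, -110310775257083959366927735159242341137,
   -31047254100328868980043559403291971820, 13403030332265705853182659642954483437,
   6379991139052680365352002953334600774, -1108454223557117598730425032493986392,
   -1008984159669099754330268635797728149, 16828396917472633741819234903163005,
   126038020420708500021619281701310308, 13660104195301172166070325945645115,
   -12207798404572808807255953128791014, -2915745366268258693810951619201951,
   845827935556987048380066971634304, 372062260380339358204598668334471,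
   -29117247321346302640028700889309, -33891176184372891686205837938012,
   -1769855725096445692199922747299, 2221149747770967544394352891683,
   376734944951253224333098105626, -94709404276883756935461749376, -32619601701865665121755578753,
   1353619670403393437814852784, 1762923236532430781213665084, 136167566969900185354851010,
   -58211383915610138531388189, -11603086603924014788650586, 737446172684117333131124,
   442546293792326975898480, 27109775849427876454980, -8196078597140122228884,
   -1475225325728142519686, 4804165266060098352, 25634072333774701599, 2578249477519508375,
   -54772831032537863, -31905346071104648, -2654412385182680, -47647027022837, 7194071153013,
   573493427372, 13701073419, -322655051, -28822530, -747866, -8705, -37]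

theorem no941 : Nat.Prime 941 → ¬ ∃ x y m : ℕ, 0 < x ∧ 0 < y ∧ 0 < m ∧ Nat.gcd x y = 1 ∧
    x ^ 2 + 3 ^ (2 * m) = 2 * y ^ 941 :=
  main5 941 470 474 6
    [true, true, true, false, true, false, true, true, false, true]
    (1135) (-37) (2) (0) Yc941 Zc941
    [(7, 6, [])] (by norm_num) (by norm_num)
    (by decide +kernel) (by decide +kernel) (by decide +kernel)



def gc971 : List ℤ :=
  [3, -723, -840, 119800, 111100, -12474468, -9287328, 931561267, 551196861, -53662542657,
   -24596722340, 2496949934193, 845602492943, -96868487383828, -22185889570632, 3206283288593262,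
   407800326217578, -92143737608184700, -2906333446783432, 2330908883702740104,
   -137645939145878376, -52475764131426852888, 7632913573196282118, 1060915447923729734337,
   -242254777652110107535, -19406673626145701054688, 5982457272100887591205,
   323237370201257125224171, -124667660936020437555213, -4928807405664033826797277,
   2272138187266896333153466, 69125417470563935797105955, -36950398967298423203007438,
   -895303518237119614147011639, 543141415520732593888536141, 10746842160178515541208541929,
   -7282457211575118629008728511, -119929707515705622784347895641, 89680129864725219837457025419,
   1247696657533176368633497521655, -1019799743826280652323323060089,
   -12130945084272297172028799524088, 10755794706664057201034885811044,
   110467556108835650524563386000778, -105601273694918290680185131934219,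
   -944015454958771510409505702620599, 968153862635950692670975391083768,
   7583821453428491979006446885500164, -8310555069495718350929238343468777,
   -57364412278101631749363780848054523, 66948006993318237623007721366979826,
   409120963903457644617600487792514675, -507172595941621990619012509463573011,
   -2754609065118030102153176458462550207, 3619681839713660067943162942662902488,
   17528789033244828734331122577755696408, -24377023254581958810555685589794862772,
   -105525333116756064518785018526715079560, 155135516937799966505326759459098162891,
   601521687364424147405482647192894464560, -934161607903339098855821585008996376541,
   -3249094497862578909078954046599184504854, 5328636764267792902474023516410645362847,
   16640552794727937586976353256279481518042, -28823473551926795373671734134110817341103,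
   -80853094824142830689617648774471333037068, 147985917109015821777816328335746943666146,
   372845105036274858328229792423499215524492, -721781166333099843482830959417954075902960,
   -1632263955223147006046678625652780431563613, 3346818542291219105859168585085845115561908,
   6785054679503311648664150044626780056221348, -14763758060819027797679000884571758062220286,
   -26780903697758096835559595827514838023455742, 61996247863727474105488365621060219328363076,
   100355473367404780023994200117686606213155644, -247955864469770187181077699434704835984212623,
   -356901566821980046485989706789426369178939572, 945003999366392860061115298665638011786467394,
   1203887484566992257944615311595084994040008198,
   -3433425146378509694174334607581138433858668581,
   -3848134454189267500200604266653798884336184776,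
   11896425300763710924205280196824960759064141413,
   11639824579931274811786706007581502138107195219,
   -39322178689860024845384795125041848944778737334,
   -33251213550109114806951391347220535346515241167,
   124024033642718592852360226433068964373268705670,
   89446014578177556430500673426755878795152005072,
   -373348738084499758423803499306563898843748517347,
   -225576327165890081214286579328871943135781412130,
   1072843094185398156295635005305522105286302776746,
   529667546660291006720432664930068300620441990035,
   -2943211600740926550911694546695440500564366952858,
   -1144623150121648888696279404797421436101040772257,
   7709043082903217121218480946301607416940913816444,
   2228217147619173562990588166627860626511085810099,
   -19278876180290499476680323170990690210604236464915,
   -3728762894438548920417521280485200264514854580421,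
   46031144392359994629476152437210871954844476614336,
   4665390911766307602216543837711044980905078727112,
   -104923876861664275106042986173043405855484553627911,
   -1281805102741994868060251941753211822571535768704,
   228291060916503260021568029919728196405788865772464,
   -17039026241109130618815188730798665753855636435787,
   -474033582276497928106620288085243160303866676869876,
   75778337488969665196736526891632246262526519221011,
   939118240567794461373974338073691567843601310411914,
   -229263474197607976159166623014421908517354201010371,
   -1774501395799979720489299336914109446624863059177090,
   582340022296016255569845108494298506770845625452743,
   3196654590663595388880475904062479965950518990105769,
   -1319591426441107157236066796198895034038819195327554,
   -5487261915129862856717980026750944697642637312627115,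
   2737892221134278308428977036881493323190967448667981,
   8969847718823253706379075927633408839080864761021886,
   -5271773193140706542811834018842261060607824538479959,
   -13952562043090733412056997075456990343389199306177182,
   9494010295070475300281528451942695267517355417447052,
   20632873384546293361633489416251652719248665380612484,
   -16069508946491060946859969039995142101665882407349367,
   -28973899204041318456515909204011463987043266168373305,
   25643910372096617765968580762455873148051012848921646,
   38581450537727205115894628967483059526029787493480546,
   -38663730315730892298153622627169303004882546595408347,
   -48628653638223062835558456813970076780124041589240949,
   55152517511899940530866689776962955659972838755722978,
   57880603508606006193163268859717415554748865199888709,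
   -74500551757457949405411756687389839241624893151884992,
   -64855036229599183739786511565751207306397864156366829,
   95349610868409140362563093110602601975629246162580007,
   68114070214126410822756271646752902002991904564115323,
   -115652230441979175239334576985836383365246450951542244,
   -66627003226761014536828898010563177655834989570164432,
   132946010380669636455326571814143110494392744692501000,
   60097443730440878406541845290927137911614123852264650,
   -144813032403765093213144493496821090019296157080898797,
   -49135539274148468050729420436362410359901452422474501,
   149416385588461277644823025721879500959416746880519262,
   35192809895795544683284215373758652613982477388407032,
   -145955353615203549746052293544152960854161545125672627,
   -20255720090587958489421259755755317337131443403989357,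
   134887339995933647311804084382739382989497477846523527,
   6384060295068659587538480476452086290816278537355795,
   -117833913524702695738107331919243620850445326403018538,
   4759078691822777814588743744243151496204088305991943,
   97195710164561616724856645157551210981271328837123030,
   -12236823014559390612707531538117180199945810816149991,
   -75600941452761672419129146560165973179930402886041589,
   15936552293578280120014689493246814844471359124302159,
   55361592172149002637377240959972024113329642942520421,
   -16435703764946702791597647997618730405187975122011813,
   -38091263000250843661382618541377588573030790202930499,
   14715239183166423529919470417929185566103665820808337,
   24563591137004420278184726867377556564297023885714496,
   -11838362955487075205940158264471185274888520643098091,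
   -14798316079115786180881202360904315958685940039253089,
   8697947740914393614206056438306413343767987056487920,
   8293346628531574447500576826351526158345901953881557,
   -5886577340226328699247735104778579219604406917167182,
   -4297907540234599808398435189233824052562057802974633,
   3686998332271032944403737003673805538371218006940370,
   2041535575172926389890823369920987693009148957877682,
   -2142552079355705559589317813031920324524999750213557,
   -876252330020482213706015184585821821476366978038367,
   1156407261461645468222506781675189878006768072031808,
   331080812565599375725826603061614993454306050410587,
   -579761583642276041348811899340506300784156290938408,
   -103904082703629550284743799330334898789531950318992,
   269798652253021980952330056133730626762764687675454,
   22409084579214778452007064229000204175614084510745,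
   -116375920980964860090112012408415034512072264631136,
   679299437323489331894154926902865204892736832812,
   46428279531580865039121686829607736978980073888624,
   -4208612836087984027572375838932319180042767146846,
   -17080222378716084221243249609653945675480506868601,
   2980891418389754656776222190445534161225192001310,
   5770535821952347935513834575128197364344007315770,
   -1506666174243793394715942925911143790241775238698,
   -1780290455109317433605709459973580457027331679395,
   632485037520395107858808286159032017431326828487,
   497489587339985069537393251813233224218881221664,
   -231200748660907832848763963587512582163327642007,
   -124357328496029977623542686064445055110076959792,
   75044995866745776200441985806176730722826362276,
   27222485898195282432552702841589141967902124722,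
   -21816843019272140758340928886725944286300816678,
   -5001548299541044281333369204258552587507020553,
   5698479555188225544203008140734892354574827900, 688660060497224110002712031022512427609632223,
   -1336880505107101759066936025144366461866036798, -37017347801829762732735097709458553471254116,
   280855722866451386044516741010569131800715720, -16036445876744079132610859201608198724239890,
   -52530718334578881766961702279100892895004663, 7324599731684206350353103704170068868286502,
   8665207438511240105813149308794456028836141, -1958970283584876021609489435604646640266039,
   -1241343277108193109290241827753912359660589, 406524553111034615985489968522695667470566,
   150278482369325629990481210904630280125102, -69951507157825387850838879875268255598353,
   -14511479305314807955066710538488183769620, 10198402523173489341127363244418695197397,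
   937484200608617248808740859863052830295, -1265371628843623668972140862190349337040,
   268740406144398966566679470797980380, 132824866093472033187201829832165415706,
   -10918299748811129158152473746912333341, -11604155312033411570154676676633542071,
   1919499026971689222273716959290167818, 815972046486981020457811105705796850,
   -218033844396773727971857034434934757, -42764902036406756742386123989455623,
   18643921684964461456167451126885866, 1271346620338657519688473535957117,
   -1236584806763220488252939265815324, 27952528760484350587059698772403,
   62826078108306364467314711042856, -6418028806104175426260994735447,
   -2314569888742168705555822563210, 451213004477082984799251134823,
   52044888291343547862159333102, -19801388783053507310274984140, -79713914410570419187117131,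
   572103405054966327973815251, -42570114764211027525767253, -9863845153228155736692332,
   1625001598850792779729247, 54600706688829110754379, -29627231131412541146784,
   1426773471804397256541, 242643508831876560944, -30969727051518749733, 104783849377758325,
   202285626918115606, -13406363339909284, -50432878376730, 47569932225250, -2632809038305,
   67000885370, -808311189, 3532677]

def fc971 : List ℤ :=
  [-1, 1, 280, -320, -38356, 48828, 3430754, -4781229, -225577869, 339964959, 11636415512,
   -18795417171, -490750725331, 843879393936, 17409309769894, -31709175412412, -530422054697758,
   1019369836325844, 14101752084824406, -28511373365566378, -331249652355113898,
   703050047702144250, 6944369956785698784, -15447777138527691575, -131004492269994708223,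
   305115453865933184892, 2239222983007791062123, -5457094806425612744969,
   -34880161525318225695351, 88930556914865889164523, 497582412001382846401378,
   -1327513221629111304632479, -6528053708501750761355214, 18235541268284758723487637,
   79050264128940314292136297, -231434458621865692043836645, -886282657079172937732794087,
   2723278322125838758830423539, 9224575368486117416566719421, -29802816434448050564241381925,
   -89332378951549916090891274357, 304171879923645985077527525136, 806460534671140223205123326714,
   -2902303148041338613972787772328, -6797335652053010748516830660311,
   25946681026721296920549562108415, 53553864541046705270374248679896,
   -217766899577859257212821457149590, -394721281991593294995684915954119,
   1718869259906194711812988516257129, 2722726681614816702914014364296862,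
   -12779938583401928493034677953976179, -17574157482093564830834557768850125,
   89634674388875704505970826805167069, 106061286075507706122314627505234602,
   -593813985589497124898745919674089354, -597455531870742405805388641377671312,
   3720170229097290675619976641063626414, 3131661860096396141606899224615346149,
   -22063491076369367976143725414881830918, -15192971609964116316677555753634654801,
   123993788278636315852766292060623275444, 67583226756723359918192380688775127451,
   -660865168522648212894648329165374852802, -270863951475271573581229878371628830437,
   3343078463103239636402026602353454643178, 942319322000900636784172529914566005972,
   -16061921861480618422049605769593007499232, -2570405593701279193271631525291904413270,
   73337636498629371799090698579685087743695, 3181010770712864431218171475138418159304,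
   -318392004781640171069721133454090930953476, 21969359194621402846255112410570843051322,
   1314915032135305873340166731997411915975806, -234003335500611230096179342463968878906384,
   -5167678345363679719228333557924771718509084, 1469428350636337070440729310509432221745163,
   19332360340709917494058218007130611578489704, -7520596720538014879244793354970079123591382,
   -68859211894005772070900005111490258296382094, 33936160205729950347091591006993701301762215,
   233554644713555100652994073014843227440878370, -139369825909768156336582865358530371401889961,
   -754377969135698044299249903394155689540999889, 529370988586463370206836191506756670088764206,
   2320321472773515586528397103786632874421144581,
   -1877092364207948063395741832162363869086659654,
   -6795256400287101773773707161066104137801764952,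
   6250382400364800295494416645750573986982733655,
   18943075119235857444475338533077799930960873992,
   -19622133606757106657625250739260824913091763388,
   -50246948412284795154861279867549971083025463283,
   58239297131545545602624544168173831006182015364,
   126746821203223547280415609379661766459614691989,
   -163755130915583533587229241719889767308924525786,
   -303803765391548467354444977942213663482915678237,
   436850574120007170027324277000062703009288753475,
   691221774182797776518593673541691912230765352465,
   -1106920703986238580756955935018701755617874872600,
   -1490686085218773137725894439685202767551686487424,
   2666303205336741451687022812079139845022342147525,
   3041214552310540623074695311572405037538798931366,
   -6109146644549242682588060841499286281897009273934,
   -5853451049919823025843753358564021400835813995079,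
   13320525035627258811105610574218823541822458433136,
   10587038700892120457499727185863624394265362968501,
   -27647733476607489587593961244461729824879207520958,
   -17888523919043010047919662119932449063674053121703,
   54634521879487703042766177342176001075455069066656,
   27972319487760863324387900970244002706809720641543,
   -102793639093911739031495918728877709673620249339209,
   -39821827548908982470575490927356009694550238164378,
   184133279226884032969213158422317356848832592319459,
   49953350132319343730838934080684110480737108707715,
   -313975427837221136472502935667838612028271339203332,
   -50861379481423741350177503709044631433898544945913,
   509496761187832505582187661948601944071694607186342,
   29555004247730410879059867712554953371291884749832,
   -786515729035268630955613119128655217118135259817214,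
   33068662047679276100342563992614710415079891982565,
   1154463880221366924595327391856756747342665440952223,
   -161052902946861788344249964161821975916619640931744,
   -1610236651303647636480719307427027727444845401575072,
   379584000538889221855694610684660138351017213154577,
   2132546261236635532654449504950222673504714257935693,
   -708402574869050956877867186392254254907222712142402,
   -2679104420398942744159773923335890220605174570427643,
   1153424059335008762517901371927366075603377138172372,
   3188942824132551652551806207662917947227473452421863,
   -1698889780532503968290345918722420974537978262334117,
   -3591077120049134997250330975603194792233458802078103,
   2303212375717188752160113677878718542827671366104936,
   3818619471988546649506873663489609437346030143924010,
   -2901379069353228762523974836846677540423114471112680,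
   -3825020952366656621877927913093669121365383899995308,
   3415041118032038808718359311768103046043459936084981,
   3597470027556543198294548187919277641431271533012521,
   -3768650666809195645157353457988619896955311464034936,
   -3162592418748380248270636991306412358174623246708990,
   3907296457042096876168024868485405003384134380408255,
   2581803031852038873331681300579846452680489574369333,
   -3810562534886688314848837800597826712799430410283203,
   -1937241846014119676186361273916583273186114501045299,
   3497640898791745423100543770326985356794720372681798,
   1312674665061136936981118669353318268678703672724741,
   -3021889115289254795761636684639723156677574016063900,
   -775486759377203230586384919378123558441271832169699,
   2456805649023720270486793954281632752882361578285325,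
   365155158481575262300947427454458598018825685176047,
   -1878315890839950695035564313743369978192589113058645,
   -90782212634027734070987266350876113984574051041781,
   1349073868981141859133251123050893018264537899411749,
   -63202665957066727704365642588022884399380264371983,
   -909016247048900291565231559798295982403548425178514,
   126648761678740605490124883504956717240045086893135,
   573567603200373274416043508452492141131565814811047,
   -132832712171556197534409165999792380932950159022978,
   -338097855252473235948090984207950721494076263588087,
   110393617357026993163980558466820206015897224146578,
   185604523621822683446420768763286173158392804485445,
   -79396817986658867611771941447916048862009339929926,
   -94492645318716916458922590236390794352316103468770,
   51082951761726431894490409235043954256484989012361,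
   44352487198695561862111790355141915394646881785845,
   -29858896126686798129957691326589599178386877850188,
   -19026898392834135796220511617029916851024647014549,
   15981651079243128363524514228536231373212916762858,
   7356527457104630968429669340751647833941342778338,
   -7864284324539848282062246346286560743958622404542,
   -2499339550742450868579116849551173078781633230423,
   3563908273083926753378505798580015829956025736924,
   705814629272865321542323640152777518085868817914,
   -1487587866789816203383026441252668529961371374790,
   -138979052197980318717752897343982929002718551306,
   571277079683382998824730666134758073614807087741,
   -859675700066039361334175975822114483657892830,
   -201387813263840907160173416293299823202052155278,
   18363873078650305149741458635196445429617835096,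
   64937611729477187291090159715105117461315141657,
   -11680142550169165711298106028344783163244050367,
   -19053116733804817451550372219591055924130542962,
   5191471519864234921702367898489468995672607031, 5047709238813397239667313810084249446612343528,
   -1897847683020205006326009040311795906328354684,
   -1193179380426661783799840872009739844484965644, 599352491072143800585140784337225103218182638,
   246631619915162786376279323449424710704554717, -166743054156314088574289059010440487746328998,
   -42847729609251787190333633611457957766645451, 41190566873775118641812265943785958947753714,
   5651403467751411694913072205105630354106688, -9052025166062669896593849924034000774784572,
   -339306919354297086362084146224081836951302, 1765688842751707817269093029626961562711813,
   -90888965123002142261923026448848455383228, -303854282981054826015332372427150878718289,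
   41664388800117253060532920190296727230345, 45630968347374964727944502791348582621827,
   -10390284840692649916334692179204337822684, -5867594733365238495734439040327671835282,
   1973903568558771203578086548064477854431, 623088545647268491430278645838574538122,
   -307265231663713563995249380483584895393, -50120204335306667430704660234303595689,
   40066608721612797575611773116484859986, 2142068863839918929427539590406570684,
   -4388033524956597675505579383486894922, 158269166234641122065362136315694321,
   399523235634718457168782489552246583, -47731256320943030926947714288696390,
   -29476785827771119703509987571463682, 6239534856588391659865211639104115,
   1663970213658425199777657443448447, -572944912635326161114000426607960,
   -60623629582952359079372015016337, 39869419636347637269688331170334,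
   131839494519624354426240950531, -2109023732934992917370447602280,
   167134448795708771702932996819, 81269929629857064693750834596, -13566186854325887776886059165,
   -1986433043805933604746039318, 631805412393105497057744382, 11887763667104266414379085,
   -18999966858795295810764555, 1201480763975522193093725, 342340817942756791695716,
   -51151157517235442585307, -2232825052032278972967, 972641295910762258426,
   -41769653065331189545, -8283738229025397320, 994708884608256413, -63205503459963,
   -6706470307182284, 429225284252902, 2392460326646, -1569107598862, 85569192785, -2163144876,
   25996625, -113369]

theorem no971 : Nat.Prime 971 → ¬ ∃ x y m : ℕ, 0 < x ∧ 0 < y ∧ 0 < m ∧ Nat.gcd x y = 1 ∧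
    x ^ 2 + 3 ^ (2 * m) = 2 * y ^ 971 :=
  main11 971 485 489 1 37 18 0
    [true, true, true, true, false, false, true, false, true, true]
    (-113369) (3532677) (2) (0) gc971 fc971 (by norm_num) (by norm_num)
    (by decide +kernel) (by decide +kernel)


theorem no_solution_small_primes (p : ℕ) (hp : Nat.Prime p)
    (hcase : (5 < p ∧ p < 1000 ∧ p % 24 = 5) ∨ p = 131 ∨ p = 251 ∨ p = 491 ∨ p = 971) :
    ¬ ∃ x y m : ℕ, 0 < x ∧ 0 < y ∧ 0 < m ∧ Nat.gcd x y = 1 ∧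
      x ^ 2 + 3 ^ (2 * m) = 2 * y ^ p := by
  rcases hcase with ⟨h1, h2, h3⟩ | h | h | h | h
  · obtain ⟨j, rfl⟩ : ∃ j, p = 24 * j + 5 := ⟨p / 24, by omega⟩
    have hj1 : 1 ≤ j := by omega
    have hj2 : j ≤ 41 := by omega
    clear h1 h2 h3
    interval_cases j
    · exact no29 hp
    · exact no53 hp
    · exact absurd hp (by norm_num)
    · exact no101 hp
    · exact absurd hp (by norm_num)
    · exact no149 hp
    · exact no173 hp
    · exact no197 hp
    · exact absurd hp (by norm_num)
    · exact absurd hp (by norm_num)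
    · exact no269 hp
    · exact no293 hp
    · exact no317 hp
    · exact absurd hp (by norm_num)
    · exact absurd hp (by norm_num)
    · exact no389 hp
    · exact absurd hp (by norm_num)
    · exact absurd hp (by norm_num)
    · exact no461 hp
    · exact absurd hp (by norm_num)
    · exact no509 hp
    · exact absurd hp (by norm_num)
    · exact no557 hp
    · exact absurd hp (by norm_num)
    · exact absurd hp (by norm_num)
    · exact absurd hp (by norm_num)
    · exact no653 hp
    · exact no677 hp
    · exact no701 hp
    · exact absurd hp (by norm_num)
    · exact absurd hp (by norm_num)
    · exact no773 hp
    · exact no797 hp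
    · exact no821 hp
    · exact absurd hp (by norm_num)
    · exact absurd hp (by norm_num)
    · exact absurd hp (by norm_num)
    · exact absurd hp (by norm_num)
    · exact no941 hp
    · exact absurd hp (by norm_num)
    · exact absurd hp (by norm_num)
  · subst h; exact no131 hp
  · subst h; exact no251 hp
  · subst h; exact no491 hp
  · subst h; exact no971 hp
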